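/- Let d ≥ 2 and let P ⊆ ℝ^d be a full-dimensional bipartite convex polytope. Then at least one of the following holds: (a) d = 2 and P has an even number of vertices; (b) d = 3 and there exist a linear isometry T of ℝ³ and λ > 0 with P = λ • T(Q), where Q is the rhombic dodecahedron or the rhombic triacontahedron; (c) P is a Γ-permutahedron, i.e. there exist a finite reflection group Γ of ℝ^d and a point v generic for Γ with P equal to the convex hull of the orbit {T(v) : T ∈ Γ}. -/

import Mathlib

open Set Pointwise

noncomputable section

/-- Euclidean space `ℝ^d`. -/
abbrev Euc (d : ℕ) := EuclideanSpace ℝ (Fin d)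

/-- A convex polytope: the convex hull of a finite set of points. -/
def IsPolytope {d : ℕ} (P : Set (Euc d)) : Prop :=
  ∃ S : Finset (Euc d), P = convexHull ℝ (S : Set (Euc d))

/-- `P` is full-dimensional: its affine span is all of `ℝ^d`. -/
def FullDim {d : ℕ} (P : Set (Euc d)) : Prop :=
  affineSpan ℝ P = ⊤

/-- `[v,w]` is an edge of `P`: an exposed face of `P` which is a segment with `v ≠ w`. -/
def IsEdge {d : ℕ} (P : Set (Euc d)) (v w : Euc d) : Prop :=
  v ≠ w ∧ IsExposed ℝ P (segment ℝ v w)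

/-- `e` is an edge of `P`, as a set. -/
def IsEdgeSet {d : ℕ} (P e : Set (Euc d)) : Prop :=
  ∃ v w : Euc d, IsEdge P v w ∧ e = segment ℝ v w

/-- `T` is a symmetry of `P`: a linear isometry mapping `P` onto itself. -/
def IsAut {d : ℕ} (P : Set (Euc d)) (T : Euc d ≃ₗᵢ[ℝ] Euc d) : Prop :=
  T '' P = P

/-- `P` is vertex-transitive: any vertex (extreme point) can be mapped onto any
other by a symmetry of `P`. -/
def VertexTransitive {d : ℕ} (P : Set (Euc d)) : Prop :=
  ∀ v ∈ Set.extremePoints ℝ P, ∀ w ∈ Set.extremePoints ℝ P,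
    ∃ T : Euc d ≃ₗᵢ[ℝ] Euc d, IsAut P T ∧ T v = w

/-- `P` is edge-transitive: any edge can be mapped onto any other by a symmetry of `P`. -/
def EdgeTransitive {d : ℕ} (P : Set (Euc d)) : Prop :=
  ∀ e e' : Set (Euc d), IsEdgeSet P e → IsEdgeSet P e' →
    ∃ T : Euc d ≃ₗᵢ[ℝ] Euc d, IsAut P T ∧ T '' e = e'

/-- `P` is bipartite with vertex partition `V1, V2`, radii `r1 ≤ r2` and edge length `ℓ`:
all edges have length `ℓ`, every edge joins `V1` to `V2`, where `V1 ⊔ V2` is a partition of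
the vertex set, and vertices in `Vᵢ` have norm `rᵢ`. -/
def IsBipartiteWith {d : ℕ} (P V1 V2 : Set (Euc d)) (r1 r2 ℓ : ℝ) : Prop :=
  (0 < ℓ) ∧ (∀ v w : Euc d, IsEdge P v w → ‖v - w‖ = ℓ) ∧
  (V1 ∪ V2 = Set.extremePoints ℝ P) ∧ Disjoint V1 V2 ∧
  (∀ v w : Euc d, IsEdge P v w → (v ∈ V1 ∧ w ∈ V2) ∨ (v ∈ V2 ∧ w ∈ V1)) ∧
  (0 < r1) ∧ (r1 ≤ r2) ∧ (∀ v ∈ V1, ‖v‖ = r1) ∧ (∀ v ∈ V2, ‖v‖ = r2)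

/-- `P` is a bipartite polytope. -/
def IsBipartite {d : ℕ} (P : Set (Euc d)) : Prop :=
  ∃ (V1 V2 : Set (Euc d)) (r1 r2 ℓ : ℝ), IsBipartiteWith P V1 V2 r1 r2 ℓ

/-- `P` is a strictly bipartite polytope (`r1 < r2`). -/
def IsStrictlyBipartite {d : ℕ} (P : Set (Euc d)) : Prop :=
  ∃ (V1 V2 : Set (Euc d)) (r1 r2 ℓ : ℝ), IsBipartiteWith P V1 V2 r1 r2 ℓ ∧ r1 < r2

/-- The point `(a,b,c) ∈ ℝ³`. -/
def pt3 (a b c : ℝ) : Euc 3 := (WithLp.equiv 2 (Fin 3 → ℝ)).symm ![a, b, c]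

/-- The rhombic dodecahedron: the convex hull of the 14 points
`(±1,±1,±1)`, `(±2,0,0)`, `(0,±2,0)`, `(0,0,±2)`. -/
def rhombicDodecahedron : Set (Euc 3) :=
  convexHull ℝ
    ({pt3 1 1 1, pt3 1 1 (-1), pt3 1 (-1) 1, pt3 1 (-1) (-1),
      pt3 (-1) 1 1, pt3 (-1) 1 (-1), pt3 (-1) (-1) 1, pt3 (-1) (-1) (-1),
      pt3 2 0 0, pt3 (-2) 0 0, pt3 0 2 0, pt3 0 (-2) 0, pt3 0 0 2, pt3 0 0 (-2)} :
      Set (Euc 3))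

/-- The golden ratio `(1 + √5)/2`. -/
noncomputable def goldenR : ℝ := (1 + Real.sqrt 5) / 2

/-- All cyclic permutations of the coordinates of `(0, ±a, ±b)`. -/
def cycSigns (a b : ℝ) : Set (Euc 3) :=
  {x | ∃ s t : ℝ, (s = 1 ∨ s = -1) ∧ (t = 1 ∨ t = -1) ∧
    (x = pt3 0 (s * a) (t * b) ∨ x = pt3 (t * b) 0 (s * a) ∨ x = pt3 (s * a) (t * b) 0)}

/-- The 8 points `(±1,±1,±1)`. -/
def cubeVerts : Set (Euc 3) :=
  {x | ∃ s t u : ℝ, (s = 1 ∨ s = -1) ∧ (t = 1 ∨ t = -1) ∧ (u = 1 ∨ u = -1) ∧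
    x = pt3 s t u}

/-- The rhombic triacontahedron: the convex hull of the 32 points `(±1,±1,±1)`,
the cyclic permutations of the coordinates of `(0, ±1/φ, ±φ)`, and
the cyclic permutations of the coordinates of `(0, ±φ, ±1)`, where `φ` is the
golden ratio. -/
noncomputable def rhombicTriacontahedron : Set (Euc 3) :=
  convexHull ℝ (cubeVerts ∪ cycSigns (1 / goldenR) goldenR ∪ cycSigns goldenR 1)

/-- A reflection of `ℝ^d`: a non-identity involutive linear isometry whose fixed-point
subspace has dimension `d - 1`. -/
def IsLinearReflection {d : ℕ} (R : Euc d ≃ₗᵢ[ℝ] Euc d) : Prop :=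
  R ≠ 1 ∧ R * R = 1 ∧
  Module.finrank ℝ
    (LinearMap.ker ((R.toLinearEquiv : Euc d →ₗ[ℝ] Euc d) - LinearMap.id)) = d - 1

/-- A finite reflection group: a finite subgroup of the linear isometry group that is
generated by the reflections it contains. -/
def IsFiniteReflectionGroup {d : ℕ} (Γ : Subgroup (Euc d ≃ₗᵢ[ℝ] Euc d)) : Prop :=
  (Γ : Set (Euc d ≃ₗᵢ[ℝ] Euc d)).Finite ∧
  Γ = Subgroup.closure {R | IsLinearReflection R ∧ R ∈ Γ}

/-- `v` is generic for `Γ`: no non-identity element of `Γ` fixes `v`. -/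
def IsGenericFor {d : ℕ} (Γ : Subgroup (Euc d ≃ₗᵢ[ℝ] Euc d)) (v : Euc d) : Prop :=
  ∀ T ∈ Γ, T ≠ 1 → T v ≠ v

/-- `P` is the `Γ`-permutahedron with generic point `v`: the convex hull of the orbit of
`v` under `Γ`. -/
def IsPermutahedron {d : ℕ} (P : Set (Euc d)) : Prop :=
  ∃ (Γ : Subgroup (Euc d ≃ₗᵢ[ℝ] Euc d)) (v : Euc d),
    IsFiniteReflectionGroup Γ ∧ IsGenericFor Γ v ∧
    P = convexHull ℝ {x | ∃ T ∈ Γ, x = T v}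

namespace BipartitePolytope

open scoped InnerProductSpace

variable {E : Type*} [NormedAddCommGroup E] [InnerProductSpace ℝ E]

section

/-! ### Faces and edges of finite point sets -/

/-- Every point of `V` is an exposed point of the convex hull of `V`. -/
def ConvexPosition (V : Finset E) : Prop :=
  ∀ v ∈ V, ∃ z : E, ∀ u ∈ V, u ≠ v → ⟪z, u⟫_ℝ < ⟪z, v⟫_ℝ

/-- `v` and `w` are the endpoints of an edge of the convex hull of `V`. -/
def Adj (V : Finset E) (v w : E) : Prop :=
  v ∈ V ∧ w ∈ V ∧ v ≠ w ∧
    ∃ z : E, ⟪z, w⟫_ℝ = ⟪z, v⟫_ℝ ∧ ∀ u ∈ V, u ≠ v → u ≠ w → ⟪z, u⟫_ℝ < ⟪z, v⟫_ℝ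

/-- `T` is the set of points of `V` on a face of the convex hull of `V`. -/
def IsFace (V T : Finset E) : Prop :=
  T ⊆ V ∧ ∃ (z : E) (a : ℝ), (∀ u ∈ T, ⟪z, u⟫_ℝ = a) ∧ ∀ u ∈ V, u ∉ T → ⟪z, u⟫_ℝ < a

theorem Adj.symm {V : Finset E} {v w : E} (h : Adj V v w) : Adj V w v := by
  obtain ⟨hv, hw, hne, z, hz, h⟩ := h
  exact ⟨hw, hv, hne.symm, z, hz.symm, fun u hu h1 h2 => hz ▸ h u hu h2 h1⟩

theorem Adj.mono {V T : Finset E} {v w : E} (h : Adj V v w) (hT : T ⊆ V) (hv : v ∈ T)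
    (hw : w ∈ T) : Adj T v w := by
  obtain ⟨-, -, hne, z, hz, h⟩ := h
  exact ⟨hv, hw, hne, z, hz, fun u hu => h u (hT hu)⟩

theorem ConvexPosition.mono {V T : Finset E} (h : ConvexPosition V) (hT : T ⊆ V) :
    ConvexPosition T := fun v hv =>
  let ⟨z, hz⟩ := h v (hT hv)
  ⟨z, fun u hu => hz u (hT hu)⟩

theorem exists_scale {ι : Type*} (s : Finset ι) (f g : ι → ℝ) (hf : ∀ i ∈ s, f i < 0) :
    ∃ N : ℝ, 0 < N ∧ ∀ i ∈ s, N * f i + g i < 0 := by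
  have h : ∀ᶠ N : ℝ in Filter.atTop, ∀ i ∈ s, N * f i + g i < 0 := by
    rw [Filter.eventually_all_finset]
    intro i hi
    filter_upwards [Filter.eventually_gt_atTop (g i / (- f i))] with N hN
    rw [div_lt_iff₀ (by linarith [hf i hi])] at hN
    linarith
  obtain ⟨N, h1, h2⟩ := (h.and (Filter.eventually_gt_atTop 0)).exists
  exact ⟨N, h2, h1⟩

theorem IsFace.adj {V T : Finset E} (hT : IsFace V T) {v w : E} (h : Adj T v w) : Adj V v w := by
  classical
  obtain ⟨hTV, z0, a, h0, h0'⟩ := hT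
  obtain ⟨hv, hw, hne, z, hz, h⟩ := h
  obtain ⟨N, hN, hs⟩ := exists_scale (V \ T) (fun u => ⟪z0, u⟫_ℝ - a)
    (fun u => ⟪z, u⟫_ℝ - ⟪z, v⟫_ℝ) (by
      intro u hu
      rw [Finset.mem_sdiff] at hu
      linarith [h0' u hu.1 hu.2])
  refine ⟨hTV hv, hTV hw, hne, N • z0 + z, ?_, ?_⟩
  · simp only [inner_add_left, real_inner_smul_left, h0 v hv, h0 w hw, hz]
  · intro u hu h1 h2
    simp only [inner_add_left, real_inner_smul_left, h0 v hv]
    by_cases huT : u ∈ T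
    · rw [h0 u huT]
      linarith [h u huT h1 h2]
    · have := hs u (Finset.mem_sdiff.2 ⟨hu, huT⟩)
      linarith

/-- Tilting a functional exposing `v` until the face contains another vertex. -/
theorem exists_tilted_face {V : Finset E} {v u f g : E} (hv : v ∈ V)
    (hg : ∀ u ∈ V, u ≠ v → ⟪g, u⟫_ℝ < ⟪g, v⟫_ℝ) (hu : u ∈ V) (hf : ⟪f, v⟫_ℝ < ⟪f, u⟫_ℝ) :
    ∃ (μ : ℝ) (T : Finset E), 0 < μ ∧ IsFace V T ∧ v ∈ T ∧ (∃ w ∈ T, w ≠ v) ∧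
      ∀ w ∈ T, ⟪f, w⟫_ℝ - ⟪f, v⟫_ℝ = μ * (⟪g, v⟫_ℝ - ⟪g, w⟫_ℝ) := by
  classical
  have huv : u ≠ v := by rintro rfl; exact lt_irrefl _ hf
  obtain ⟨x, hx, hmax⟩ := (V.erase v).exists_max_image
    (fun x => (⟪f, x⟫_ℝ - ⟪f, v⟫_ℝ) / (⟪g, v⟫_ℝ - ⟪g, x⟫_ℝ)) ⟨u, Finset.mem_erase.2 ⟨huv, hu⟩⟩
  rw [Finset.mem_erase] at hx
  set μ := (⟪f, x⟫_ℝ - ⟪f, v⟫_ℝ) / (⟪g, v⟫_ℝ - ⟪g, x⟫_ℝ) with hμ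
  have hgx := hg x hx.2 hx.1
  have hle : ∀ w ∈ V, ⟪f, w⟫_ℝ - ⟪f, v⟫_ℝ ≤ μ * (⟪g, v⟫_ℝ - ⟪g, w⟫_ℝ) := by
    intro w hw
    by_cases hwv : w = v
    · subst hwv; simp
    · have := hmax w (Finset.mem_erase.2 ⟨hwv, hw⟩)
      rwa [div_le_iff₀ (by linarith [hg w hw hwv])] at this
  refine ⟨μ, V.filter (fun w => ⟪f, w⟫_ℝ - ⟪f, v⟫_ℝ = μ * (⟪g, v⟫_ℝ - ⟪g, w⟫_ℝ)), ?_,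
    ⟨Finset.filter_subset _ _, f + μ • g, ⟪f + μ • g, v⟫_ℝ, ?_, ?_⟩, ?_, ⟨x, ?_, hx.1⟩, ?_⟩
  · have h1 := hmax u (Finset.mem_erase.2 ⟨huv, hu⟩)
    refine lt_of_lt_of_le (div_pos ?_ ?_) h1
    · linarith
    · linarith [hg u hu huv]
  · intro w hw
    have := (Finset.mem_filter.1 hw).2
    simp only [inner_add_left, real_inner_smul_left]
    linarith
  · intro w hw hw'
    have h1 := hle w hw
    have h2 : ⟪f, w⟫_ℝ - ⟪f, v⟫_ℝ ≠ μ * (⟪g, v⟫_ℝ - ⟪g, w⟫_ℝ) := fun h =>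
      hw' (Finset.mem_filter.2 ⟨hw, h⟩)
    have := lt_of_le_of_ne h1 h2
    simp only [inner_add_left, real_inner_smul_left]
    linarith
  · simp [hv]
  · rw [Finset.mem_filter]
    refine ⟨hx.2, ?_⟩
    rw [hμ, div_mul_cancel₀]
    linarith
  · intro w hw
    exact (Finset.mem_filter.1 hw).2

/-- A vertex that does not maximize a functional has a neighbour with a larger value. -/
theorem ConvexPosition.exists_adj_gt {V : Finset E} (hV : ConvexPosition V) {v u f : E}
    (hv : v ∈ V) (hu : u ∈ V) (hf : ⟪f, v⟫_ℝ < ⟪f, u⟫_ℝ) :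
    ∃ w, Adj V v w ∧ ⟪f, v⟫_ℝ < ⟪f, w⟫_ℝ := by
  classical
  induction hn : V.card using Nat.strong_induction_on generalizing V u with
  | _ n ih =>
  have key : ∀ T, IsFace V T → v ∈ T → (∃ w ∈ T, ⟪f, v⟫_ℝ < ⟪f, w⟫_ℝ) → T ≠ V →
      ∃ w, Adj V v w ∧ ⟪f, v⟫_ℝ < ⟪f, w⟫_ℝ := by
    rintro T hT hvT ⟨x, hx, hfx⟩ hne
    have hlt : T.card < n := hn ▸ Finset.card_lt_card (lt_of_le_of_ne hT.1 hne)
    obtain ⟨w, hw, hw'⟩ := ih T.card hlt (hV.mono hT.1) hvT hx hfx rfl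
    exact ⟨w, hT.adj hw, hw'⟩
  obtain ⟨g, hg⟩ := hV v hv
  obtain ⟨μ, T, hμ, hT, hvT, ⟨x, hx, hxv⟩, h⟩ := exists_tilted_face hv hg hu hf
  by_cases hTV : T = V
  swap
  · refine key T hT hvT ⟨x, hx, ?_⟩ hTV
    have h1 := h x hx
    have := mul_pos hμ (sub_pos.2 (hg x (hT.1 hx) hxv))
    linarith
  subst hTV
  have hall : ∀ w ∈ T, w ≠ v → ⟪f, v⟫_ℝ < ⟪f, w⟫_ℝ := by
    intro w hw hwv
    have h1 := h w hw
    have := mul_pos hμ (sub_pos.2 (hg w hw hwv))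
    linarith
  have huv : u ≠ v := by rintro rfl; exact lt_irrefl _ hf
  by_cases h2 : ∃ y ∈ T, y ≠ v ∧ y ≠ u
  swap
  · push Not at h2
    exact ⟨u, ⟨hv, hu, huv.symm, 0, by simp, fun y hy h3 h4 => absurd (h2 y hy h3) h4⟩, hf⟩
  obtain ⟨y, hy, hyv, hyu⟩ := h2
  have key2 : ∀ a ∈ T, a ≠ v → (∃ w, Adj T v w ∧ ⟪f, v⟫_ℝ < ⟪f, w⟫_ℝ) ∨
      ∀ b ∈ T, b ≠ a → ⟪g, a⟫_ℝ < ⟪g, b⟫_ℝ := by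
    intro a ha hav
    obtain ⟨k, hk⟩ := hV a ha
    obtain ⟨ν, S, hν, hS, hvS, ⟨x', hx', hxv'⟩, h'⟩ := exists_tilted_face hv hg ha (hk v hv hav.symm)
    by_cases hST : S = T
    · right
      subst hST
      intro b hb hba
      have h3 := h' a ha
      have h4 := h' b hb
      have h5 := hk b hb hba
      have h6 : ν * ⟪g, a⟫_ℝ < ν * ⟪g, b⟫_ℝ := by linarith
      exact lt_of_mul_lt_mul_left h6 hν.le
    · left
      exact key S hS hvS ⟨x', hx', hall x' (hS.1 hx') hxv'⟩ hST
  rcases key2 u hu huv with h3 | h3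
  · exact h3
  rcases key2 y hy hyv with h4 | h4
  · exact h4
  exact absurd (h3 y hy hyu) (not_lt.2 (h4 u hu hyu.symm).le)

theorem ConvexPosition.le_of_adj {V : Finset E} (hV : ConvexPosition V) {v f : E} (hv : v ∈ V)
    (h : ∀ w, Adj V v w → ⟪f, w⟫_ℝ ≤ ⟪f, v⟫_ℝ) {u : E} (hu : u ∈ V) : ⟪f, u⟫_ℝ ≤ ⟪f, v⟫_ℝ := by
  by_contra! hlt
  obtain ⟨w, hw, hw'⟩ := hV.exists_adj_gt hv hu hlt
  exact absurd (h w hw) (not_le.2 hw')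

theorem ConvexPosition.lt_of_adj {V : Finset E} (hV : ConvexPosition V) {v f : E} (hv : v ∈ V)
    (h : ∀ w, Adj V v w → ⟪f, w⟫_ℝ < ⟪f, v⟫_ℝ) {u : E} (hu : u ∈ V) (huv : u ≠ v) :
    ⟪f, u⟫_ℝ < ⟪f, v⟫_ℝ := by
  classical
  refine lt_of_le_of_ne (hV.le_of_adj hv (fun w hw => (h w hw).le) hu) fun heq => ?_
  obtain ⟨g, hg⟩ := hV u hu
  obtain ⟨N, hN, hs⟩ := exists_scale (V.filter (Adj V v)) (fun w => ⟪f, w⟫_ℝ - ⟪f, v⟫_ℝ)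
    (fun w => ⟪g, w⟫_ℝ - ⟪g, v⟫_ℝ) (by
      intro w hw
      linarith [h w (Finset.mem_filter.1 hw).2])
  have h1 := hV.le_of_adj (f := N • f + g) hv (fun w hw => by
    have := hs w (Finset.mem_filter.2 ⟨hw.2.1, hw⟩)
    simp only [inner_add_left, real_inner_smul_left] at this ⊢
    linarith) hu
  have h2 := hg v hv huv.symm
  simp only [inner_add_left, real_inner_smul_left, heq] at h1
  linarith

/-- The edge graph is connected. -/
theorem ConvexPosition.mem_of_adj_closed {V : Finset E} (hV : ConvexPosition V) {C : Set E}
    (hC : ∀ v ∈ V, v ∈ C → ∀ w, Adj V v w → w ∈ C) {x : E} (hx : x ∈ V) (hxC : x ∈ C)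
    {u : E} (hu : u ∈ V) : u ∈ C := by
  classical
  by_contra huC
  obtain ⟨g, hg⟩ := hV u hu
  obtain ⟨v, hv, hmax⟩ := (V.filter (· ∈ C)).exists_max_image (fun x => ⟪g, x⟫_ℝ)
    ⟨x, Finset.mem_filter.2 ⟨hx, hxC⟩⟩
  rw [Finset.mem_filter] at hv
  obtain ⟨w, hw, hw'⟩ := hV.exists_adj_gt hv.1 hu
    (hg v hv.1 (by rintro rfl; exact huC hv.2))
  exact absurd (hmax w (Finset.mem_filter.2 ⟨hw.2.1, hC v hv.1 hv.2 w hw⟩)) (not_le.2 hw')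

/-- The differences from a vertex lie in the span of the edges at this vertex. -/
theorem ConvexPosition.sub_mem_span {V : Finset E} (hV : ConvexPosition V) {v u : E} (hv : v ∈ V)
    (hu : u ∈ V) : u - v ∈ Submodule.span ℝ {x | ∃ w, Adj V v w ∧ x = w - v} := by
  have hfin : ({x | ∃ w, Adj V v w ∧ x = w - v} : Set E).Finite :=
    (V.finite_toSet.image (· - v)).subset (by
      rintro x ⟨w, hw, rfl⟩
      exact ⟨w, hw.2.1, rfl⟩)
  have : FiniteDimensional ℝ (Submodule.span ℝ {x | ∃ w, Adj V v w ∧ x = w - v}) :=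
    FiniteDimensional.span_of_finite ℝ hfin
  rw [← Submodule.orthogonal_orthogonal (Submodule.span ℝ {x | ∃ w, Adj V v w ∧ x = w - v}),
    Submodule.mem_orthogonal]
  intro z hz
  rw [Submodule.mem_orthogonal'] at hz
  have h0 : ∀ w, Adj V v w → ⟪z, w⟫_ℝ = ⟪z, v⟫_ℝ := fun w hw => by
    have := hz (w - v) (Submodule.subset_span ⟨w, hw, rfl⟩)
    rwa [inner_sub_right, sub_eq_zero] at this
  have h1 := hV.le_of_adj (f := z) hv (fun w hw => (h0 w hw).le) hu
  have h2 := hV.le_of_adj (f := -z) hv (fun w hw => by simp [h0 w hw]) hu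
  simp only [inner_neg_left] at h2
  rw [inner_sub_right]
  linarith

theorem ConvexPosition.vectorSpan_eq {V : Finset E} (hV : ConvexPosition V) {v : E} (hv : v ∈ V) :
    vectorSpan ℝ (V : Set E) = Submodule.span ℝ {x | ∃ w, Adj V v w ∧ x = w - v} := by
  apply le_antisymm
  · rw [vectorSpan_eq_span_vsub_set_right ℝ (Finset.mem_coe.2 hv), Submodule.span_le]
    rintro _ ⟨u, hu, rfl⟩
    exact hV.sub_mem_span hv hu
  · rw [Submodule.span_le]
    rintro _ ⟨w, hw, rfl⟩
    exact vsub_mem_vectorSpan ℝ (Finset.mem_coe.2 hw.2.1) (Finset.mem_coe.2 hv)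

end

section

/-! ### Bipartite vertex configurations -/

/-- The vertex set `V` of a bipartite polytope; the colour classes are `V ∩ A` and `V \ A`, with
squared radii `p` and `q`, and `c` is the inner product of the endpoints of an edge. -/
structure Cfg (V : Finset E) (A : Set E) (p q c : ℝ) : Prop where
  pos : ConvexPosition V
  norm1 : ∀ v ∈ V, v ∈ A → ⟪v, v⟫_ℝ = p
  norm2 : ∀ v ∈ V, v ∉ A → ⟪v, v⟫_ℝ = q
  bip : ∀ v w, Adj V v w → (v ∈ A ↔ w ∉ A)
  inner : ∀ v w, Adj V v w → ⟪v, w⟫_ℝ = c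
  dim : 2 ≤ Module.finrank ℝ (vectorSpan ℝ (V : Set E))

theorem eq_of_inner_eq {x y : E} {a : ℝ} (hx : ⟪x, x⟫_ℝ = a) (hy : ⟪y, y⟫_ℝ = a)
    (h : a ≤ ⟪x, y⟫_ℝ) : x = y := by
  rw [← sub_eq_zero, ← real_inner_self_nonpos]
  simp only [inner_sub_left, inner_sub_right, real_inner_comm x y] at *
  linarith

namespace Cfg

variable {V : Finset E} {A : Set E} {p q c : ℝ}

theorem swap (h : Cfg V A p q c) : Cfg V Aᶜ q p c where
  pos := h.pos
  norm1 := h.norm2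
  norm2 v hv hA := h.norm1 v hv (not_not.1 hA)
  bip v w hvw := by
    have := h.bip v w hvw
    simp only [mem_compl_iff, not_not]
    tauto
  inner := h.inner
  dim := h.dim

theorem exists_adj (h : Cfg V A p q c) {v : E} (hv : v ∈ V) (x : E) :
    ∃ w, Adj V v w ∧ w ≠ x := by
  by_contra! hx
  have h1 := h.dim
  rw [h.pos.vectorSpan_eq hv] at h1
  have h2 : Submodule.span ℝ {y | ∃ w, Adj V v w ∧ y = w - v} ≤ Submodule.span ℝ {x - v} := by
    apply Submodule.span_mono
    rintro _ ⟨w, hw, rfl⟩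
    rw [hx w hw]
    rfl
  have h3 := Submodule.finrank_mono h2
  have h4 := finrank_span_finset_le_card (R := ℝ) {x - v}
  rw [Finset.coe_singleton, Finset.card_singleton, Set.finrank] at h4
  omega

theorem nonempty (h : Cfg V A p q c) : V.Nonempty := by
  rw [Finset.nonempty_iff_ne_empty]
  rintro rfl
  have := h.dim
  rw [Finset.coe_empty, vectorSpan_empty, finrank_bot] at this
  omega

theorem exists_mem (h : Cfg V A p q c) : ∃ v ∈ V, v ∈ A := by
  obtain ⟨v, hv⟩ := h.nonempty
  by_cases hA : v ∈ A
  · exact ⟨v, hv, hA⟩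
  · obtain ⟨w, hw, -⟩ := h.exists_adj hv v
    exact ⟨w, hw.2.1, by have := h.bip v w hw; tauto⟩

theorem c_lt_p (h : Cfg V A p q c) : c < p := by
  by_contra! hc
  obtain ⟨v, hv, hA⟩ := h.exists_mem
  obtain ⟨w, hw, -⟩ := h.exists_adj hv v
  obtain ⟨v', hv', hne⟩ := h.exists_adj hw.2.1 v
  have hA' : v' ∈ A := by
    have h1 := h.bip _ _ hw
    have h2 := h.bip _ _ hv'
    tauto
  have h1 := h.pos.le_of_adj (f := -v) hv (fun u hu => by
    rw [inner_neg_left, inner_neg_left, h.inner _ _ hu, h.norm1 v hv hA]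
    linarith) hv'.2.1
  rw [inner_neg_left, inner_neg_left, h.norm1 v hv hA, neg_le_neg_iff] at h1
  exact hne (eq_of_inner_eq (h.norm1 v hv hA) (h.norm1 v' hv'.2.1 hA') h1).symm

theorem c_lt_q (h : Cfg V A p q c) : c < q := h.swap.c_lt_p

theorem p_pos (h : Cfg V A p q c) : 0 < p := by
  obtain ⟨v, hv, hA⟩ := h.exists_mem
  have h1 := h.norm1 v hv hA
  rcases (real_inner_self_nonneg (x := v)).lt_or_eq with h2 | h2
  · linarith
  · obtain ⟨w, hw, -⟩ := h.exists_adj hv v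
    have h3 := h.inner _ _ hw
    rw [inner_self_eq_zero.1 h2.symm, inner_zero_left] at h3
    have := h.c_lt_p
    linarith

theorem q_pos (h : Cfg V A p q c) : 0 < q := h.swap.p_pos

theorem sub_pos (h : Cfg V A p q c) : 0 < p * q - c ^ 2 := by
  obtain ⟨v, hv, hA⟩ := h.exists_mem
  obtain ⟨w, hw, -⟩ := h.exists_adj hv v
  obtain ⟨w', hw', hne⟩ := h.exists_adj hv w
  have hp := h.p_pos
  by_contra! hc
  have key : ∀ u, Adj V v u → u = (c / p) • v := by
    intro u hu
    rw [← sub_eq_zero, ← real_inner_self_nonpos]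
    simp only [inner_sub_left, inner_sub_right, real_inner_smul_left,
      real_inner_smul_right, real_inner_comm v u, h.inner _ _ hu, h.norm1 v hv hA,
      h.norm2 u hu.2.1 ((h.bip _ _ hu).1 hA)]
    have h2 : q * p ≤ c * c := by linarith
    have : q ≤ c * c / p := (le_div_iff₀ hp).2 h2
    have e : c / p * p = c := by field_simp
    have e2 : c * c / p = c / p * c := by ring
    rw [e]
    linarith
  exact hne ((key w' hw').trans (key w hw).symm)

theorem inner_lt (h : Cfg V A p q c) {v u : E} (hv : v ∈ V) (hA : v ∈ A) (hu : u ∈ V)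
    (hne : u ≠ v) : ⟪v, u⟫_ℝ < p := by
  rw [← h.norm1 v hv hA]
  exact h.pos.lt_of_adj hv (fun w hw => by
    rw [h.inner _ _ hw, h.norm1 v hv hA]; exact h.c_lt_p) hu hne

/-- Among the vertices of the outer class, the neighbours of an inner vertex are the nearest. -/
theorem inner_le (h : Cfg V A p q c) (hpq : p ≤ q) {v w : E} (hv : v ∈ V) (hA : v ∈ A)
    (hw : w ∈ V) (hB : w ∉ A) : ⟪v, w⟫_ℝ ≤ c := by
  have hwv : w ≠ v := by rintro rfl; exact hB hA
  set X := ⟪v, w⟫_ℝ with hX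
  have hwX : ⟪w, v⟫_ℝ = X := real_inner_comm v w
  have hXp : X < p := h.inner_lt hv hA hw hwv
  have hp := h.p_pos
  have hcp := h.c_lt_p
  have hS := h.sub_pos
  have hvv := h.norm1 v hv hA
  have hww := h.norm2 w hw hB
  by_contra! hcX
  have hY : 0 ≤ q - X ^ 2 / p := by
    have := real_inner_self_nonneg (x := w - (X / p) • v)
    simp only [inner_sub_left, inner_sub_right, real_inner_smul_left,
      real_inner_smul_right, hwX, ← hX, hvv, hww] at this
    have e : q - X / p * X - (X / p * X - X / p * (X / p * p)) = q - X ^ 2 / p := by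
      field_simp; ring
    rwa [e] at this
  set Y := q - X ^ 2 / p with hYd
  set s := q - c ^ 2 / p with hsd
  have hs : 0 < s := by
    have : s = (p * q - c ^ 2) / p := by rw [hsd]; field_simp
    rw [this]; positivity
  set lam := -(Real.sqrt (s * Y) / (p - c)) with hlam
  have hpc : 0 < p - c := by linarith
  -- the functional
  have hnb : ∀ u, Adj V v u →
      ⟪w - (X / p) • v - lam • v, u⟫_ℝ ≤ ⟪w - (X / p) • v - lam • v, v⟫_ℝ := by
    intro u hu
    have huu := h.norm2 u hu.2.1 ((h.bip _ _ hu).1 hA)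
    have hvu := h.inner _ _ hu
    have hcs := real_inner_mul_inner_self_le (w - (X / p) • v) (u - (c / p) • v)
    have e1 : ⟪w - (X / p) • v, u - (c / p) • v⟫_ℝ = ⟪w, u⟫_ℝ - X * c / p := by
      simp only [inner_sub_left, inner_sub_right, real_inner_smul_left,
        real_inner_smul_right, hwX, hvv, hvu]
      field_simp; ring
    have e2 : ⟪w - (X / p) • v, w - (X / p) • v⟫_ℝ = Y := by
      simp only [inner_sub_left, inner_sub_right, real_inner_smul_left,
        real_inner_smul_right, hvv, hww, hwX, ← hX]
      rw [hYd]
      field_simp; ring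
    have e3 : ⟪u - (c / p) • v, u - (c / p) • v⟫_ℝ = s := by
      simp only [inner_sub_left, inner_sub_right, real_inner_smul_left,
        real_inner_smul_right, hvv, huu]
      rw [real_inner_comm v u, hvu, hsd]
      field_simp; ring
    rw [e1, e2, e3] at hcs
    have h1 : ⟪w, u⟫_ℝ - X * c / p ≤ Real.sqrt (s * Y) := by
      apply Real.le_sqrt_of_sq_le
      nlinarith
    have h2 : lam * (p - c) = - Real.sqrt (s * Y) := by
      rw [hlam]; field_simp
    have e4 : X / p * p = X := by field_simp
    simp only [inner_sub_left, real_inner_smul_left, hvv, hvu]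
    rw [hwX, e4]
    have e5 : X / p * c = X * c / p := by ring
    rw [e5]
    linarith
  have h1 := h.pos.le_of_adj hv hnb hw
  simp only [inner_sub_left, real_inner_smul_left, hvv, hww] at h1
  rw [hwX] at h1
  have e4 : X / p * p = X := by field_simp
  have e5 : X / p * X = X ^ 2 / p := by ring
  rw [e4, e5, hlam] at h1
  have h2 : Y * (p - c) ≤ Real.sqrt (s * Y) * (p - X) := by
    have : Y ≤ Real.sqrt (s * Y) / (p - c) * (p - X) := by rw [hYd]; linarith
    calc Y * (p - c) ≤ Real.sqrt (s * Y) / (p - c) * (p - X) * (p - c) :=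
          mul_le_mul_of_nonneg_right this hpc.le
      _ = _ := by field_simp
  have hYpos : 0 < Y := by
    have hX2 : X ^ 2 < p * q := by
      rcases le_or_gt 0 X with h0 | h0
      · nlinarith
      · nlinarith
    have : Y = (p * q - X ^ 2) / p := by rw [hYd]; field_simp
    rw [this]
    apply div_pos _ hp
    linarith
  have h3 : Y * (p - c) ^ 2 ≤ s * (p - X) ^ 2 := by
    have h4 : (Y * (p - c)) ^ 2 ≤ (Real.sqrt (s * Y) * (p - X)) ^ 2 :=
      pow_le_pow_left₀ (by positivity) h2 2
    rw [mul_pow (Real.sqrt _), Real.sq_sqrt (by positivity)] at h4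
    have : Y * (Y * (p - c) ^ 2) ≤ Y * (s * (p - X) ^ 2) := by linarith
    exact le_of_mul_le_mul_left this hYpos
  have h5 : (p * q - X ^ 2) * (p - c) ^ 2 ≤ (p * q - c ^ 2) * (p - X) ^ 2 := by
    have e6 : p * Y = p * q - X ^ 2 := by rw [hYd]; field_simp
    have e7 : p * s = p * q - c ^ 2 := by rw [hsd]; field_simp
    rw [← e6, ← e7]
    nlinarith
  have h6 : 0 < p * (X - c) * (q * (2 * p - c - X) - p * (X + c) + 2 * c * X) := by
    apply mul_pos (mul_pos hp (by linarith))
    have : p * (2 * p - c - X) ≤ q * (2 * p - c - X) :=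
      mul_le_mul_of_nonneg_right hpq (by linarith)
    nlinarith [mul_pos hpc (show 0 < p - X by linarith)]
  nlinarith

end Cfg

end

section

/-! ### Translating a face to its centre -/

/-- The translate `V - m`. -/
def shift {F : Type*} [AddGroup F] (V : Finset F) (m : F) : Finset F := V.map (Equiv.subRight m).toEmbedding

theorem mem_shift {F : Type*} [AddGroup F] {V : Finset F} {m x : F} : x ∈ shift V m ↔ x + m ∈ V := by
  simp only [shift, Finset.mem_map_equiv]
  rfl

theorem sub_mem_shift {F : Type*} [AddGroup F] {V : Finset F} {m x : F} : x - m ∈ shift V m ↔ x ∈ V := by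
  rw [mem_shift, sub_add_cancel]

theorem adj_shift {V : Finset E} {m x y : E} : Adj (shift V m) x y ↔ Adj V (x + m) (y + m) := by
  simp only [Adj, mem_shift, ne_eq, add_left_inj]
  refine and_congr_right fun _ => and_congr_right fun _ => and_congr_right fun _ =>
    exists_congr fun z => and_congr (by simp [inner_add_right]) ⟨fun h u hu h1 h2 => ?_,
      fun h u hu h1 h2 => ?_⟩
  · have := h (u - m) (by rwa [sub_add_cancel]) (by rintro rfl; simp at h1)
      (by rintro rfl; simp at h2)
    rw [inner_sub_right] at this
    rw [inner_add_right]
    linarith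
  · have := h (u + m) hu (by simpa using h1) (by simpa using h2)
    simp only [inner_add_right] at this
    linarith

theorem convexPosition_shift {V : Finset E} {m : E} (h : ConvexPosition V) :
    ConvexPosition (shift V m) := by
  intro v hv
  obtain ⟨z, hz⟩ := h _ (mem_shift.1 hv)
  refine ⟨z, fun u hu huv => ?_⟩
  have := hz _ (mem_shift.1 hu) (by simpa using huv)
  simp only [inner_add_right] at this
  linarith

theorem vectorSpan_shift {V : Finset E} {m : E} :
    vectorSpan ℝ (shift V m : Set E) = vectorSpan ℝ (V : Set E) := by
  have : (shift V m : Set E) -ᵥ (shift V m : Set E) = (V : Set E) -ᵥ (V : Set E) := by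
    ext x
    simp only [Set.mem_vsub, Finset.mem_coe, mem_shift, vsub_eq_sub]
    constructor
    · rintro ⟨a, ha, b, hb, rfl⟩
      exact ⟨_, ha, _, hb, by abel⟩
    · rintro ⟨a, ha, b, hb, rfl⟩
      exact ⟨a - m, by simpa, b - m, by simpa, by abel⟩
  rw [vectorSpan, vectorSpan, this]

theorem Cfg.face_center [FiniteDimensional ℝ E] {V T : Finset E} {A : Set E} {p q c : ℝ}
    (h : Cfg V A p q c) (hT : IsFace V T)
    (hdim : 2 ≤ Module.finrank ℝ (vectorSpan ℝ (T : Set E))) :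
    ∃ m : E, (∀ u ∈ T, u - m ∈ vectorSpan ℝ (T : Set E)) ∧
      (∀ x ∈ vectorSpan ℝ (T : Set E), ⟪m, x⟫_ℝ = 0) ∧
      Cfg (shift T m) {x | x + m ∈ A} (p - ⟪m, m⟫_ℝ) (q - ⟪m, m⟫_ℝ) (c - ⟪m, m⟫_ℝ) := by
  have hne : T.Nonempty := by
    rw [Finset.nonempty_iff_ne_empty]
    rintro rfl
    rw [Finset.coe_empty, vectorSpan_empty, finrank_bot] at hdim
    omega
  obtain ⟨u0, hu0⟩ := hne
  set W := vectorSpan ℝ (T : Set E) with hW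
  set m := u0 - W.starProjection u0 with hm
  have hmo : ∀ x ∈ W, ⟪m, x⟫_ℝ = 0 := fun x hx =>
    Submodule.inner_left_of_mem_orthogonal hx (Submodule.sub_starProjection_mem_orthogonal u0)
  have hmem : ∀ u ∈ T, u - m ∈ W := by
    intro u hu
    have h1 : u - u0 ∈ W := vsub_mem_vectorSpan ℝ (Finset.mem_coe.2 hu) (Finset.mem_coe.2 hu0)
    have h2 : W.starProjection u0 ∈ W := Submodule.starProjection_apply_mem _ _
    have : u - m = (u - u0) + W.starProjection u0 := by rw [hm]; abel
    rw [this]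
    exact W.add_mem h1 h2
  have hin : ∀ u ∈ T, ⟪m, u⟫_ℝ = ⟪m, m⟫_ℝ := by
    intro u hu
    have := hmo _ (hmem u hu)
    rwa [inner_sub_right, sub_eq_zero] at this
  have hin2 : ∀ x, x + m ∈ T → ⟪m, x⟫_ℝ = 0 := fun x hx => by
    have := hin _ hx
    rw [inner_add_right] at this
    linarith
  refine ⟨m, hmem, hmo, convexPosition_shift (h.pos.mono hT.1), ?_, ?_, ?_, ?_, ?_⟩
  · intro v hv hA
    rw [mem_shift] at hv
    have := h.norm1 _ (hT.1 hv) hA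
    simp only [inner_add_left, inner_add_right, real_inner_comm m v, hin2 v hv] at this
    have h2 := real_inner_comm m v
    linarith [hin2 v hv]
  · intro v hv hA
    rw [mem_shift] at hv
    have := h.norm2 _ (hT.1 hv) hA
    simp only [inner_add_left, inner_add_right] at this
    have h2 := real_inner_comm m v
    linarith [hin2 v hv]
  · intro v w hvw
    exact h.bip _ _ (hT.adj (adj_shift.1 hvw))
  · intro v w hvw
    rw [adj_shift] at hvw
    have := h.inner _ _ (hT.adj hvw)
    simp only [inner_add_left, inner_add_right] at this
    have h2 := real_inner_comm m v
    linarith [hin2 v hvw.1, hin2 w hvw.2.1]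
  · rwa [vectorSpan_shift]

/-! ### Polygons -/

/-- A point of an equiangular polygon with centre `m` and alternating radii `a` and `b`. -/
def polyPt (m f g : E) (a b θ : ℝ) (j : ℤ) : E :=
  m + (if Even j then a else b) • (Real.cos (j * θ) • f + Real.sin (j * θ) • g)

theorem inner_polyPt {f g : E} {a b θ : ℝ} (hf : ⟪f, f⟫_ℝ = 1) (hg : ⟪g, g⟫_ℝ = 1)
    (hfg : ⟪f, g⟫_ℝ = 0) (i j : ℤ) :
    ⟪polyPt 0 f g a b θ i, polyPt 0 f g a b θ j⟫_ℝ =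
      (if Even i then a else b) * (if Even j then a else b) * Real.cos ((j - i : ℤ) * θ) := by
  have hgf : ⟪g, f⟫_ℝ = 0 := by rw [real_inner_comm, hfg]
  simp only [polyPt, zero_add, inner_add_left, inner_add_right, real_inner_smul_left,
    real_inner_smul_right, hf, hg, hfg, hgf]
  push_cast
  rw [sub_mul, Real.cos_sub]
  ring

/-- A vector of the plane is determined up to reflection by its length and its inner product with
a given polygon vertex. -/
theorem eq_polyPt_or {f g x : E} {a b θ r : ℝ} (hf : ⟪f, f⟫_ℝ = 1) (hg : ⟪g, g⟫_ℝ = 1)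
    (hfg : ⟪f, g⟫_ℝ = 0) (hx : x ∈ Submodule.span ℝ {f, g}) (j : ℤ)
    (hr : r = if Even (j + 1) then a else b) (hxx : ⟪x, x⟫_ℝ = r ^ 2)
    (hin : ⟪Real.cos (j * θ) • f + Real.sin (j * θ) • g, x⟫_ℝ = r * Real.cos θ) :
    x = polyPt 0 f g a b θ (j - 1) ∨ x = polyPt 0 f g a b θ (j + 1) := by
  have hgf : ⟪g, f⟫_ℝ = 0 := by rw [real_inner_comm, hfg]
  have hpar : Even (j - 1) ↔ Even (j + 1) := by
    rw [Int.even_sub_one, Int.even_add_one]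
  obtain ⟨s, t, rfl⟩ := Submodule.mem_span_pair.1 hx
  simp only [inner_add_left, inner_add_right, real_inner_smul_left,
    real_inner_smul_right, hf, hg, hfg, hgf] at hxx hin
  set C := Real.cos (j * θ) with hC
  set S := Real.sin (j * θ) with hS
  have hCS : S ^ 2 + C ^ 2 = 1 := Real.sin_sq_add_cos_sq _
  have hθ := Real.sin_sq_add_cos_sq θ
  have h1 : s * C + t * S = r * Real.cos θ := by linarith
  have h2 : (t * C - s * S) ^ 2 = (r * Real.sin θ) ^ 2 := by
    have e : (t * C - s * S) ^ 2 + (s * C + t * S) ^ 2 = (s ^ 2 + t ^ 2) * (S ^ 2 + C ^ 2) := by ring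
    rw [hCS, h1] at e
    have : s ^ 2 + t ^ 2 = r ^ 2 := by linarith
    rw [this] at e
    linear_combination e - r ^ 2 * hθ
  rcases sq_eq_sq_iff_eq_or_eq_neg.1 h2 with h3 | h3
  · right
    rw [polyPt, ← hr]
    push_cast
    rw [add_mul, one_mul, Real.cos_add, Real.sin_add, ← hC, ← hS]
    have es : s = r * (C * Real.cos θ - S * Real.sin θ) := by
      linear_combination -s * hCS + C * h1 - S * h3
    have et : t = r * (S * Real.cos θ + C * Real.sin θ) := by
      linear_combination -t * hCS + S * h1 + C * h3
    rw [zero_add, smul_add, smul_smul, smul_smul, ← es, ← et]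
  · left
    rw [polyPt, if_congr hpar rfl rfl, ← hr]
    push_cast
    rw [sub_mul, one_mul, Real.cos_sub, Real.sin_sub, ← hC, ← hS]
    have es : s = r * (C * Real.cos θ + S * Real.sin θ) := by
      linear_combination -s * hCS + C * h1 - S * h3
    have et : t = r * (S * Real.cos θ - C * Real.sin θ) := by
      linear_combination -t * hCS + S * h1 + C * h3
    rw [zero_add, smul_add, smul_smul, smul_smul, ← es, ← et]

/-- `T` is the vertex set of the `2 k`-gon with centre `m` in the directions `f, g`. -/
structure IsPolygon (T : Finset E) (A : Set E) (a b : ℝ) (k : ℕ) (m f g : E) : Prop where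
  two_le : 2 ≤ k
  ff : ⟪f, f⟫_ℝ = 1
  gg : ⟪g, g⟫_ℝ = 1
  fg : ⟪f, g⟫_ℝ = 0
  mf : ⟪m, f⟫_ℝ = 0
  mg : ⟪m, g⟫_ℝ = 0
  mem : ∀ j, polyPt m f g a b (Real.pi / k) j ∈ T
  memA : ∀ j, polyPt m f g a b (Real.pi / k) j ∈ A ↔ Even j
  surj : ∀ u ∈ T, ∃ j, u = polyPt m f g a b (Real.pi / k) j
  adj : ∀ j x, Adj T (polyPt m f g a b (Real.pi / k) j) x ↔
    x = polyPt m f g a b (Real.pi / k) (j - 1) ∨ x = polyPt m f g a b (Real.pi / k) (j + 1)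

/-- A polygon with all odd chords at least as long as an edge closes up after one turn. -/
theorem exists_eq_pi_div {θ : ℝ} (h0 : 0 < θ) (h1 : θ < Real.pi)
    (hodd : ∀ m : ℤ, Odd m → Real.cos (m * θ) ≤ Real.cos θ) {i : ℤ} (hi : i ≠ 0)
    (hper : ∃ n : ℤ, i * θ = n * (2 * Real.pi)) : ∃ k : ℕ, 2 ≤ k ∧ θ = Real.pi / k := by
  obtain ⟨n, hn⟩ := hper
  have hπ := Real.pi_pos
  set r : ℚ := 2 * n / i with hr
  have hθ : θ = Real.pi * r := by
    have hi' : (i : ℝ) ≠ 0 := by exact_mod_cast hi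
    rw [hr]
    push_cast
    field_simp
    linarith
  have hden : (0 : ℝ) < r.den := by exact_mod_cast r.den_pos
  have hrr : (r : ℝ) * r.den = r.num := by exact_mod_cast Rat.mul_den_eq_num r
  have hθd : θ * r.den = Real.pi * r.num := by rw [hθ, mul_assoc, hrr]
  have hnum0 : 0 < r.num := by
    have : 0 < Real.pi * (r.num : ℝ) := by rw [← hθd]; positivity
    exact_mod_cast pos_of_mul_pos_right this hπ.le
  have hnumlt : r.num < r.den := by
    have : Real.pi * (r.num : ℝ) < Real.pi * r.den := by
      rw [← hθd]; exact mul_lt_mul_of_pos_right h1 hden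
    exact_mod_cast lt_of_mul_lt_mul_left this hπ.le
  have hcop : IsCoprime r.num (r.den : ℤ) := by
    rw [Int.isCoprime_iff_gcd_eq_one]
    exact r.reduced
  rcases Int.even_or_odd r.num with he | ho
  · exfalso
    have hdo : Odd (r.den : ℤ) := by
      by_contra hd
      rw [Int.not_odd_iff_even] at hd
      have := hcop.isUnit_of_dvd' he.two_dvd hd.two_dvd
      simp [Int.isUnit_iff] at this
    have h2 := hodd r.den hdo
    obtain ⟨s, hs⟩ := he
    have : ((r.den : ℤ) : ℝ) * θ = s * (2 * Real.pi) := by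
      push_cast
      rw [mul_comm, hθd, hs]
      push_cast
      ring
    rw [this, Real.cos_int_mul_two_pi] at h2
    have h3 : Real.cos θ < Real.cos 0 := Real.cos_lt_cos_of_nonneg_of_le_pi le_rfl h1.le h0
    rw [Real.cos_zero] at h3
    linarith
  · have hcop2 : IsCoprime r.num (2 * (r.den : ℤ)) := by
      apply IsCoprime.mul_right _ hcop
      obtain ⟨s, hs⟩ := ho
      exact ⟨1, -s, by rw [hs]; ring⟩
    obtain ⟨s, t, hst⟩ := hcop2
    have hs : Odd s := by
      by_contra hs
      rw [Int.not_odd_iff_even] at hs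
      have h2 : Even (s * r.num + t * (2 * r.den)) :=
        (hs.mul_right _).add ((even_two_mul _).mul_left _)
      rw [hst] at h2
      exact absurd h2 (by decide)
    have h2 := hodd s hs
    have e : (s : ℝ) * θ = Real.pi / r.den - (t : ℤ) * (2 * Real.pi) := by
      have h3 : (s : ℝ) * r.num + t * (2 * r.den) = 1 := by exact_mod_cast hst
      have h4 : θ = Real.pi * r.num / r.den := by field_simp; linarith
      rw [h4]
      field_simp
      linarith
    rw [e, Real.cos_sub_int_mul_two_pi] at h2
    have hle : θ ≤ Real.pi / r.den := by
      by_contra! hlt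
      have := Real.cos_lt_cos_of_nonneg_of_le_pi (by positivity) h1.le hlt
      linarith
    have h5 : Real.pi * (r.num : ℝ) ≤ Real.pi * 1 := by
      rw [← hθd, mul_one]; exact (le_div_iff₀ hden).1 hle
    have h6 : r.num ≤ 1 := by exact_mod_cast le_of_mul_le_mul_left h5 hπ
    have h7 : r.num = 1 := by omega
    refine ⟨r.den, by omega, ?_⟩
    rw [eq_div_iff hden.ne', hθd, h7]
    simp

end

section

theorem mem_span_pair_of_orthonormal {W : Submodule ℝ E} (hW : Module.finrank ℝ W = 2) {f g : E}
    (hf : f ∈ W) (hg : g ∈ W) (hff : ⟪f, f⟫_ℝ = 1) (hgg : ⟪g, g⟫_ℝ = 1) (hfg : ⟪f, g⟫_ℝ = 0)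
    {x : E} (hx : x ∈ W) : x ∈ Submodule.span ℝ {f, g} := by
  have : FiniteDimensional ℝ W := Module.finite_of_finrank_pos (by omega)
  have hle : Submodule.span ℝ {f, g} ≤ W := by
    rw [Submodule.span_le]
    rintro y (rfl | rfl)
    · exact hf
    · exact hg
  have hli : LinearIndependent ℝ ![f, g] := by
    rw [LinearIndependent.pair_iff]
    intro s t hst
    have h1 := congrArg (fun y => ⟪f, y⟫_ℝ) hst
    have h2 := congrArg (fun y => ⟪g, y⟫_ℝ) hst
    have hgf : ⟪g, f⟫_ℝ = 0 := by rw [real_inner_comm, hfg]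
    simp only [inner_add_right, real_inner_smul_right, hff, hgg, hfg, hgf, inner_zero_right] at h1 h2
    constructor <;> linarith
  have h2 := finrank_span_eq_card hli
  rw [Matrix.range_cons, Matrix.range_cons, Matrix.range_empty, Set.union_empty,
    Set.singleton_union] at h2
  rw [Submodule.eq_of_le_of_finrank_eq hle (by rw [h2, hW]; simp)]
  exact hx

theorem Cfg.exists_polygon_centered {V : Finset E} {A : Set E} {p q c : ℝ}
    (h : Cfg V A p q c) (hpq : p ≤ q) (hW : ∀ u ∈ V, u ∈ vectorSpan ℝ (V : Set E))
    (hdim : Module.finrank ℝ (vectorSpan ℝ (V : Set E)) = 2) {v w : E} (hvw : Adj V v w)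
    (hvA : v ∈ A) : ∃ (k : ℕ) (f g : E), IsPolygon V A (√p) (√q) k 0 f g ∧
      polyPt 0 f g (√p) (√q) (Real.pi / k) 0 = v ∧ polyPt 0 f g (√p) (√q) (Real.pi / k) 1 = w ∧
      c = √p * √q * Real.cos (Real.pi / k) ∧
      f ∈ vectorSpan ℝ (V : Set E) ∧ g ∈ vectorSpan ℝ (V : Set E) := by
  have hp := h.p_pos
  have hq := h.q_pos
  have hS := h.sub_pos
  have hsp : 0 < √p := Real.sqrt_pos.2 hp
  have hsq : 0 < √q := Real.sqrt_pos.2 hq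
  have hpp := Real.sq_sqrt hp.le
  have hqq := Real.sq_sqrt hq.le
  have hvV := hvw.1
  have hwV := hvw.2.1
  have hwA : w ∉ A := (h.bip _ _ hvw).1 hvA
  have hvv := h.norm1 v hvV hvA
  have hww := h.norm2 w hwV hwA
  have hin := h.inner _ _ hvw
  set y := c / (√p * √q) with hy
  have hcy : c = √p * √q * y := by rw [hy]; field_simp
  have hy2 : y ^ 2 < 1 := by
    have : y ^ 2 = c ^ 2 / (p * q) := by rw [hy, div_pow, mul_pow, hpp, hqq]
    rw [this, div_lt_one (by positivity)]
    linarith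
  have hy1 : -1 < y ∧ y < 1 := by
    rw [← abs_lt]; exact (sq_lt_one_iff_abs_lt_one _).1 hy2
  set θ := Real.arccos y with hθ
  have hcos : Real.cos θ = y := Real.cos_arccos hy1.1.le hy1.2.le
  have hθ0 : 0 < θ := Real.arccos_pos.2 hy1.2
  have hθπ : θ < Real.pi := by
    refine lt_of_le_of_ne (Real.arccos_le_pi y) fun he => ?_
    rw [he, Real.cos_pi] at hcos
    linarith [hy1.1]
  have hsin : 0 < Real.sin θ := Real.sin_pos_of_pos_of_lt_pi hθ0 hθπ
  have hsc := Real.sin_sq_add_cos_sq θ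
  set f := (√p)⁻¹ • v with hf
  set g := (√q * Real.sin θ)⁻¹ • (w - (√q * Real.cos θ) • f) with hg
  have hff : ⟪f, f⟫_ℝ = 1 := by
    rw [hf, real_inner_smul_left, real_inner_smul_right, hvv]
    field_simp
    exact hpp.symm
  have hfw : ⟪f, w⟫_ℝ = √q * Real.cos θ := by
    rw [hf, real_inner_smul_left, hin, hcy, hcos]
    field_simp
  have hwf : ⟪w, f⟫_ℝ = √q * Real.cos θ := by rw [real_inner_comm, hfw]
  have hfg : ⟪f, g⟫_ℝ = 0 := by
    rw [hg, real_inner_smul_right, inner_sub_right, real_inner_smul_right, hff, hfw]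
    ring
  have hgg : ⟪g, g⟫_ℝ = 1 := by
    rw [hg]
    simp only [real_inner_smul_right, real_inner_smul_left, inner_sub_right, inner_sub_left, hff,
      hfw, hwf, hww]
    field_simp
    linear_combination -√q ^ 2 * hsc - hqq
  set Z : ℤ → E := polyPt 0 f g (√p) (√q) θ with hZ
  have hZ0 : Z 0 = v := by
    simp [hZ, polyPt, hf, smul_smul, hsp.ne']
  have hZ1 : Z 1 = w := by
    have : √q * Real.sin θ ≠ 0 := by positivity
    simp only [hZ, polyPt, show ¬ Even (1 : ℤ) by decide, if_false, Int.cast_one, one_mul, zero_add,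
      smul_add, smul_smul]
    rw [hg, smul_smul (√q * Real.sin θ), mul_inv_cancel₀ this, one_smul, hf, smul_smul]
    abel
  have hfW : f ∈ vectorSpan ℝ (V : Set E) := Submodule.smul_mem _ _ (hW v hvV)
  have hgW : g ∈ vectorSpan ℝ (V : Set E) :=
    Submodule.smul_mem _ _ (Submodule.sub_mem _ (hW w hwV) (Submodule.smul_mem _ _ hfW))
  have hspan : ∀ u ∈ V, u ∈ Submodule.span ℝ {f, g} := fun u hu =>
    mem_span_pair_of_orthonormal hdim hfW hgW hff hgg hfg (hW u hu)
  -- neighbours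
  have hnb : ∀ j, Z j ∈ V → (Z j ∈ A ↔ Even j) → ∀ x, Adj V (Z j) x →
      x = Z (j - 1) ∨ x = Z (j + 1) := by
    intro j hj hjA x hx
    have h1 := h.inner _ _ hx
    have h2 := h.bip _ _ hx
    refine eq_polyPt_or (r := if Even (j + 1) then √p else √q) hff hgg hfg (hspan x hx.2.1) j rfl ?_ ?_
    · by_cases hj' : Even j
      · rw [if_neg (by rw [Int.even_add_one]; simpa using hj'), hqq]
        exact h.norm2 x hx.2.1 (h2.1 (hjA.2 hj'))
      · rw [if_pos (by rw [Int.even_add_one]; exact hj'), hpp]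
        exact h.norm1 x hx.2.1 (by tauto)
    · simp only [hZ, polyPt, zero_add, real_inner_smul_left] at h1
      rw [hcos]
      by_cases hj' : Even j
      · rw [if_neg (by rw [Int.even_add_one]; simpa using hj')]
        rw [if_pos hj', hcy] at h1
        apply mul_left_cancel₀ hsp.ne'
        linarith
      · rw [if_pos (by rw [Int.even_add_one]; exact hj')]
        rw [if_neg hj', hcy] at h1
        apply mul_left_cancel₀ hsq.ne'
        linarith
  have hadj : ∀ j, Z j ∈ V → (Z j ∈ A ↔ Even j) → Adj V (Z j) (Z (j - 1)) ∧ Adj V (Z j) (Z (j + 1)) := by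
    intro j hj hjA
    obtain ⟨x, hx, hne⟩ := h.exists_adj hj (Z (j - 1))
    obtain ⟨x', hx', hne'⟩ := h.exists_adj hj (Z (j + 1))
    have e := (hnb j hj hjA x hx).resolve_left hne
    have e' := (hnb j hj hjA x' hx').resolve_right hne'
    exact ⟨e' ▸ hx', e ▸ hx⟩
  have hall : ∀ j, Z j ∈ V ∧ (Z j ∈ A ↔ Even j) := by
    have hstep : ∀ i j, (j = i - 1 ∨ j = i + 1) → Z i ∈ V ∧ (Z i ∈ A ↔ Even i) →
        Z j ∈ V ∧ (Z j ∈ A ↔ Even j) := by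
      intro i j hij hi
      have h1 := hadj i hi.1 hi.2
      have h2 : Adj V (Z i) (Z j) := by
        rcases hij with rfl | rfl
        · exact h1.1
        · exact h1.2
      have h3 := h.bip _ _ h2
      have h4 : Even j ↔ ¬ Even i := by
        rcases hij with rfl | rfl
        · exact Int.even_sub_one
        · exact Int.even_add_one
      exact ⟨h2.2.1, by tauto⟩
    intro j
    induction j using Int.induction_on with
    | zero => rw [hZ0]; exact ⟨hvV, by simp [hvA]⟩
    | succ i ih => exact hstep i _ (Or.inr rfl) ih
    | pred i ih => exact hstep (-i) _ (Or.inl rfl) ih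
  -- the angle
  have hodd : ∀ m : ℤ, Odd m → Real.cos (m * θ) ≤ Real.cos θ := by
    intro m hm
    have hm' : ¬ Even m := by simpa using hm
    have h1 := h.inner_le hpq hvV hvA (hall m).1 (fun hA => hm' ((hall m).2.1 hA))
    rw [← hZ0, hZ, inner_polyPt hff hgg hfg, if_pos (by decide), if_neg hm', sub_zero, hcy] at h1
    rw [hcos]
    exact le_of_mul_le_mul_left h1 (by positivity)
  obtain ⟨i, j, hij, hZij⟩ : ∃ i j, i ≠ j ∧ Z i = Z j := by
    have := Finite.exists_ne_map_eq_of_infinite (fun i : ℤ => (⟨Z i, (hall i).1⟩ : {x // x ∈ V}))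
    obtain ⟨i, j, h1, h2⟩ := this
    exact ⟨i, j, h1, congrArg Subtype.val h2⟩
  have hper : ∃ n : ℤ, ((j - i : ℤ) : ℝ) * θ = n * (2 * Real.pi) := by
    have hpar : Even i ↔ Even j := by rw [← (hall i).2, ← (hall j).2, hZij]
    have h1 : ⟪Z i, Z i⟫_ℝ = ⟪Z i, Z j⟫_ℝ := by rw [← hZij]
    rw [hZ, inner_polyPt hff hgg hfg, inner_polyPt hff hgg hfg, sub_self, Int.cast_zero, zero_mul,
      Real.cos_zero, if_congr hpar rfl rfl] at h1
    have hne : (if Even j then √p else √q) * (if Even j then √p else √q) ≠ 0 := by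
      split_ifs <;> positivity
    have h2 := mul_left_cancel₀ hne h1
    obtain ⟨n, hn⟩ := (Real.cos_eq_one_iff _).1 h2.symm
    exact ⟨n, hn.symm⟩
  obtain ⟨k, hk, hθk⟩ := exists_eq_pi_div hθ0 hθπ hodd (sub_ne_zero.2 hij.symm) hper
  have hsurj : ∀ u ∈ V, ∃ j, u = Z j := by
    intro u hu
    refine h.pos.mem_of_adj_closed (C := {u | ∃ j, u = Z j}) ?_ hvV ⟨0, hZ0.symm⟩ hu
    rintro _ - ⟨j, rfl⟩ x hx
    rcases hnb j (hall j).1 (hall j).2 x hx with h1 | h1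
    · exact ⟨_, h1⟩
    · exact ⟨_, h1⟩
  refine ⟨k, f, g, ⟨hk, hff, hgg, hfg, inner_zero_left _, inner_zero_left _, ?_, ?_, ?_, ?_⟩,
    ?_, ?_, ?_, hfW, hgW⟩ <;> rw [← hθk]
  · exact fun j => (hall j).1
  · exact fun j => (hall j).2
  · exact hsurj
  · intro j x
    refine ⟨hnb j (hall j).1 (hall j).2 x, ?_⟩
    rintro (rfl | rfl)
    · exact (hadj j (hall j).1 (hall j).2).1
    · exact (hadj j (hall j).1 (hall j).2).2
  · exact hZ0
  · exact hZ1
  · rw [hcos]; exact hcy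

theorem polyPt_add (m f g : E) (a b θ : ℝ) (j : ℤ) :
    polyPt m f g a b θ j = polyPt 0 f g a b θ j + m := by
  simp only [polyPt, zero_add, add_comm m]

/-- Every two-dimensional face is a polygon. -/
theorem Cfg.exists_polygon [FiniteDimensional ℝ E] {V T : Finset E} {A : Set E} {p q c : ℝ}
    (h : Cfg V A p q c) (hpq : p ≤ q) (hT : IsFace V T)
    (hdim : Module.finrank ℝ (vectorSpan ℝ (T : Set E)) = 2) {v w : E} (hvw : Adj T v w)
    (hvA : v ∈ A) : ∃ (k : ℕ) (m f g : E) (a b : ℝ), IsPolygon T A a b k m f g ∧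
      polyPt m f g a b (Real.pi / k) 0 = v ∧ polyPt m f g a b (Real.pi / k) 1 = w ∧
      0 < a ∧ 0 < b ∧ a ^ 2 = p - ⟪m, m⟫_ℝ ∧ b ^ 2 = q - ⟪m, m⟫_ℝ ∧
      c - ⟪m, m⟫_ℝ = a * b * Real.cos (Real.pi / k) ∧
      (∀ u ∈ T, u - m ∈ vectorSpan ℝ (T : Set E)) ∧
      (∀ x ∈ vectorSpan ℝ (T : Set E), ⟪m, x⟫_ℝ = 0) := by
  obtain ⟨m, h1, h2, h3⟩ := h.face_center hT hdim.ge
  have hvw' : Adj (shift T m) (v - m) (w - m) := by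
    rwa [adj_shift, sub_add_cancel, sub_add_cancel]
  obtain ⟨k, f, g, hP, e0, e1, e2, hf, hg⟩ := h3.exists_polygon_centered (by linarith)
    (fun u hu => by
      rw [vectorSpan_shift]
      have := h1 _ (mem_shift.1 hu)
      rwa [add_sub_cancel_right] at this) (by rwa [vectorSpan_shift]) hvw' (by simpa using hvA)
  rw [vectorSpan_shift] at hf hg
  refine ⟨k, m, f, g, _, _, ⟨hP.two_le, hP.ff, hP.gg, hP.fg, h2 f hf, h2 g hg, ?_, ?_, ?_, ?_⟩,
    ?_, ?_, Real.sqrt_pos.2 h3.p_pos, Real.sqrt_pos.2 h3.q_pos, Real.sq_sqrt h3.p_pos.le,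
    Real.sq_sqrt h3.q_pos.le, e2, h1, h2⟩
  · intro j
    rw [polyPt_add]
    exact mem_shift.1 (hP.mem j)
  · intro j
    rw [polyPt_add]
    exact hP.memA j
  · intro u hu
    obtain ⟨j, hj⟩ := hP.surj (u - m) (sub_mem_shift.2 hu)
    exact ⟨j, by rw [polyPt_add, ← hj, sub_add_cancel]⟩
  · intro j x
    have := hP.adj j (x - m)
    rw [adj_shift, sub_add_cancel] at this
    rw [polyPt_add, this, polyPt_add m f g _ _ _ (j - 1), polyPt_add m f g _ _ _ (j + 1),
      sub_eq_iff_eq_add, sub_eq_iff_eq_add]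
  · rw [polyPt_add, e0, sub_add_cancel]
  · rw [polyPt_add, e1, sub_add_cancel]

end

section

/-! ### Obtuse systems of vectors -/

theorem inner_posPart_negPart_nonpos {ι : Type*} (s : Finset ι) (e : ι → E)
    (hobt : ∀ i ∈ s, ∀ j ∈ s, i ≠ j → ⟪e i, e j⟫_ℝ ≤ 0) (l : ι → ℝ) :
    ⟪∑ i ∈ s, max (l i) 0 • e i, ∑ i ∈ s, max (-l i) 0 • e i⟫_ℝ ≤ 0 := by
  simp only [sum_inner, inner_sum, real_inner_smul_left, real_inner_smul_right]
  refine Finset.sum_nonpos fun i hi => Finset.sum_nonpos fun j hj => ?_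
  by_cases hij : i = j
  · subst hij
    rcases le_total (l i) 0 with h | h
    · rw [max_eq_right h]; simp
    · rw [max_eq_right (neg_nonpos.2 h)]; simp
  · have h1 : 0 ≤ max (-l i) 0 * max (l j) 0 := by positivity
    nlinarith [hobt j hj i hi (Ne.symm hij)]

theorem sum_posPart_sub {ι : Type*} (s : Finset ι) (e : ι → E) (l : ι → ℝ) :
    ∑ i ∈ s, l i • e i = ∑ i ∈ s, max (l i) 0 • e i - ∑ i ∈ s, max (-l i) 0 • e i := by
  rw [← Finset.sum_sub_distrib]
  refine Finset.sum_congr rfl fun i _ => ?_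
  rw [← sub_smul]
  congr 1
  rcases le_total (l i) 0 with h | h
  · rw [max_eq_right h, max_eq_left (neg_nonneg.2 h)]; ring
  · rw [max_eq_left h, max_eq_right (neg_nonpos.2 h)]; ring

/-- The coefficients of a vector making acute angles with an obtuse system are nonnegative. -/
theorem obtuse_coeff_nonneg {ι : Type*} (s : Finset ι) (e : ι → E) (y x : E)
    (hobt : ∀ i ∈ s, ∀ j ∈ s, i ≠ j → ⟪e i, e j⟫_ℝ ≤ 0) (hy : ∀ i ∈ s, 0 < ⟪y, e i⟫_ℝ)
    (hx : ∀ i ∈ s, 0 ≤ ⟪x, e i⟫_ℝ) (l : ι → ℝ) (hl : x = ∑ i ∈ s, l i • e i) :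
    ∀ i ∈ s, 0 ≤ l i := by
  have h1 := inner_posPart_negPart_nonpos s e hobt l
  set n := ∑ i ∈ s, max (-l i) 0 • e i with hn
  rw [sum_posPart_sub] at hl
  have h2 : 0 ≤ ⟪x, n⟫_ℝ := by
    rw [hn, inner_sum]
    refine Finset.sum_nonneg fun i hi => ?_
    rw [real_inner_smul_right]
    exact mul_nonneg (le_max_right _ _) (hx i hi)
  rw [hl, inner_sub_left] at h2
  have h3 : n = 0 := by
    rw [← real_inner_self_nonpos]
    linarith
  have h4 : ∑ i ∈ s, max (-l i) 0 * ⟪y, e i⟫_ℝ = 0 := by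
    have : ⟪y, n⟫_ℝ = 0 := by rw [h3, inner_zero_right]
    rw [hn, inner_sum] at this
    simpa only [real_inner_smul_right] using this
  intro i hi
  have h5 := (Finset.sum_eq_zero_iff_of_nonneg fun i hi =>
    mul_nonneg (le_max_right _ _) (hy i hi).le).1 h4 i hi
  have h6 := (mul_eq_zero.1 h5).resolve_right (hy i hi).ne'
  have := le_max_left (-l i) 0
  linarith

theorem obtuse_linearIndependent {ι : Type*} (s : Finset ι) (e : ι → E) (y : E)
    (hobt : ∀ i ∈ s, ∀ j ∈ s, i ≠ j → ⟪e i, e j⟫_ℝ ≤ 0) (hy : ∀ i ∈ s, 0 < ⟪y, e i⟫_ℝ)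
    (l : ι → ℝ) (hl : ∑ i ∈ s, l i • e i = 0) : ∀ i ∈ s, l i = 0 := by
  intro i hi
  have h1 := obtuse_coeff_nonneg s e y 0 hobt hy (by simp) l hl.symm i hi
  have h2 := obtuse_coeff_nonneg s e y 0 hobt hy (by simp) (fun i => -l i)
    (by simp only [neg_smul, Finset.sum_neg_distrib, hl, neg_zero]) i hi
  linarith

theorem obtuse_coeff_pos {ι : Type*} (s : Finset ι) (e : ι → E) (y : E)
    (hobt : ∀ i ∈ s, ∀ j ∈ s, i ≠ j → ⟪e i, e j⟫_ℝ ≤ 0) (hy : ∀ i ∈ s, 0 < ⟪y, e i⟫_ℝ)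
    (l : ι → ℝ) (hl : y = ∑ i ∈ s, l i • e i) : ∀ i ∈ s, 0 < l i := by
  have h0 := obtuse_coeff_nonneg s e y y hobt hy (fun i hi => (hy i hi).le) l hl
  intro i hi
  refine lt_of_le_of_ne (h0 i hi) fun h => ?_
  have h1 := hy i hi
  rw [hl, sum_inner] at h1
  refine absurd h1 (not_lt.2 (Finset.sum_nonpos fun j hj => ?_))
  rw [real_inner_smul_left]
  by_cases hji : j = i
  · rw [hji, ← h, zero_mul]
  · exact mul_nonpos_of_nonneg_of_nonpos (h0 j hj) (hobt j hj i hi hji)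

/-! ### Faces at a vertex -/

/-- A functional which is maximal at `v` among its neighbours cuts out a face at `v`. -/
theorem ConvexPosition.exists_face {V : Finset E} (hV : ConvexPosition V) {v z : E} (hv : v ∈ V)
    (hz : ∀ u, Adj V v u → ⟪z, u⟫_ℝ ≤ ⟪z, v⟫_ℝ) :
    ∃ T, IsFace V T ∧ (∀ u, u ∈ T ↔ u ∈ V ∧ ⟪z, u⟫_ℝ = ⟪z, v⟫_ℝ) ∧
      ∀ u, Adj T v u ↔ Adj V v u ∧ ⟪z, u⟫_ℝ = ⟪z, v⟫_ℝ := by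
  classical
  have hmem : ∀ u, u ∈ V.filter (fun u => ⟪z, u⟫_ℝ = ⟪z, v⟫_ℝ) ↔
    u ∈ V ∧ ⟪z, u⟫_ℝ = ⟪z, v⟫_ℝ := fun u => Finset.mem_filter
  have hface : IsFace V (V.filter (fun u => ⟪z, u⟫_ℝ = ⟪z, v⟫_ℝ)) := by
    refine ⟨Finset.filter_subset _ _, z, ⟪z, v⟫_ℝ, fun u hu => ((hmem u).1 hu).2,
      fun u hu hu' => ?_⟩
    exact lt_of_le_of_ne (hV.le_of_adj hv hz hu) fun h => hu' ((hmem u).2 ⟨hu, h⟩)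
  refine ⟨_, hface, hmem, fun u => ⟨fun h => ⟨hface.adj h, ((hmem u).1 h.2.1).2⟩, fun h => ?_⟩⟩
  exact h.1.mono hface.1 ((hmem v).2 ⟨hv, rfl⟩) ((hmem u).2 ⟨h.1.2.1, h.2⟩)

namespace Cfg

variable {V : Finset E} {A : Set E} {p q c : ℝ}

theorem inner_self_gt (h : Cfg V A p q c) {v : E} (hv : v ∈ V) : c < ⟪v, v⟫_ℝ := by
  by_cases hA : v ∈ A
  · rw [h.norm1 v hv hA]; exact h.c_lt_p
  · rw [h.norm2 v hv hA]; exact h.c_lt_q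

theorem inner_self_eq (h : Cfg V A p q c) {v w w' : E} (hw : Adj V v w) (hw' : Adj V v w') :
    ⟪w, w⟫_ℝ = ⟪w', w'⟫_ℝ := by
  have h1 := h.bip _ _ hw
  have h2 := h.bip _ _ hw'
  by_cases hA : v ∈ A
  · rw [h.norm2 w hw.2.1 (by tauto), h.norm2 w' hw'.2.1 (by tauto)]
  · rw [h.norm1 w hw.2.1 (by tauto), h.norm1 w' hw'.2.1 (by tauto)]

theorem linearIndependent_pair (h : Cfg V A p q c) {v w w' : E} (hw : Adj V v w)
    (hw' : Adj V v w') (hne : w ≠ w') : LinearIndependent ℝ ![w - v, w' - v] := by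
  rw [LinearIndependent.pair_iff]
  intro s t hst
  have h1 := congrArg (fun y => ⟪v, y⟫_ℝ) hst
  have hvv := h.inner_self_gt hw.1
  simp only [inner_add_right, real_inner_smul_right, inner_sub_right, h.inner _ _ hw,
    h.inner _ _ hw', inner_zero_right] at h1
  have h2 : (s + t) * (c - ⟪v, v⟫_ℝ) = 0 := by linarith
  have h3 : t = -s := by
    have := (mul_eq_zero.1 h2).resolve_right (by linarith)
    linarith
  subst h3
  have h4 : s • (w - w') = 0 := by
    rw [← hst]; simp only [smul_sub, neg_smul]; abel
  have h5 := (smul_eq_zero.1 h4).resolve_right (sub_ne_zero.2 hne)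
  exact ⟨h5, by rw [h5, neg_zero]⟩

theorem finrank_span_pair (h : Cfg V A p q c) {v w w' : E} (hw : Adj V v w)
    (hw' : Adj V v w') (hne : w ≠ w') :
    Module.finrank ℝ (Submodule.span ℝ {w - v, w' - v}) = 2 := by
  have h2 := finrank_span_eq_card (h.linearIndependent_pair hw hw' hne)
  rwa [Matrix.range_cons, Matrix.range_cons, Matrix.range_empty, Set.union_empty,
    Set.singleton_union] at h2

/-- The plane of a face with exactly two edges at a vertex. -/
theorem vectorSpan_face (h : Cfg V A p q c) {T : Finset E} (hT : IsFace V T) {v w w' : E}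
    (hw : Adj T v w) (hw' : Adj T v w') (honly : ∀ u, Adj T v u → u = w ∨ u = w') :
    vectorSpan ℝ (T : Set E) = Submodule.span ℝ {w - v, w' - v} := by
  rw [(h.pos.mono hT.1).vectorSpan_eq hw.1]
  congr 1
  ext x
  constructor
  · rintro ⟨u, hu, rfl⟩
    rcases honly u hu with rfl | rfl
    · exact Or.inl rfl
    · exact Or.inr rfl
  · rintro (rfl | rfl)
    · exact ⟨w, hw, rfl⟩
    · exact ⟨w', hw', rfl⟩

/-- Two neighbours of `v` with a functional singling them out span a polygonal face. -/
theorem exists_face_pair (h : Cfg V A p q c) {v w w' z : E} (hw : Adj V v w) (hw' : Adj V v w')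
    (hne : w ≠ w') (hz1 : ⟪z, w⟫_ℝ = ⟪z, v⟫_ℝ) (hz2 : ⟪z, w'⟫_ℝ = ⟪z, v⟫_ℝ)
    (hz : ∀ u, Adj V v u → u ≠ w → u ≠ w' → ⟪z, u⟫_ℝ < ⟪z, v⟫_ℝ) :
    ∃ T, IsFace V T ∧ Adj T v w ∧ Adj T v w' ∧ (∀ u, Adj T v u → u = w ∨ u = w') ∧
      Module.finrank ℝ (vectorSpan ℝ (T : Set E)) = 2 := by
  have hle : ∀ u, Adj V v u → ⟪z, u⟫_ℝ ≤ ⟪z, v⟫_ℝ := by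
    intro u hu
    by_cases h1 : u = w
    · rw [h1, hz1]
    by_cases h2 : u = w'
    · rw [h2, hz2]
    exact (hz u hu h1 h2).le
  obtain ⟨T, hT, -, hadj⟩ := h.pos.exists_face hw.1 hle
  have h1 : Adj T v w := (hadj w).2 ⟨hw, hz1⟩
  have h2 : Adj T v w' := (hadj w').2 ⟨hw', hz2⟩
  have h3 : ∀ u, Adj T v u → u = w ∨ u = w' := by
    intro u hu
    by_contra! hcon
    have := (hadj u).1 hu
    exact (hz u this.1 hcon.1 hcon.2).ne this.2
  refine ⟨T, hT, h1, h2, h3, ?_⟩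
  rw [h.vectorSpan_face hT h1 h2 h3, h.finrank_span_pair hw hw' hne]

theorem exists_face_of_link (h : Cfg V A p q c) {v w w' : E} {N : Finset E}
    (hN : ∀ u, u ∈ N ↔ Adj V v u) (hww : Adj N w w') :
    ∃ T, IsFace V T ∧ Adj T v w ∧ Adj T v w' ∧ (∀ u, Adj T v u → u = w ∨ u = w') ∧
      Module.finrank ℝ (vectorSpan ℝ (T : Set E)) = 2 := by
  obtain ⟨hw, hw', hne, z, hz, hlt⟩ := hww
  rw [hN] at hw hw'
  have hvv := h.inner_self_gt hw.1
  have hvv' : ⟪v, v⟫_ℝ - c ≠ 0 := by linarith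
  obtain ⟨lam, hlam⟩ : ∃ lam : ℝ, lam * (⟪v, v⟫_ℝ - c) = ⟪z, v⟫_ℝ - ⟪z, w⟫_ℝ :=
    ⟨(⟪z, v⟫_ℝ - ⟪z, w⟫_ℝ) / (⟪v, v⟫_ℝ - c), div_mul_cancel₀ _ hvv'⟩
  refine h.exists_face_pair (z := z - lam • v) hw hw' hne ?_ ?_ ?_
  · simp only [inner_sub_left, real_inner_smul_left, h.inner _ _ hw]
    linarith
  · simp only [inner_sub_left, real_inner_smul_left, h.inner _ _ hw']
    linarith
  · intro u hu h1 h2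
    have := hlt u ((hN u).2 hu) h1 h2
    simp only [inner_sub_left, real_inner_smul_left, h.inner _ _ hu]
    linarith

variable [FiniteDimensional ℝ E]

theorem inner_nonpos_of_face (h : Cfg V A p q c) (hpq : p ≤ q) {T : Finset E} (hT : IsFace V T)
    (hdim : Module.finrank ℝ (vectorSpan ℝ (T : Set E)) = 2) {v w w' : E} (hvA : v ∈ A)
    (hw : Adj T v w) (hw' : Adj T v w') (hne : w ≠ w') : ⟪w - v, w' - v⟫_ℝ ≤ 0 := by
  obtain ⟨k, m, f, g, a, b, hP, e0, e1, ha, hb, ha2, hb2, hc, -, -⟩ :=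
    h.exists_polygon hpq hT hdim hw hvA
  have e2 := (hP.adj 0 w').1 (by rwa [e0])
  rw [zero_sub, zero_add, e1] at e2
  replace e2 := e2.resolve_right hne.symm
  rw [← e1, e2, ← e0]
  have hk : (2 : ℝ) ≤ k := by exact_mod_cast hP.two_le
  have hθ1 : Real.pi / k ≤ Real.pi / 2 := by
    apply div_le_div_of_nonneg_left Real.pi_pos.le (by norm_num) hk
  have hcos : 0 ≤ Real.cos (Real.pi / k) :=
    Real.cos_nonneg_of_neg_pi_div_two_le_of_le (by
      have : 0 ≤ Real.pi / k := by positivity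
      linarith [Real.pi_pos]) hθ1
  have h1 := inner_polyPt (a := a) (b := b) (θ := Real.pi / k) hP.ff hP.gg hP.fg
  have hodd1 : ¬ Even (1 : ℤ) := by decide
  have hodd2 : ¬ Even (-1 : ℤ) := by decide
  have h11 := h1 1 (-1)
  have h10 := h1 1 0
  have h00 := h1 0 0
  have h01 := h1 0 (-1)
  simp only [hodd1, hodd2, if_false, Even.zero, if_true] at h11 h10 h00 h01
  have e3 : ((-1 - 1 : ℤ) : ℝ) * (Real.pi / k) = -(2 * (Real.pi / k)) := by push_cast; ring
  have e4 : ((0 - 1 : ℤ) : ℝ) * (Real.pi / k) = -(Real.pi / k) := by push_cast; ring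
  have e5 : ((-1 - 0 : ℤ) : ℝ) * (Real.pi / k) = -(Real.pi / k) := by push_cast; ring
  have e6 : ((0 - 0 : ℤ) : ℝ) * (Real.pi / k) = 0 := by push_cast; ring
  rw [e3, Real.cos_neg, Real.cos_two_mul] at h11
  rw [e4, Real.cos_neg] at h10
  rw [e5, Real.cos_neg] at h01
  rw [e6, Real.cos_zero] at h00
  rw [polyPt_add m f g _ _ _ 1, polyPt_add m f g _ _ _ 0, polyPt_add m f g _ _ _ (-1),
    add_sub_add_right_eq_sub, add_sub_add_right_eq_sub]
  simp only [inner_sub_left, inner_sub_right, h11, h10, h00, h01]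
  set x := Real.cos (Real.pi / k)
  have h2 : b * x < a := by
    have := h.c_lt_p
    have h3 : a * (b * x) < a * a := by nlinarith
    exact lt_of_mul_lt_mul_left h3 ha.le
  have h3 : 0 ≤ b * x := by positivity
  nlinarith [mul_nonneg h3 (sub_nonneg.2 h2.le)]

/-- Any two edges at an inner vertex form a right or obtuse angle. -/
theorem inner_edge_nonpos (h : Cfg V A p q c) (hpq : p ≤ q) {v w w' : E} (hvA : v ∈ A)
    (hw : Adj V v w) (hw' : Adj V v w') (hne : w ≠ w') : ⟪w - v, w' - v⟫_ℝ ≤ 0 := by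
  classical
  set N := V.filter (Adj V v) with hNdef
  have hN : ∀ u, u ∈ N ↔ Adj V v u := fun u => by
    rw [hNdef, Finset.mem_filter]; exact ⟨fun h => h.2, fun h => ⟨h.2.1, h⟩⟩
  have hNpos : ConvexPosition N := h.pos.mono (Finset.filter_subset _ _)
  obtain ⟨x, hx, hmax⟩ := (N.erase w).exists_max_image (fun x => ⟪w, x⟫_ℝ)
    ⟨w', Finset.mem_erase.2 ⟨hne.symm, (hN _).2 hw'⟩⟩
  rw [Finset.mem_erase] at hx
  have hxv := (hN x).1 hx.2
  obtain ⟨y, hy, hy'⟩ := hNpos.exists_adj_gt (f := w) hx.2 ((hN w).2 hw) (by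
    by_contra! hle
    exact hx.1 (eq_of_inner_eq rfl (h.inner_self_eq hxv hw) hle).symm)
  have hyw : y = w := by
    by_contra hyw
    exact absurd (hmax y (Finset.mem_erase.2 ⟨hyw, hy.2.1⟩)) (not_le.2 hy')
  subst hyw
  obtain ⟨T, hT, h1, h2, -, hdim⟩ := h.exists_face_of_link hN hy
  have h3 := h.inner_nonpos_of_face hpq hT hdim hvA h2 h1 hx.1.symm
  have h4 := hmax w' (Finset.mem_erase.2 ⟨hne.symm, (hN _).2 hw'⟩)
  have h5 := h.inner _ _ hw'
  have h6 := h.inner _ _ hxv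
  simp only [inner_sub_left, inner_sub_right] at h3 h4 ⊢
  linarith

end Cfg

end

section

/-- The neighbours of `v` in the edge graph. -/
def nbrs (V : Finset E) (v : E) : Finset E := @Finset.filter _ (Adj V v) (Classical.decPred _) V

theorem mem_nbrs {V : Finset E} {v u : E} : u ∈ nbrs V v ↔ Adj V v u :=
  (@Finset.mem_filter _ _ (Classical.decPred _) _ _).trans ⟨fun h => h.2, fun h => ⟨h.2.1, h⟩⟩

theorem edges_eq_range {T I : Finset E} {v : E} (hI : ∀ u, Adj T v u ↔ u ∈ I) :
    {x | ∃ w, Adj T v w ∧ x = w - v} = Set.range (fun u : I => (u : E) - v) := by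
  ext x
  constructor
  · rintro ⟨u, hu, rfl⟩
    exact ⟨⟨u, (hI u).1 hu⟩, rfl⟩
  · rintro ⟨u, rfl⟩
    exact ⟨u, (hI u).2 u.2, rfl⟩

/-- Inner products with linearly independent vectors can be prescribed. -/
theorem exists_inner_eq [FiniteDimensional ℝ E] {ι : Type*} {e : ι → E}
    (he : LinearIndependent ℝ e) (r : ι → ℝ) : ∃ z : E, ∀ i, ⟪z, e i⟫_ℝ = r i := by
  obtain ⟨f, hf⟩ := ((Module.Basis.span he).constr ℝ r).exists_extend
  refine ⟨(InnerProductSpace.toDual ℝ E).symm (LinearMap.toContinuousLinearMap f), fun i => ?_⟩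
  rw [InnerProductSpace.toDual_symm_apply, LinearMap.coe_toContinuousLinearMap']
  have h1 := LinearMap.congr_fun hf (Module.Basis.span he i)
  rw [LinearMap.comp_apply, Module.Basis.constr_basis, Submodule.subtype_apply,
    Module.Basis.span_apply] at h1
  exact h1

namespace Cfg

variable {V : Finset E} {A : Set E} {p q c : ℝ} [FiniteDimensional ℝ E]

theorem edges_linearIndependent (h : Cfg V A p q c) (hpq : p ≤ q) {v : E} (hvA : v ∈ A) :
    LinearIndependent ℝ (fun u : nbrs V v => (u : E) - v) := by
  rw [Fintype.linearIndependent_iff]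
  intro l hl i
  refine obtuse_linearIndependent Finset.univ _ (-v) ?_ ?_ l hl i (Finset.mem_univ i)
  · intro i _ j _ hij
    exact h.inner_edge_nonpos hpq hvA (mem_nbrs.1 i.2) (mem_nbrs.1 j.2)
      (fun h => hij (Subtype.ext h))
  · intro i _
    have hi := mem_nbrs.1 i.2
    have := h.inner_self_gt hi.1
    rw [inner_neg_left, inner_sub_right, h.inner _ _ hi]
    linarith

theorem card_nbrs (h : Cfg V A p q c) (hpq : p ≤ q) {v : E} (hv : v ∈ V) (hvA : v ∈ A) :
    (nbrs V v).card = Module.finrank ℝ (vectorSpan ℝ (V : Set E)) := by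
  have h1 := finrank_span_eq_card (h.edges_linearIndependent hpq hvA)
  rw [h.pos.vectorSpan_eq hv, ← Fintype.card_coe, ← h1, edges_eq_range fun u => mem_nbrs.symm]

/-- Every set of edges at an inner vertex is the set of edges of a face at this vertex. -/
theorem exists_face_of_subset (h : Cfg V A p q c) (hpq : p ≤ q) {v : E} (hv : v ∈ V) (hvA : v ∈ A)
    {I : Finset E} (hI : I ⊆ nbrs V v) :
    ∃ T, IsFace V T ∧ v ∈ T ∧ (∀ u, Adj T v u ↔ u ∈ I) ∧
      Module.finrank ℝ (vectorSpan ℝ (T : Set E)) = I.card := by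
  classical
  have hli := h.edges_linearIndependent hpq hvA
  obtain ⟨z, hz⟩ := exists_inner_eq hli (fun u => if (u : E) ∈ I then 0 else -1)
  have hz' : ∀ u, Adj V v u → ⟪z, u⟫_ℝ = ⟪z, v⟫_ℝ + if u ∈ I then 0 else -1 := by
    intro u hu
    have := hz ⟨u, mem_nbrs.2 hu⟩
    rw [inner_sub_right] at this
    simp only at this
    linarith
  obtain ⟨T, hT, hmem, hadj⟩ := h.pos.exists_face (z := z) hv (fun u hu => by
    rw [hz' u hu]; split_ifs <;> linarith)
  have hadj' : ∀ u, Adj T v u ↔ u ∈ I := by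
    intro u
    rw [hadj]
    constructor
    · rintro ⟨h1, h2⟩
      rw [hz' u h1] at h2
      by_contra hu
      rw [if_neg hu] at h2
      linarith
    · intro hu
      have h1 := mem_nbrs.1 (hI hu)
      exact ⟨h1, by rw [hz' u h1, if_pos hu, add_zero]⟩
  have hvT : v ∈ T := (hmem v).2 ⟨hv, rfl⟩
  refine ⟨T, hT, hvT, hadj', ?_⟩
  have hli' : LinearIndependent ℝ (fun u : I => (u : E) - v) :=
    hli.comp (fun u : I => (⟨u, hI u.2⟩ : nbrs V v)) (fun a b hab => by
      exact Subtype.ext (congrArg (fun x : nbrs V v => (x : E)) hab))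
  have h1 := finrank_span_eq_card hli'
  rw [(h.pos.mono hT.1).vectorSpan_eq hvT, ← Fintype.card_coe, ← h1, edges_eq_range hadj']

/-- The centre of the polytope lies strictly inside the cone at an inner vertex. -/
theorem inner_eq_zero (h : Cfg V A p q c) (hpq : p ≤ q)
    (hW : ∀ u ∈ V, u ∈ vectorSpan ℝ (V : Set E)) {v z : E} (hv : v ∈ V) (hvA : v ∈ A)
    (hzv : ⟪z, v⟫_ℝ = 0) (hz : ∀ u, Adj V v u → ⟪z, u⟫_ℝ ≤ 0) : ∀ u ∈ V, ⟪z, u⟫_ℝ = 0 := by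
  have h1 : -v ∈ Submodule.span ℝ (Set.range (fun u : nbrs V v => (u : E) - v)) := by
    rw [← edges_eq_range fun u => mem_nbrs.symm, ← h.pos.vectorSpan_eq hv]
    exact Submodule.neg_mem _ (hW v hv)
  rw [Submodule.mem_span_range_iff_exists_fun] at h1
  obtain ⟨l, hl⟩ := h1
  have hpos := obtuse_coeff_pos Finset.univ (fun u : nbrs V v => (u : E) - v) (-v)
    (fun i _ j _ hij => h.inner_edge_nonpos hpq hvA (mem_nbrs.1 i.2) (mem_nbrs.1 j.2)
      (fun h => hij (Subtype.ext h)))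
    (fun i _ => by
      have hi := mem_nbrs.1 i.2
      have := h.inner_self_gt hi.1
      rw [inner_neg_left, inner_sub_right, h.inner _ _ hi]
      linarith) l hl.symm
  have h2 : ∑ u : nbrs V v, l u * ⟪z, (u : E)⟫_ℝ = 0 := by
    have := congrArg (fun x => ⟪z, x⟫_ℝ) hl
    simpa only [inner_sum, real_inner_smul_right, inner_sub_right, hzv, sub_zero, inner_neg_right,
      neg_zero] using this
  have h3 : ∀ u, Adj V v u → ⟪z, u⟫_ℝ = 0 := by
    intro u hu
    have h4 := (Finset.sum_eq_zero_iff_of_nonpos (fun u hu =>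
      mul_nonpos_of_nonneg_of_nonpos (hpos u hu).le (hz u (mem_nbrs.1 u.2)))).1 h2
      ⟨u, mem_nbrs.2 hu⟩ (Finset.mem_univ _)
    exact (mul_eq_zero.1 h4).resolve_left (hpos _ (Finset.mem_univ _)).ne'
  intro u hu
  have h5 := h.pos.le_of_adj (f := z) hv (fun w hw => by rw [h3 w hw, hzv]) hu
  have h6 := h.pos.le_of_adj (f := -z) hv (fun w hw => by
    rw [inner_neg_left, inner_neg_left, h3 w hw, hzv]) hu
  rw [inner_neg_left, inner_neg_left] at h6
  linarith

end Cfg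

end

section

/-- The reflection in the hyperplane orthogonal to `e`. -/
def refl (e : E) : E ≃ₗᵢ[ℝ] E := (Submodule.span ℝ {e})ᗮ.reflection

theorem refl_apply (e y : E) : refl e y = y - (2 * ⟪e, y⟫_ℝ / ⟪e, e⟫_ℝ) • e := by
  rw [refl, Submodule.reflection_orthogonal_apply, Submodule.reflection_singleton_apply,
    real_inner_self_eq_norm_sq, neg_sub, two_smul, ← add_smul]
  norm_num
  ring_nf

theorem refl_mul_self (e : E) : refl e * refl e = 1 := Submodule.reflection_mul_reflection _

theorem refl_inv (e : E) : (refl e)⁻¹ = refl e := Submodule.reflection_inv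

theorem refl_neg (e : E) : refl (-e) = refl e := by
  ext y
  rw [refl_apply, refl_apply, inner_neg_left, inner_neg_neg, smul_neg, mul_neg, neg_div, neg_smul,
    neg_neg]

theorem refl_map (g : E ≃ₗᵢ[ℝ] E) (e : E) : refl (g e) = g * refl e * g⁻¹ := by
  ext y
  change refl (g e) y = g (refl e (g⁻¹ y))
  rw [refl_apply, refl_apply,
    map_sub, map_smul, LinearIsometryEquiv.inner_map_map,
    ← LinearIsometryEquiv.inner_map_map g e (g⁻¹ y)]
  have : g (g⁻¹ y) = y := g.apply_symm_apply y
  rw [this]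

theorem refl_sub_eq {v w : E} (h : ⟪v, v⟫_ℝ = ⟪w, w⟫_ℝ) : refl (w - v) v = w := by
  rw [← refl_neg, neg_sub]
  apply Submodule.reflection_sub
  rw [norm_eq_sqrt_real_inner, norm_eq_sqrt_real_inner, h]

theorem refl_eq_of_sub_eq_smul {x y e : E} (h : ⟪x, x⟫_ℝ = ⟪y, y⟫_ℝ) {r : ℝ} (hr : r ≠ 0)
    (he : y - x = r • e) : refl e x = y := by
  rw [refl_apply]
  by_cases h0 : e = 0
  · subst h0
    rw [smul_zero, sub_eq_zero] at he
    rw [smul_zero, he, sub_zero]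
  have hy : y = x + r • e := by rw [← he]; abel
  have h1 : 0 < ⟪e, e⟫_ℝ := real_inner_self_pos.2 h0
  rw [hy] at h ⊢
  simp only [inner_add_left, inner_add_right, real_inner_smul_left, real_inner_smul_right,
    real_inner_comm e x] at h
  rw [sub_eq_add_neg, ← neg_smul]
  congr 2
  rw [real_inner_comm] at h
  have : r * (2 * ⟪e, x⟫_ℝ + r * ⟪e, e⟫_ℝ) = 0 := by linarith
  rcases mul_eq_zero.1 this with h2 | h2
  · exact absurd h2 hr
  · field_simp
    linarith

variable {V : Finset E} {A : Set E} {p q c : ℝ}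

theorem Cfg.exists_cfg_mem (h : Cfg V A p p c) (v : E) : ∃ A', Cfg V A' p p c ∧ v ∈ A' := by
  by_cases hv : v ∈ A
  · exact ⟨A, h, hv⟩
  · exact ⟨Aᶜ, h.swap, hv⟩

theorem Cfg.norm_eq (h : Cfg V A p p c) {v : E} (hv : v ∈ V) : ⟪v, v⟫_ℝ = p := by
  obtain ⟨A', h', hA'⟩ := h.exists_cfg_mem v
  exact h'.norm1 v hv hA'

theorem polyPt_of_eq (m f g : E) (a θ : ℝ) (j : ℤ) :
    polyPt m f g a a θ j = m + a • (Real.cos (j * θ) • f + Real.sin (j * θ) • g) := by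
  rw [polyPt, ite_self]

variable [FiniteDimensional ℝ E]

/-- Two edges at an inner vertex span a polygonal face. -/
theorem Cfg.exists_polygon_pair (h : Cfg V A p q c) (hpq : p ≤ q) {v w u : E} (hvA : v ∈ A)
    (hw : Adj V v w) (hu : Adj V v u) (hne : u ≠ w) :
    ∃ (T : Finset E) (k : ℕ) (m f g : E) (a b : ℝ), IsFace V T ∧ IsPolygon T A a b k m f g ∧
      polyPt m f g a b (Real.pi / k) 0 = v ∧ polyPt m f g a b (Real.pi / k) 1 = w ∧
      polyPt m f g a b (Real.pi / k) (-1) = u ∧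
      0 < a ∧ 0 < b ∧ a ^ 2 = p - ⟪m, m⟫_ℝ ∧ b ^ 2 = q - ⟪m, m⟫_ℝ ∧
      c - ⟪m, m⟫_ℝ = a * b * Real.cos (Real.pi / k) := by
  classical
  obtain ⟨T, hT, -, hadj, hdim⟩ := h.exists_face_of_subset hpq hw.1 hvA (I := {w, u})
    (fun x hx => by
      rw [Finset.mem_insert, Finset.mem_singleton] at hx
      rcases hx with rfl | rfl
      exacts [mem_nbrs.2 hw, mem_nbrs.2 hu])
  rw [Finset.card_pair hne.symm] at hdim
  obtain ⟨k, m, f, g, a, b, hP, h0, h1, ha, hb, ha2, hb2, hc, -⟩ := h.exists_polygon hpq hT hdim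
    ((hadj w).2 (by simp)) hvA
  refine ⟨T, k, m, f, g, a, b, hT, hP, h0, h1, ?_, ha, hb, ha2, hb2, hc⟩
  have h2 := (hP.adj 0 u).1 (by rw [h0]; exact (hadj u).2 (by simp))
  rw [zero_add, zero_sub, h1] at h2
  exact (h2.resolve_right hne).symm

/-- If all vertices have the same norm, the reflection exchanging the endpoints of an edge maps
neighbours of one endpoint to neighbours of the other one. -/
theorem Cfg.adj_refl (h : Cfg V A p p c) {v w u : E} (hw : Adj V v w) (hu : Adj V v u) :
    Adj V w (refl (w - v) u) := by
  by_cases hne : u = w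
  · subst hne
    rw [← refl_neg, neg_sub, refl_sub_eq]
    · exact hw.symm
    · rw [h.norm_eq hw.1, h.norm_eq hw.2.1]
  obtain ⟨A', h', hA'⟩ := h.exists_cfg_mem v
  obtain ⟨T, k, m, f, g, a, b, hT, hP, h0, h1, h2, ha, hb, ha2, hb2, hc⟩ :=
    h'.exists_polygon_pair le_rfl hA' hw hu hne
  have hab : b = a := by
    rw [← sq_eq_sq₀ hb.le ha.le, ha2, hb2]
  subst hab
  set θ := Real.pi / k with hθ
  have hadj : Adj T (polyPt m f g b b θ 1) (polyPt m f g b b θ 2) := (hP.adj 1 _).2 (Or.inr rfl)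
  have hV := hT.adj hadj
  rw [h1] at hV
  have hk : (2 : ℝ) ≤ k := by exact_mod_cast hP.two_le
  have hcos : 0 ≤ Real.cos θ := by
    apply Real.cos_nonneg_of_mem_Icc
    have hπ := Real.pi_pos
    refine ⟨by rw [hθ]; have : 0 ≤ Real.pi / k := by positivity
               linarith, ?_⟩
    rw [hθ]
    gcongr
  convert hV using 1
  refine refl_eq_of_sub_eq_smul (r := 2 * Real.cos θ + 1) ?_ (by positivity) ?_
  · rw [h.norm_eq hu.2.1, h.norm_eq hV.2.1]
  · rw [← h0, ← h1, ← h2]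
    simp only [polyPt_of_eq]
    have e1 : ((2 : ℤ) : ℝ) * θ = 2 * θ := by push_cast; ring
    have e2 : ((-1 : ℤ) : ℝ) * θ = - θ := by push_cast; ring
    have e3 : ((0 : ℤ) : ℝ) * θ = 0 := by push_cast; ring
    have e4 : ((1 : ℤ) : ℝ) * θ = θ := by push_cast; ring
    rw [e1, e2, e3, e4, Real.cos_two_mul, Real.sin_two_mul, Real.cos_neg, Real.sin_neg,
      Real.cos_zero, Real.sin_zero]
    module

end

section

variable {V : Finset E} {A : Set E} {p q c : ℝ} [FiniteDimensional ℝ E]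

/-- A functional orthogonal to an edge direction attains its maximum at an edge in this
direction. -/
theorem Cfg.exists_parallel_edge (h : Cfg V A p p c) {v w z : E} (hvw : Adj V v w)
    (hz : ⟪z, w - v⟫_ℝ = 0) :
    ∃ x, Adj V x (x + (w - v)) ∧ ∀ u ∈ V, ⟪z, u⟫_ℝ ≤ ⟪z, x⟫_ℝ := by
  classical
  set e := w - v with he
  obtain ⟨x, hx, hmax⟩ := Finset.exists_max_image (V.filter fun x => Adj V x (x + e))
    (fun x => ⟪z, x⟫_ℝ) ⟨v, Finset.mem_filter.2 ⟨hvw.1, by rw [he, add_sub_cancel]; exact hvw⟩⟩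
  rw [Finset.mem_filter] at hx
  refine ⟨x, hx.2, fun u hu => h.pos.le_of_adj hx.1 (fun u hu => ?_) hu⟩
  by_cases hne : u = x + e
  · rw [hne, inner_add_right, hz, add_zero]
  obtain ⟨A', h', hA'⟩ := h.exists_cfg_mem x
  obtain ⟨T, k, m, f, g, a, b, hT, hP, h0, h1, h2, ha, hb, ha2, hb2, hc⟩ :=
    h'.exists_polygon_pair le_rfl hA' hx.2 hu hne
  have hab : b = a := by
    rw [← sq_eq_sq₀ hb.le ha.le, ha2, hb2]
  subst hab
  set θ := Real.pi / k with hθ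
  have hadj : Adj T (polyPt m f g b b θ (k + 1)) (polyPt m f g b b θ k) :=
    (hP.adj _ _).2 (Or.inl (by rw [add_sub_cancel_right]))
  have hV := hT.adj hadj
  have hk : (2 : ℝ) ≤ k := by exact_mod_cast hP.two_le
  have hkθ : (k : ℝ) * θ = Real.pi := by rw [hθ]; field_simp
  have hπ := Real.pi_pos
  have hcos : Real.cos θ < 1 := by
    rw [← Real.cos_zero]
    apply Real.cos_lt_cos_of_nonneg_of_le_pi le_rfl
    · rw [hθ]; exact div_le_self hπ.le (by linarith)
    · rw [hθ]; positivity
  have e1 : (((k : ℤ) : ℤ) : ℝ) * θ = Real.pi := by push_cast; exact hkθ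
  have e5 : (((k : ℤ) + 1 : ℤ) : ℝ) * θ = θ + Real.pi := by push_cast; rw [add_mul, hkθ]; ring
  have e2 : ((-1 : ℤ) : ℝ) * θ = - θ := by push_cast; ring
  have e3 : ((0 : ℤ) : ℝ) * θ = 0 := by push_cast; ring
  have e4 : ((1 : ℤ) : ℝ) * θ = θ := by push_cast; ring
  simp only [polyPt_of_eq, e1, e2, e3, e4, e5, Real.cos_add_pi, Real.sin_add_pi, Real.cos_pi,
    Real.sin_pi, Real.cos_neg, Real.sin_neg, Real.cos_zero, Real.sin_zero] at h0 h1 h2 hV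
  have hy : m + b • (-1 : ℝ) • f = m + b • (-Real.cos θ • f + -Real.sin θ • g) + e := by
    have : e = m + b • (Real.cos θ • f + Real.sin θ • g) -
      (m + b • ((1 : ℝ) • f + (0 : ℝ) • g)) := by rw [h0, h1]; abel
    rw [this]
    module
  rw [zero_smul, add_zero, hy] at hV
  have h3 := hmax _ (Finset.mem_filter.2 ⟨hV.1, hV⟩)
  have h4 : ⟪z, m + b • (Real.cos θ • f + Real.sin θ • g)⟫_ℝ =
      ⟪z, m + b • ((1 : ℝ) • f + (0 : ℝ) • g)⟫_ℝ := by
    rw [h0, h1, inner_add_right, hz, add_zero]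
  rw [← h0, ← h2]
  rw [← h0] at h3
  simp only [inner_add_right, inner_smul_right] at h3 h4 ⊢
  have h5 : 0 ≤ b * ⟪z, f⟫_ℝ := by linarith
  nlinarith

/-- No vertex lies on the hyperplane orthogonal to an edge. -/
theorem Cfg.inner_edge_ne_zero (h : Cfg V A p p c) {v w u : E} (hvw : Adj V v w) (hu : u ∈ V) :
    ⟪u, w - v⟫_ℝ ≠ 0 := by
  intro h0
  obtain ⟨x, hx, hmax⟩ := h.exists_parallel_edge hvw h0
  obtain ⟨A', h', hA'⟩ := h.exists_cfg_mem u
  have key : ∀ y ∈ V, ⟪u, u⟫_ℝ ≤ ⟪u, y⟫_ℝ → y = u := by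
    intro y hy hle
    by_contra hne
    have := h'.inner_lt hu hA' hy hne
    rw [h.norm_eq hu] at hle
    linarith
  have h1 := key x hx.1 (hmax u hu)
  have h2 := key (x + (w - v)) hx.2.1 (by rw [inner_add_right, h0, add_zero]; exact hmax u hu)
  exact hx.2.2.1 (h1.trans h2.symm)

/-- An edge crossing the hyperplane orthogonal to another edge is parallel to it. -/
theorem Cfg.parallel_of_crossing (h : Cfg V A p p c) {v w x y : E} (hvw : Adj V v w)
    (hxy : Adj V x y) (hx : 0 < ⟪x, w - v⟫_ℝ) (hy : ⟪y, w - v⟫_ℝ < 0) :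
    w - v = y - x ∨ w - v = -(y - x) := by
  set e := w - v with he
  have hz : ⟪(-⟪y, e⟫_ℝ) • x + ⟪x, e⟫_ℝ • y, e⟫_ℝ = 0 := by
    rw [inner_add_left, real_inner_smul_left, real_inner_smul_left]
    ring
  obtain ⟨t, ht, hmax⟩ := h.exists_parallel_edge hvw hz
  obtain ⟨A', h', hA'⟩ := h.exists_cfg_mem x
  have hyA : y ∉ A' := (h'.bip x y hxy).1 hA'
  have hc : ⟪x, y⟫_ℝ = c := h'.inner x y hxy
  have hc' : ⟪y, x⟫_ℝ = c := h'.inner y x hxy.symm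
  have key : ∀ u ∈ V, (∀ s ∈ V, ⟪(-⟪y, e⟫_ℝ) • x + ⟪x, e⟫_ℝ • y, s⟫_ℝ ≤
      ⟪(-⟪y, e⟫_ℝ) • x + ⟪x, e⟫_ℝ • y, u⟫_ℝ) → u = x ∨ u = y := by
    intro u hu hm
    by_contra! hne
    have hmx := hm x hxy.1
    have hmy := hm y hxy.2.1
    simp only [inner_add_left, real_inner_smul_left, hc, hc', h.norm_eq hxy.1,
      h.norm_eq hxy.2.1] at hmx hmy
    by_cases huA : u ∈ A'
    · have h1 := h'.inner_lt hxy.1 hA' hu hne.1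
      have h2 := h'.inner_le le_rfl hu huA hxy.2.1 hyA
      rw [real_inner_comm] at h2
      nlinarith
    · have h1 := h'.swap.inner_lt hxy.2.1 hyA hu hne.2
      have h2 := h'.inner_le le_rfl hxy.1 hA' hu huA
      nlinarith
  have k1 := key t ht.1 hmax
  have k2 := key (t + e) ht.2.1 (fun s hs => by
    rw [inner_add_right, hz, add_zero]; exact hmax s hs)
  have hne := ht.2.2.1
  rcases k1 with k1 | k1 <;> rcases k2 with k2 | k2
  · exact absurd (k1.trans k2.symm) hne
  · left
    rw [← k2, ← k1, add_sub_cancel_left]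
  · right
    rw [← k2, ← k1]
    abel
  · exact absurd (k1.trans k2.symm) hne

end

section

/-- The reflections exchanging `v` with one of its neighbours. -/
def edgeRefls (V : Finset E) (v : E) : Set (E ≃ₗᵢ[ℝ] E) :=
  {s | ∃ u, Adj V v u ∧ s = refl (u - v)}

variable {V : Finset E} {A : Set E} {p q c : ℝ}

theorem exists_list_of_mem_closure {v : E} {g : E ≃ₗᵢ[ℝ] E}
    (hg : g ∈ Subgroup.closure (edgeRefls V v)) :
    ∃ L : List (E ≃ₗᵢ[ℝ] E), (∀ s ∈ L, s ∈ edgeRefls V v) ∧ L.prod = g := by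
  have step : ∀ (g : E ≃ₗᵢ[ℝ] E), ∀ s ∈ edgeRefls V v,
      (∃ L : List (E ≃ₗᵢ[ℝ] E), (∀ s ∈ L, s ∈ edgeRefls V v) ∧ L.prod = g) →
      ∃ L : List (E ≃ₗᵢ[ℝ] E), (∀ s ∈ L, s ∈ edgeRefls V v) ∧ L.prod = g * s := by
    rintro g s hs ⟨L, hL, rfl⟩
    refine ⟨L ++ [s], fun t ht => ?_, by rw [List.prod_append, List.prod_singleton]⟩
    rcases List.mem_append.1 ht with ht | ht
    · exact hL t ht
    · rw [List.mem_singleton.1 ht]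
      exact hs
  induction hg using Subgroup.closure_induction_right with
  | one => exact ⟨[], by simp, rfl⟩
  | mul_right x hx s hs ih => exact step x s hs ih
  | mul_inv_cancel x hx s hs ih =>
    have : s⁻¹ = s := by obtain ⟨u, hu, rfl⟩ := hs; exact refl_inv _
    rw [this]
    exact step x s hs ih

variable [FiniteDimensional ℝ E]

theorem Cfg.adj_map (h : Cfg V A p p c) {v : E} (hv : v ∈ V) {g : E ≃ₗᵢ[ℝ] E}
    (hg : g ∈ Subgroup.closure (edgeRefls V v)) :
    g v ∈ V ∧ ∀ y, Adj V v y → Adj V (g v) (g y) := by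
  have step : ∀ (g : E ≃ₗᵢ[ℝ] E), ∀ s ∈ edgeRefls V v,
      (g v ∈ V ∧ ∀ y, Adj V v y → Adj V (g v) (g y)) →
      ((g * s) v ∈ V ∧ ∀ y, Adj V v y → Adj V ((g * s) v) ((g * s) y)) := by
    rintro g s ⟨u, hu, rfl⟩ ⟨h1, h2⟩
    have e1 : (g * refl (u - v)) v = g u := by
      change g (refl (u - v) v) = g u
      rw [refl_sub_eq]
      rw [h.norm_eq hu.1, h.norm_eq hu.2.1]
    rw [e1]
    refine ⟨(h2 u hu).2.1, fun y hy => ?_⟩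
    have h3 := h.adj_refl (h2 u hu) (h2 y hy)
    rw [← map_sub, refl_map] at h3
    convert h3 using 1
    change _ = g (refl (u - v) (g⁻¹ (g y)))
    have : g⁻¹ (g y) = y := g.symm_apply_apply y
    rw [this]
    rfl
  induction hg using Subgroup.closure_induction_right with
  | one => exact ⟨hv, fun y hy => hy⟩
  | mul_right x hx s hs ih => exact step x s hs ih
  | mul_inv_cancel x hx s hs ih =>
    have : s⁻¹ = s := by obtain ⟨u, hu, rfl⟩ := hs; exact refl_inv _
    rw [this]
    exact step x s hs ih

theorem Cfg.exists_map_eq (h : Cfg V A p p c) {v u : E} (hv : v ∈ V) (hu : u ∈ V) :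
    ∃ g ∈ Subgroup.closure (edgeRefls V v), g v = u := by
  classical
  refine h.pos.mem_of_adj_closed (C := {u | ∃ g ∈ Subgroup.closure (edgeRefls V v), g v = u}) ?_ hv
    ⟨1, Subgroup.one_mem _, rfl⟩ hu
  rintro _ hx ⟨g, hg, rfl⟩ w hw
  have hsub : (nbrs V v).image g ⊆ nbrs V (g v) := by
    intro y hy
    obtain ⟨x, hx, rfl⟩ := Finset.mem_image.1 hy
    exact mem_nbrs.2 ((h.adj_map hv hg).2 x (mem_nbrs.1 hx))
  obtain ⟨A₁, h₁, hA₁⟩ := h.exists_cfg_mem v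
  obtain ⟨A₂, h₂, hA₂⟩ := h.exists_cfg_mem (g v)
  have heq := Finset.eq_of_subset_of_card_le hsub (by
    rw [Finset.card_image_of_injective _ g.injective, h₁.card_nbrs le_rfl hv hA₁,
      h₂.card_nbrs le_rfl hx hA₂])
  have hw' := mem_nbrs.2 hw
  rw [← heq] at hw'
  obtain ⟨y, hy, rfl⟩ := Finset.mem_image.1 hw'
  have hy := mem_nbrs.1 hy
  refine ⟨g * refl (y - v), Subgroup.mul_mem _ hg (Subgroup.subset_closure ⟨y, hy, rfl⟩), ?_⟩
  change g (refl (y - v) v) = g y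
  rw [refl_sub_eq]
  rw [h.norm_eq hy.1, h.norm_eq hy.2.1]

theorem Cfg.closure_finite (h : Cfg V A p p c) (hW : vectorSpan ℝ (V : Set E) = ⊤) {v : E}
    (hv : v ∈ V) : (Subgroup.closure (edgeRefls V v) : Set (E ≃ₗᵢ[ℝ] E)).Finite := by
  have hspan : Submodule.span ℝ (V : Set E) = ⊤ := by
    rw [eq_top_iff, ← hW]
    exact Submodule.span_le.2 (by
      rintro _ ⟨x, hx, y, hy, rfl⟩
      exact Submodule.sub_mem _ (Submodule.subset_span hx) (Submodule.subset_span hy))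
  refine Set.Finite.of_injOn (f := fun g (u : V) => g u)
    (t := Set.pi Set.univ (fun _ => (V : Set E))) ?_ ?_ (Set.Finite.pi fun _ => V.finite_toSet)
  · rintro g hg ⟨u, hu⟩ -
    obtain ⟨g', hg', rfl⟩ := h.exists_map_eq hv hu
    exact (h.adj_map hv (Subgroup.mul_mem _ hg hg')).1
  · intro g _ g' _ hgg
    have : (g.toLinearEquiv : E →ₗ[ℝ] E) = g'.toLinearEquiv :=
      LinearMap.ext_on hspan fun u hu => congrFun hgg ⟨u, hu⟩
    ext u
    exact LinearMap.congr_fun this u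

/-- A gallery crossing a reflection hyperplane uses this reflection. -/
theorem Cfg.exists_crossing (h : Cfg V A p p c) {v a b : E} (hv : v ∈ V) (hab : Adj V a b)
    (L : List (E ≃ₗᵢ[ℝ] E)) (hL : ∀ s ∈ L, s ∈ edgeRefls V v) :
    ∀ g ∈ Subgroup.closure (edgeRefls V v), 0 < ⟪g v, b - a⟫_ℝ → ⟪g (L.prod v), b - a⟫_ℝ < 0 →
    ∃ L₁ s L₂, L = L₁ ++ s :: L₂ ∧ s ∈ edgeRefls V v ∧
      refl (b - a) = (g * L₁.prod) * s * (g * L₁.prod)⁻¹ := by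
  induction L with
  | nil =>
    intro g hg h1 h2
    exact absurd h1 (not_lt.2 h2.le)
  | cons s L ih =>
    intro g hg h1 h2
    have hs := hL s (by simp)
    have hgs : g * s ∈ Subgroup.closure (edgeRefls V v) :=
      Subgroup.mul_mem _ hg (Subgroup.subset_closure hs)
    rcases lt_trichotomy 0 ⟪(g * s) v, b - a⟫_ℝ with h3 | h3 | h3
    · obtain ⟨L₁, t, L₂, rfl, ht, he⟩ := ih (fun t ht => hL t (by simp [ht])) (g * s) hgs h3 (by
        rw [List.prod_cons] at h2
        exact h2)
      exact ⟨s :: L₁, t, L₂, rfl, ht, by rw [he, List.prod_cons, mul_assoc g s]⟩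
    · exact absurd h3.symm (h.inner_edge_ne_zero hab (h.adj_map hv hgs).1)
    · refine ⟨[], s, L, rfl, hs, ?_⟩
      obtain ⟨u, hu, rfl⟩ := hs
      have e1 : (g * refl (u - v)) v = g u := by
        change g (refl (u - v) v) = g u
        rw [refl_sub_eq]
        rw [h.norm_eq hu.1, h.norm_eq hu.2.1]
      rw [e1] at h3
      have h4 := h.parallel_of_crossing hab ((h.adj_map hv hg).2 u hu) h1 h3
      rw [List.prod_nil, mul_one, ← refl_map, map_sub]
      rcases h4 with h4 | h4
      · rw [h4]
      · rw [h4, refl_neg]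

theorem Cfg.prod_eq_one (h : Cfg V A p p c) {v : E} (hv : v ∈ V) (n : ℕ) :
    ∀ L : List (E ≃ₗᵢ[ℝ] E), L.length = n → (∀ s ∈ L, s ∈ edgeRefls V v) → L.prod v = v →
      L.prod = 1 := by
  induction n using Nat.strong_induction_on with
  | _ n ih =>
  rintro (_ | ⟨s, L⟩) hn hL hfix
  · rfl
  obtain ⟨u, hu, hs⟩ := hL s (by simp)
  have hsv : s v = u := by
    rw [hs, refl_sub_eq]
    rw [h.norm_eq hu.1, h.norm_eq hu.2.1]
  obtain ⟨A', h', hA'⟩ := h.exists_cfg_mem v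
  have hcp := h.c_lt_p
  have hin : ⟪v, u⟫_ℝ = c := h'.inner v u hu
  obtain ⟨L₁, t, L₂, rfl, ht, he⟩ := h.exists_crossing hv hu L (fun t ht => hL t (by simp [ht])) s
    (Subgroup.subset_closure (hL s (by simp)))
    (by rw [hsv, inner_sub_right, h.norm_eq hu.2.1, real_inner_comm, hin]; linarith)
    (by
      rw [List.prod_cons] at hfix
      change s (L.prod v) = v at hfix
      rw [hfix, inner_sub_right, h.norm_eq hu.1, hin]; linarith)
  have hss : s * s = 1 := by rw [hs]; exact refl_mul_self _
  rw [← hs] at he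
  have h1 : (s :: (L₁ ++ t :: L₂)).prod = (L₁ ++ L₂).prod := by
    have h2 : s * L₁.prod * t = L₁.prod := by
      have h3 : s * (s * L₁.prod) = s * L₁.prod * t := eq_mul_inv_iff_mul_eq.1 he
      rw [← h3, ← mul_assoc, hss, one_mul]
    rw [List.prod_cons, List.prod_append, List.prod_cons, List.prod_append, ← mul_assoc,
      ← mul_assoc, h2]
  rw [h1] at hfix ⊢
  refine ih (L₁ ++ L₂).length ?_ _ rfl (fun r hr => hL r ?_) hfix
  · rw [← hn]
    simp
  · rw [List.mem_append] at hr
    simp only [List.mem_cons, List.mem_append]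
    tauto

theorem Cfg.eq_one_of_fix (h : Cfg V A p p c) {v : E} (hv : v ∈ V) {g : E ≃ₗᵢ[ℝ] E}
    (hg : g ∈ Subgroup.closure (edgeRefls V v)) (hfix : g v = v) : g = 1 := by
  obtain ⟨L, hL, rfl⟩ := exists_list_of_mem_closure hg
  exact h.prod_eq_one hv _ L rfl hL hfix

end

section

theorem isLinearReflection_refl {d : ℕ} {e : Euc d} (he : e ≠ 0) : IsLinearReflection (refl e) := by
  have hee : 0 < ⟪e, e⟫_ℝ := real_inner_self_pos.2 he
  refine ⟨fun h => ?_, refl_mul_self e, ?_⟩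
  · have h1 : refl e e = e := by rw [h]; rfl
    rw [refl_apply, mul_div_assoc, div_self hee.ne', sub_eq_self, smul_eq_zero] at h1
    rcases h1 with h1 | h1
    · norm_num at h1
    · exact he h1
  · have h1 : LinearMap.ker (((refl e).toLinearEquiv : Euc d →ₗ[ℝ] Euc d) - LinearMap.id) =
        (Submodule.span ℝ {e})ᗮ := by
      ext y
      rw [LinearMap.mem_ker, LinearMap.sub_apply, LinearMap.id_apply,
        Submodule.mem_orthogonal_singleton_iff_inner_right, sub_eq_zero]
      change refl e y = y ↔ _
      rw [refl_apply, sub_eq_self, smul_eq_zero, div_eq_zero_iff]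
      simp [he]
    rw [h1]
    have h2 := Submodule.finrank_add_finrank_orthogonal (Submodule.span ℝ {e})
    rw [finrank_span_singleton he, finrank_euclideanSpace_fin] at h2
    omega

theorem Cfg.isPermutahedron {d : ℕ} {V : Finset (Euc d)} {A : Set (Euc d)} {p c : ℝ}
    (h : Cfg V A p p c) (hW : vectorSpan ℝ (V : Set (Euc d)) = ⊤) :
    IsPermutahedron (convexHull ℝ (V : Set (Euc d))) := by
  obtain ⟨v, hv⟩ := h.nonempty
  refine ⟨Subgroup.closure (edgeRefls V v), v, ⟨h.closure_finite hW hv, ?_⟩,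
    fun T hT hne hfix => hne (h.eq_one_of_fix hv hT hfix), ?_⟩
  · apply le_antisymm
    · rw [Subgroup.closure_le]
      intro s hs
      refine Subgroup.subset_closure ⟨?_, Subgroup.subset_closure hs⟩
      obtain ⟨u, hu, rfl⟩ := hs
      exact isLinearReflection_refl (sub_ne_zero.2 hu.2.2.1.symm)
    · rw [Subgroup.closure_le]
      rintro s ⟨-, hs⟩
      exact hs
  · congr 1
    ext u
    constructor
    · intro hu
      obtain ⟨g, hg, rfl⟩ := h.exists_map_eq hv hu
      exact ⟨g, hg, rfl⟩
    · rintro ⟨g, hg, rfl⟩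
      exact (h.adj_map hv hg).1

end

section

theorem convexPosition_of_convexIndependent {E : Type*} [NormedAddCommGroup E]
    [InnerProductSpace ℝ E] [FiniteDimensional ℝ E] {V : Finset E}
    (hV : ∀ v ∈ V, v ∉ convexHull ℝ ((V : Set E) \ {v})) : ConvexPosition V := by
  intro v hv
  have hc : IsClosed (convexHull ℝ ((V : Set E) \ {v})) :=
    ((V.finite_toSet.subset sdiff_subset).isCompact_convexHull (𝕜 := ℝ)).isClosed
  obtain ⟨f, r, h1, h2⟩ := geometric_hahn_banach_closed_point (convex_convexHull ℝ _) hc (hV v hv)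
  refine ⟨(InnerProductSpace.toDual ℝ E).symm f, fun u hu hne => ?_⟩
  rw [InnerProductSpace.toDual_symm_apply, InnerProductSpace.toDual_symm_apply]
  exact (h1 u (subset_convexHull ℝ _ ⟨hu, hne⟩)).trans h2

theorem isEdge_of_adj {d : ℕ} {V : Finset (Euc d)} {v w : Euc d} (h : Adj V v w) :
    IsEdge (convexHull ℝ (V : Set (Euc d))) v w := by
  classical
  obtain ⟨hv, hw, hne, z, hzw, hz⟩ := h
  refine ⟨hne, fun _ => ⟨innerSL ℝ z, ?_⟩⟩
  have hle : ∀ u ∈ V, ⟪z, u⟫_ℝ ≤ ⟪z, v⟫_ℝ := by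
    intro u hu
    by_cases h1 : u = v
    · rw [h1]
    by_cases h2 : u = w
    · rw [h2, hzw]
    · exact (hz u hu h1 h2).le
  have hleP : ∀ y ∈ convexHull ℝ (V : Set (Euc d)), ⟪z, y⟫_ℝ ≤ ⟪z, v⟫_ℝ := by
    intro y hy
    refine convexHull_min (t := {y | ⟪z, y⟫_ℝ ≤ ⟪z, v⟫_ℝ}) (fun u hu => hle u hu) ?_ hy
    exact convex_halfSpace_le (innerSL ℝ z).toLinearMap.isLinear _
  have hvP := subset_convexHull ℝ (V : Set (Euc d)) hv
  have hwP := subset_convexHull ℝ (V : Set (Euc d)) hw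
  ext x
  constructor
  · intro hx
    refine ⟨(convex_convexHull ℝ _).segment_subset hvP hwP hx, fun y hy => ?_⟩
    obtain ⟨a, b, ha, hb, hab, rfl⟩ := hx
    rw [innerSL_apply_apply, innerSL_apply_apply, inner_add_right, inner_smul_right,
      inner_smul_right, hzw, ← add_mul, hab, one_mul]
    exact hleP y hy
  · rintro ⟨hx, hmax⟩
    obtain ⟨l, hl0, hl1, rfl⟩ := Finset.mem_convexHull'.1 hx
    have h1 : ∑ u ∈ V, l u * (⟪z, u⟫_ℝ - ⟪z, v⟫_ℝ) = 0 := by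
      have h2 := hmax v hvP
      have h3 := hleP _ hx
      rw [innerSL_apply_apply, innerSL_apply_apply] at h2
      have h4 := le_antisymm h3 h2
      rw [inner_sum] at h4
      simp only [inner_smul_right] at h4
      simp only [mul_sub, Finset.sum_sub_distrib, ← Finset.sum_mul, hl1, h4]
      ring
    have h2 := (Finset.sum_eq_zero_iff_of_nonpos (fun u hu =>
      mul_nonpos_of_nonneg_of_nonpos (hl0 u hu) (sub_nonpos.2 (hle u hu)))).1 h1
    have h3 : ∀ u ∈ V, u ∉ ({v, w} : Finset (Euc d)) → l u = 0 := by
      intro u hu hn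
      rw [Finset.mem_insert, Finset.mem_singleton, not_or] at hn
      have := hz u hu hn.1 hn.2
      exact (mul_eq_zero.1 (h2 u hu)).resolve_right (by linarith)
    have hsub : ({v, w} : Finset (Euc d)) ⊆ V := by
      intro u hu
      rw [Finset.mem_insert, Finset.mem_singleton] at hu
      rcases hu with rfl | rfl <;> assumption
    rw [← Finset.sum_subset hsub (fun u hu hn => h3 u hu hn), Finset.sum_pair hne] at hl1
    rw [← Finset.sum_subset hsub (fun u hu hn => by rw [h3 u hu hn, zero_smul]),
      Finset.sum_pair hne]
    exact ⟨l v, l w, hl0 v hv, hl0 w hw, hl1, rfl⟩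

/-- The vertices of a bipartite polytope form a configuration. -/
theorem exists_cfg {d : ℕ} (hd : 2 ≤ d) {P V₁ V₂ : Set (Euc d)} {r₁ r₂ l : ℝ} (hP : IsPolytope P)
    (hfull : FullDim P) (hbip : IsBipartiteWith P V₁ V₂ r₁ r₂ l) :
    ∃ (V : Finset (Euc d)) (c : ℝ), (V : Set (Euc d)) = Set.extremePoints ℝ P ∧
      P = convexHull ℝ (V : Set (Euc d)) ∧ vectorSpan ℝ (V : Set (Euc d)) = ⊤ ∧
      Cfg V V₁ (r₁ ^ 2) (r₂ ^ 2) c := by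
  obtain ⟨S, rfl⟩ := hP
  obtain ⟨hl, hlen, hun, hdisj, hedge, hr1, hr12, hn1, hn2⟩ := hbip
  have hfin : (Set.extremePoints ℝ (convexHull ℝ (S : Set (Euc d)))).Finite :=
    S.finite_toSet.subset extremePoints_convexHull_subset
  have hhull : convexHull ℝ (S : Set (Euc d)) = convexHull ℝ (hfin.toFinset : Set (Euc d)) := by
    rw [hfin.coe_toFinset]
    have h1 := closure_convexHull_extremePoints
      (S.finite_toSet.isCompact_convexHull (𝕜 := ℝ)) (convex_convexHull ℝ (S : Set (Euc d)))
    rw [(hfin.isCompact_convexHull (𝕜 := ℝ)).isClosed.closure_eq] at h1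
    exact h1.symm
  set V := hfin.toFinset with hVdef
  have hVe : (V : Set (Euc d)) = Set.extremePoints ℝ (convexHull ℝ (S : Set (Euc d))) :=
    hfin.coe_toFinset
  have hspan : vectorSpan ℝ (V : Set (Euc d)) = ⊤ := by
    rw [FullDim, hhull, affineSpan_convexHull] at hfull
    rw [← direction_affineSpan, hfull, AffineSubspace.direction_top]
  have hadj : ∀ v w, Adj V v w → IsEdge (convexHull ℝ (S : Set (Euc d))) v w := by
    intro v w h
    rw [hhull]
    exact isEdge_of_adj h
  have hmem : ∀ v ∈ V, v ∉ V₁ → v ∈ V₂ := by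
    intro v hv hn
    have : v ∈ (V : Set (Euc d)) := hv
    rw [hVe, ← hun] at this
    exact this.resolve_left hn
  refine ⟨V, (r₁ ^ 2 + r₂ ^ 2 - l ^ 2) / 2, hVe, hhull, hspan, ?_, ?_, ?_, ?_, ?_, ?_⟩
  · apply convexPosition_of_convexIndependent
    intro v hv
    rw [hVe]
    have := (convex_convexHull ℝ (S : Set (Euc d))).convexIndependent_extremePoints
    rw [convexIndependent_set_iff_notMem_convexHull_sdiff] at this
    exact this v (by rw [← hVe]; exact hv)
  · intro v _ hA
    rw [real_inner_self_eq_norm_sq, hn1 v hA]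
  · intro v hv hA
    rw [real_inner_self_eq_norm_sq, hn2 v (hmem v hv hA)]
  · intro v w h
    rcases hedge v w (hadj v w h) with ⟨h1, h2⟩ | ⟨h1, h2⟩
    · exact ⟨fun _ h3 => Set.disjoint_left.1 hdisj h3 h2, fun _ => h1⟩
    · exact ⟨fun h3 => absurd h1 (Set.disjoint_left.1 hdisj h3), fun h3 => absurd h2 h3⟩
  · intro v w h
    have h1 := hlen v w (hadj v w h)
    have h2 : ‖v‖ ^ 2 + ‖w‖ ^ 2 = r₁ ^ 2 + r₂ ^ 2 := by
      rcases hedge v w (hadj v w h) with ⟨h3, h4⟩ | ⟨h3, h4⟩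
      · rw [hn1 v h3, hn2 w h4]
      · rw [hn2 v h3, hn1 w h4, add_comm]
    have h3 := norm_sub_sq_real v w
    rw [h1] at h3
    linarith
  · rw [hspan, finrank_top, finrank_euclideanSpace_fin]
    exact hd

end

section

theorem polyPt_eq_iff {a b : ℝ} {k : ℕ} {f g : E} (hk : 0 < k) (ha : 0 < a) (hb : 0 < b)
    (hf : ⟪f, f⟫_ℝ = 1) (hg : ⟪g, g⟫_ℝ = 1) (hfg : ⟪f, g⟫_ℝ = 0) {i j : ℤ}
    (hpar : Even i ↔ Even j)
    (h : polyPt 0 f g a b (Real.pi / k) i = polyPt 0 f g a b (Real.pi / k) j) :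
    ∃ n : ℤ, j - i = 2 * k * n := by
  have h1 := inner_polyPt (a := a) (b := b) (θ := Real.pi / k) hf hg hfg i i
  have h2 := inner_polyPt (a := a) (b := b) (θ := Real.pi / k) hf hg hfg i j
  rw [← h, h1] at h2
  set r := if Even i then a else b with hr
  have hr' : (if Even j then a else b) = r := by rw [hr, if_congr hpar rfl rfl]
  have hr0 : 0 < r := by rw [hr]; split_ifs <;> assumption
  rw [hr', sub_self, Int.cast_zero, zero_mul, Real.cos_zero] at h2
  have h3 : Real.cos (((j - i : ℤ) : ℝ) * (Real.pi / k)) = 1 :=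
    (mul_left_cancel₀ (mul_pos hr0 hr0).ne' h2).symm
  obtain ⟨n, hn⟩ := (Real.cos_eq_one_iff _).1 h3
  refine ⟨n, ?_⟩
  have hk' : (k : ℝ) ≠ 0 := by positivity
  have hπ := Real.pi_ne_zero
  have : ((j - i : ℤ) : ℝ) = 2 * k * n := by
    field_simp at hn
    linarith
  exact_mod_cast this

theorem Cfg.even_card {V : Finset E} {A : Set E} {p q c : ℝ} (h : Cfg V A p q c) (hpq : p ≤ q)
    (hW : ∀ u ∈ V, u ∈ vectorSpan ℝ (V : Set E))
    (hdim : Module.finrank ℝ (vectorSpan ℝ (V : Set E)) = 2) : Even V.card := by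
  classical
  obtain ⟨v, hv, hvA⟩ := h.exists_mem
  obtain ⟨w, hw, -⟩ := h.exists_adj hv v
  obtain ⟨k, f, g, hP, -⟩ := h.exists_polygon_centered hpq hW hdim hw hvA
  have hk : 0 < k := by have := hP.two_le; omega
  have hV : V = (Finset.range (2 * k)).image
      (fun j : ℕ => polyPt 0 f g √p √q (Real.pi / k) (j : ℤ)) := by
    ext u
    rw [Finset.mem_image]
    constructor
    · intro hu
      obtain ⟨j, rfl⟩ := hP.surj u hu
      have h2k : (0 : ℤ) < 2 * k := by omega
      have h0 := Int.emod_nonneg j h2k.ne'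
      have h1 := Int.emod_lt_of_pos j h2k
      have h2 := Int.emod_add_mul_ediv j (2 * k)
      refine ⟨(j % (2 * k)).toNat, by rw [Finset.mem_range]; omega, ?_⟩
      rw [Int.toNat_of_nonneg h0]
      have hpar : Even (j % (2 * k)) ↔ Even j := by
        rw [Int.even_iff, Int.even_iff, Int.emod_emod_of_dvd _ (dvd_mul_right 2 _)]
      have hang : (j : ℝ) * (Real.pi / k) =
          ((j % (2 * k) : ℤ) : ℝ) * (Real.pi / k) + ((j / (2 * k) : ℤ) : ℝ) * (2 * Real.pi) := by
        have : (j : ℝ) = ((j % (2 * k) : ℤ) : ℝ) + 2 * k * ((j / (2 * k) : ℤ) : ℝ) := by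
          exact_mod_cast h2.symm
        have hk' : (k : ℝ) ≠ 0 := by positivity
        conv_lhs => rw [this]
        field_simp
      rw [polyPt, polyPt, if_congr hpar rfl rfl, hang, Real.cos_add_int_mul_two_pi,
        Real.sin_add_int_mul_two_pi]
    · rintro ⟨j, -, rfl⟩
      exact hP.mem j
  rw [hV, Finset.card_image_of_injOn, Finset.card_range]
  · exact even_two_mul k
  · intro i hi j hj hij
    simp only [Finset.coe_range, Set.mem_Iio] at hi hj
    have hpar : Even (i : ℤ) ↔ Even (j : ℤ) := by
      rw [← hP.memA i, ← hP.memA j, show polyPt 0 f g √p √q (Real.pi / k) i = _ from hij]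
    obtain ⟨n, hn⟩ := polyPt_eq_iff hk (Real.sqrt_pos.2 h.p_pos) (Real.sqrt_pos.2 h.q_pos) hP.ff
      hP.gg hP.fg hpar hij
    have h1 : n < 1 := by nlinarith
    have h2 : -1 < n := by nlinarith
    have : n = 0 := by omega
    rw [this] at hn
    omega

end

section

/-- `t` is the squared distance from the origin to a `2 k`-gonal face. -/
structure FaceType (p q c : ℝ) (k : ℕ) (t : ℝ) : Prop where
  two_le : 2 ≤ k
  pos : 0 < t
  le : t ≤ c
  eq : (p - t) * (q - t) * Real.cos (Real.pi / k) ^ 2 = (c - t) ^ 2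

/-- The dihedral angle in the direction of a vertex with squared norm `p` of a `2 k`-gonal face,
measured in full turns. -/
def ang (p q c : ℝ) (k : ℕ) (t : ℝ) : ℝ :=
  Real.arccos ((t + (q - t) * Real.cos (2 * (Real.pi / k)) - c ^ 2 / p) / (q - c ^ 2 / p)) /
    (2 * Real.pi)

namespace FaceType

variable {p q c t t' : ℝ} {k k' : ℕ}

theorem symm (h : FaceType p q c k t) : FaceType q p c k t where
  two_le := h.two_le
  pos := h.pos
  le := h.le
  eq := by rw [← h.eq]; ring

theorem cos_nonneg (h : FaceType p q c k t) : 0 ≤ Real.cos (Real.pi / k) := by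
  have hk : (2 : ℝ) ≤ k := by exact_mod_cast h.two_le
  have hπ := Real.pi_pos
  apply Real.cos_nonneg_of_mem_Icc
  refine ⟨?_, by gcongr⟩
  have : 0 ≤ Real.pi / k := by positivity
  linarith

theorem sin_pos (h : FaceType p q c k t) : 0 < Real.sin (Real.pi / k) := by
  have hk : (2 : ℝ) ≤ k := by exact_mod_cast h.two_le
  have hπ := Real.pi_pos
  apply Real.sin_pos_of_pos_of_lt_pi
  · positivity
  · exact div_lt_self hπ (by linarith)

theorem ang_spec (h : FaceType p q c k t) (hp : c < p) (hq : c < q) :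
    0 ≤ Real.pi * ang p q c k t ∧ Real.pi * ang p q c k t ≤ Real.pi / 2 ∧
    Real.cos (Real.pi * ang p q c k t) ^ 2 = (p - c) ^ 2 * t / ((p * q - c ^ 2) * (p - t)) ∧
    Real.sin (Real.pi * ang p q c k t) ^ 2 =
      p * (q - t) * Real.sin (Real.pi / k) ^ 2 / (p * q - c ^ 2) := by
  have h0 := h.pos
  have h1 := h.le
  have hπ := Real.pi_pos
  have hS : 0 < p * q - c ^ 2 := by nlinarith
  have hp0 : 0 < p := by linarith
  have hpt : 0 < p - t := by linarith
  have hqt : 0 < q - t := by linarith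
  set y := (t + (q - t) * Real.cos (2 * (Real.pi / k)) - c ^ 2 / p) / (q - c ^ 2 / p) with hy
  have hang : Real.pi * ang p q c k t = Real.arccos y / 2 := by
    rw [ang, ← hy]
    field_simp
  have hx := h.eq
  have hsc := Real.sin_sq_add_cos_sq (Real.pi / k)
  have hy' : y = (p * (t + (q - t) * (2 * Real.cos (Real.pi / k) ^ 2 - 1)) - c ^ 2) /
      (p * q - c ^ 2) := by
    have hqc : q - c ^ 2 / p = (p * q - c ^ 2) / p := by field_simp
    rw [hy, hqc, Real.cos_two_mul]
    field_simp
  have hcos : (1 + y) / 2 = (p - c) ^ 2 * t / ((p * q - c ^ 2) * (p - t)) := by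
    rw [hy']
    generalize hSe : p * q - c ^ 2 = S at hS
    field_simp
    linear_combination 2 * p * hx - (p - t) * hSe
  have hsin : (1 - y) / 2 = p * (q - t) * Real.sin (Real.pi / k) ^ 2 / (p * q - c ^ 2) := by
    rw [hy']
    generalize hSe : p * q - c ^ 2 = S at hS
    field_simp
    linear_combination (- 2 * p * (q - t)) * hsc - hSe
  have hy1 : -1 ≤ y := by
    have : 0 ≤ (1 + y) / 2 := by rw [hcos]; positivity
    linarith
  have hy2 : y ≤ 1 := by
    have : 0 ≤ (1 - y) / 2 := by rw [hsin]; positivity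
    linarith
  have h3 := Real.arccos_nonneg y
  have h4 := Real.arccos_le_pi y
  have h5 : Real.cos (Real.arccos y / 2) ^ 2 = (1 + y) / 2 := by
    rw [Real.cos_sq, mul_div_cancel₀ _ two_ne_zero, Real.cos_arccos hy1 hy2]
    ring
  rw [hang]
  refine ⟨by linarith, by linarith, by rw [h5, hcos], ?_⟩
  rw [Real.sin_sq, h5, ← hsin]
  ring

theorem ang_lt_half (h : FaceType p q c k t) (hp : c < p) (hq : c < q) : ang p q c k t < 1 / 2 := by
  have h1 := h.ang_spec hp hq
  have hπ := Real.pi_pos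
  by_contra! hc
  have h2 : Real.pi * ang p q c k t = Real.pi / 2 := by
    apply le_antisymm h1.2.1
    nlinarith
  have h3 := h1.2.2.1
  rw [h2, Real.cos_pi_div_two] at h3
  have h0 := h.pos
  have hle := h.le
  have hS : 0 < p * q - c ^ 2 := by nlinarith
  have hpt : 0 < p - t := by linarith
  have hpc : 0 < p - c := by linarith
  have : 0 < (p - c) ^ 2 * t / ((p * q - c ^ 2) * (p - t)) := by positivity
  rw [← h3] at this
  norm_num at this

theorem lt_of_cos_sq_lt {x y : ℝ} (hx : 0 ≤ Real.pi * x) (hx' : Real.pi * x ≤ Real.pi / 2)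
    (hy : 0 ≤ Real.pi * y)
    (h : Real.cos (Real.pi * y) ^ 2 < Real.cos (Real.pi * x) ^ 2) : x < y := by
  have hπ := Real.pi_pos
  have hcx : 0 ≤ Real.cos (Real.pi * x) := Real.cos_nonneg_of_mem_Icc ⟨by linarith, hx'⟩
  by_contra! hle
  have h1 : Real.cos (Real.pi * x) ≤ Real.cos (Real.pi * y) :=
    Real.cos_le_cos_of_nonneg_of_le_pi hy (by linarith) (by nlinarith)
  nlinarith

theorem ang_swap_lt (h : FaceType p q c k t) (hp : c < p) (hpq : p < q) :
    ang q p c k t < ang p q c k t := by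
  have hq : c < q := hp.trans hpq
  have h1 := h.ang_spec hp hq
  have h2 := h.symm.ang_spec hq hp
  refine lt_of_cos_sq_lt h2.1 h2.2.1 h1.1 ?_
  rw [h1.2.2.1, h2.2.2.1, mul_comm q p]
  have h0 := h.pos
  have hle := h.le
  have hS : 0 < p * q - c ^ 2 := by nlinarith
  have hpt : 0 < p - t := by linarith
  have hqt : 0 < q - t := by linarith
  rw [div_lt_div_iff₀ (by positivity) (by positivity)]
  have key : (p - c) ^ 2 * (q - t) < (q - c) ^ 2 * (p - t) := by
    have e : (q - c) ^ 2 * (p - t) - (p - c) ^ 2 * (q - t) =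
        (q - p) * ((p - c) * (q - c) + (c - t) * (p - c + (q - c))) := by ring
    have : 0 < (q - p) * ((p - c) * (q - c) + (c - t) * (p - c + (q - c))) := by
      have h5 : 0 < q - p := by linarith
      have h6 : 0 < p - c := by linarith
      have h7 : 0 < q - c := by linarith
      have h8 : 0 ≤ c - t := by linarith
      positivity
    linarith
  have := mul_lt_mul_of_pos_left key (mul_pos h0 hS)
  linarith

theorem t_lt (h : FaceType p q c k t) (h' : FaceType p q c k' t') (hp : c < p) (hq : c < q)
    (hk : k < k') : t' < t := by
  have hπ := Real.pi_pos
  have hk2 := h.two_le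
  have hcos : Real.cos (Real.pi / k) < Real.cos (Real.pi / k') := by
    apply Real.cos_lt_cos_of_nonneg_of_le_pi
    · positivity
    · exact div_le_self hπ.le (by exact_mod_cast (by omega : 1 ≤ k))
    · gcongr
  have hc0 := h.cos_nonneg
  have e := h.eq
  have e' := h'.eq
  by_contra! hle
  have h1 := h.le
  have h2 := h'.le
  have hx : Real.cos (Real.pi / k) ^ 2 < Real.cos (Real.pi / k') ^ 2 := by gcongr
  have h3 : (c - t') * (p - t) ≤ (c - t) * (p - t') := by nlinarith
  have h4 : (c - t') * (q - t) ≤ (c - t) * (q - t') := by nlinarith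
  have h5 : (c - t') * (p - t) * ((c - t') * (q - t)) ≤
      (c - t) * (p - t') * ((c - t) * (q - t')) :=
    mul_le_mul h3 h4 (mul_nonneg (by linarith) (by linarith))
      (mul_nonneg (by linarith) (by linarith))
  have h6 : 0 < (p - t) * (q - t) * ((p - t') * (q - t')) :=
    mul_pos (mul_pos (by linarith) (by linarith)) (mul_pos (by linarith) (by linarith))
  have h7 : (p - t) * (q - t) * ((p - t') * (q - t')) * Real.cos (Real.pi / k') ^ 2 ≤
      (p - t) * (q - t) * ((p - t') * (q - t')) * Real.cos (Real.pi / k) ^ 2 := by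
    have : (p - t) * (q - t) * ((p - t') * (q - t')) * Real.cos (Real.pi / k') ^ 2 =
        (c - t') * (p - t) * ((c - t') * (q - t)) := by linear_combination (p - t) * (q - t) * e'
    rw [this]
    refine h5.trans_eq ?_
    linear_combination - (p - t') * (q - t') * e
  exact absurd (le_of_mul_le_mul_left h7 h6) (not_le.2 hx)

theorem t_unique (h : FaceType p q c k t) (h' : FaceType p q c k t') (hp : c < p) (hq : c < q) :
    t = t' := by
  by_contra hne
  wlog hlt : t < t' generalizing t t'
  · exact this h' h (Ne.symm hne) (lt_of_le_of_ne (not_lt.1 hlt) (Ne.symm hne))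
  have h1 := h.le
  have h2 := h'.le
  have e := h.eq
  have e' := h'.eq
  have h3 : (c - t') * (p - t) < (c - t) * (p - t') := by nlinarith
  have h4 : (c - t') * (q - t) < (c - t) * (q - t') := by nlinarith
  have h5 : (c - t') * (p - t) * ((c - t') * (q - t)) <
      (c - t) * (p - t') * ((c - t) * (q - t')) :=
    mul_lt_mul'' h3 h4 (mul_nonneg (by linarith) (by linarith))
      (mul_nonneg (by linarith) (by linarith))
  refine absurd h5 (not_lt.2 (le_of_eq ?_))
  linear_combination -(p - t') * (q - t') * e + (p - t) * (q - t) * e'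

theorem ang_lt (h : FaceType p q c k t) (h' : FaceType p q c k' t') (hp : c < p) (hq : c < q)
    (hk : k < k') : ang p q c k t < ang p q c k' t' := by
  have h1 := h.ang_spec hp hq
  have h2 := h'.ang_spec hp hq
  have ht := h.t_lt h' hp hq hk
  refine lt_of_cos_sq_lt h1.1 h1.2.1 h2.1 ?_
  rw [h1.2.2.1, h2.2.2.1]
  have h0 := h'.pos
  have hle := h.le
  have hS : 0 < p * q - c ^ 2 := by nlinarith
  have hpt : 0 < p - t := by linarith
  have hqt : 0 < p - t' := by linarith
  rw [div_lt_div_iff₀ (by positivity) (by positivity)]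
  have hpc : 0 < (p - c) ^ 2 * (p * q - c ^ 2) := by
    have : 0 < p - c := by linarith
    positivity
  have key : t' * (p - t) < t * (p - t') := by nlinarith
  have := mul_lt_mul_of_pos_left key hpc
  linarith

theorem ang_add_gt (h : FaceType p q c k t) (hp : c < p) (hq : c < q) :
    1 - 1 / (k : ℝ) < ang p q c k t + ang q p c k t := by
  have hπ := Real.pi_pos
  have h1 := h.ang_spec hp hq
  have h2 := h.symm.ang_spec hq hp
  have h0 := h.pos
  have hle := h.le
  have hk : (2 : ℝ) ≤ k := by exact_mod_cast h.two_le
  have hs := h.sin_pos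
  have hc0 := h.cos_nonneg
  rw [mul_comm q p] at h2
  obtain ⟨a1, a2, a3, a4⟩ := h1
  obtain ⟨b1, b2, b3, b4⟩ := h2
  set α := Real.pi * ang p q c k t with hα
  set β := Real.pi * ang q p c k t with hβ
  set S := p * q - c ^ 2 with hSdef
  have hS : 0 < S := by rw [hSdef]; nlinarith
  have hpt : 0 < p - t := by linarith
  have hqt : 0 < q - t := by linarith
  have hpc : 0 < p - c := by linarith
  have hqc : 0 < q - c := by linarith
  set D := √((p - t) * (q - t)) with hD
  have hDD : D ^ 2 = (p - t) * (q - t) := Real.sq_sqrt (by positivity)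
  have hD0 : 0 < D := Real.sqrt_pos.2 (by positivity)
  set R := √(p * q) with hR
  have hRR : R ^ 2 = p * q := Real.sq_sqrt (by nlinarith)
  have hR0 : 0 < R := Real.sqrt_pos.2 (by nlinarith)
  have hRc : c < R := by
    rw [hR]
    apply Real.lt_sqrt_of_sq_lt
    nlinarith
  set s := Real.sin (Real.pi / k) with hsdef
  set x := Real.cos (Real.pi / k) with hxdef
  have hsx : s ^ 2 + x ^ 2 = 1 := Real.sin_sq_add_cos_sq _
  have hDx : D * x = c - t := by
    rw [← sq_eq_sq₀ (by positivity) (by linarith), mul_pow, hDD]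
    exact h.eq
  have hcc : Real.cos α * Real.cos β = (p - c) * (q - c) * t / (S * D) := by
    have e1 : 0 ≤ Real.cos α := Real.cos_nonneg_of_mem_Icc ⟨by linarith, a2⟩
    have e2 : 0 ≤ Real.cos β := Real.cos_nonneg_of_mem_Icc ⟨by linarith, b2⟩
    rw [← sq_eq_sq₀ (by positivity) (by positivity), mul_pow, a3, b3, div_pow, mul_pow S, hDD]
    field_simp
  have hss : Real.sin α * Real.sin β = R * D * s ^ 2 / S := by
    have e1 : 0 ≤ Real.sin α := Real.sin_nonneg_of_nonneg_of_le_pi a1 (by linarith)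
    have e2 : 0 ≤ Real.sin β := Real.sin_nonneg_of_nonneg_of_le_pi b1 (by linarith)
    rw [← sq_eq_sq₀ (by positivity) (by positivity), mul_pow, a4, b4, div_pow, mul_pow (R * D),
      mul_pow R, hDD, hRR]
    field_simp
  have hDs : D ^ 2 * s ^ 2 = S - t * (p + q - 2 * c) := by
    have : s ^ 2 = 1 - x ^ 2 := by linarith
    rw [this, mul_sub, ← mul_pow, hDx, hDD, hSdef]
    ring
  have hcos : Real.cos (α + β) < Real.cos (Real.pi - Real.pi / k) := by
    rw [Real.cos_pi_sub, Real.cos_add, hcc, hss, ← hxdef]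
    have hx : x = (c - t) / D := by rw [← hDx]; field_simp
    rw [hx, ← sub_neg, sub_neg_eq_add]
    have e : (p - c) * (q - c) * t / (S * D) - R * D * s ^ 2 / S + (c - t) / D =
        (c - R) * (D ^ 2 * s ^ 2) / (S * D) := by
      field_simp
      linear_combination (-c) * hDs + t * hSdef
    rw [e]
    apply div_neg_of_neg_of_pos _ (by positivity)
    exact mul_neg_of_neg_of_pos (by linarith) (by positivity)
  have h3 : Real.pi - Real.pi / k < α + β := by
    by_contra! hcon
    have := Real.cos_le_cos_of_nonneg_of_le_pi (by linarith)
      (by have : 0 ≤ Real.pi / k := by positivity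
          linarith) hcon
    linarith
  have h4 : Real.pi * (1 - 1 / (k : ℝ)) < Real.pi * (ang p q c k t + ang q p c k t) := by
    rw [mul_add, ← hα, ← hβ, mul_sub, mul_one, mul_one_div]
    exact h3
  exact lt_of_mul_lt_mul_left h4 hπ.le

end FaceType

end

section

/-- The types of faces around the inner vertices of a three-dimensional configuration: `S₁` lists
the triples of types around inner vertices, `a` and `b` give the dihedral angles at inner and outer
vertices. -/
structure InnerTypes (occ : ℕ → Prop) (a b : ℕ → ℝ) (S₁ : ℕ → ℕ → ℕ → Prop) : Prop where
  two_le : ∀ k, occ k → 2 ≤ k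
  b_lt_a : ∀ k, occ k → b k < a k
  a_lt_half : ∀ k, occ k → a k < 1 / 2
  add_gt : ∀ k : ℕ, occ k → 1 - 1 / (k : ℝ) < a k + b k
  a_mono : ∀ i j, occ i → occ j → i < j → a i < a j
  b_mono : ∀ i j, occ i → occ j → i < j → b i < b j
  nonempty : ∃ i j k, S₁ i j k
  occ₁ : ∀ i j k, S₁ i j k → occ i
  sum₁ : ∀ i j k, S₁ i j k → a i + a j + a k = 1
  swap₁ : ∀ i j k, S₁ i j k → S₁ j i k
  rot₁ : ∀ i j k, S₁ i j k → S₁ j k i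

/-- The possible types of faces around all the vertices: `S₃, S₄, S₅` list the cyclic sequences of
types around outer vertices. -/
structure TypeSystem (occ : ℕ → Prop) (a b : ℕ → ℝ) (S₁ S₃ : ℕ → ℕ → ℕ → Prop)
    (S₄ : ℕ → ℕ → ℕ → ℕ → Prop) (S₅ : ℕ → ℕ → ℕ → ℕ → ℕ → Prop) : Prop
    extends InnerTypes occ a b S₁ where
  sum₃ : ∀ i j k, S₃ i j k → b i + b j + b k = 1
  rot₃ : ∀ i j k, S₃ i j k → S₃ j k i
  sum₄ : ∀ i j k l, S₄ i j k l → b i + b j + b k + b l = 1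
  rot₄ : ∀ i j k l, S₄ i j k l → S₄ j k l i
  sum₅ : ∀ i j k l m, S₅ i j k l m → b i + b j + b k + b l + b m = 1
  rot₅ : ∀ i j k l m, S₅ i j k l m → S₅ j k l m i
  edge₁ : ∀ i j k, S₁ i j k →
    (∃ x, S₃ i j x) ∨ (∃ x y, S₄ i j x y) ∨ (∃ x y z, S₅ i j x y z)
  edge₃ : ∀ i j k, S₃ i j k → ∃ x, S₁ i j x
  edge₄ : ∀ i j k l, S₄ i j k l → ∃ x, S₁ i j x
  edge₅ : ∀ i j k l m, S₅ i j k l m → ∃ x, S₁ i j x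
  rhombus : ∀ i j l, S₄ i 2 j l → ∃ i' j', S₁ i 2 i' ∧ S₁ 2 j j' ∧
    (S₃ i' 2 j' ∨ (∃ x, S₄ i' 2 j' x) ∨ (∃ x y, S₅ i' 2 j' x y))

namespace InnerTypes

variable {occ : ℕ → Prop} {a b : ℕ → ℝ} {S₁ : ℕ → ℕ → ℕ → Prop}

theorem a_inj (h : InnerTypes occ a b S₁) {i j : ℕ} (hi : occ i) (hj : occ j)
    (hij : a i = a j) : i = j := by
  rcases lt_trichotomy i j with h1 | h1 | h1
  · have := h.a_mono i j hi hj h1; linarith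
  · exact h1
  · have := h.a_mono j i hj hi h1; linarith

theorem inv_sum (h : InnerTypes occ a b S₁) {i j k : ℕ} (hs : S₁ i j k) :
    1 < 1 / (i : ℝ) + 1 / j + 1 / k := by
  have hi := h.occ₁ _ _ _ hs
  have hj := h.occ₁ _ _ _ (h.rot₁ _ _ _ hs)
  have hk := h.occ₁ _ _ _ (h.rot₁ _ _ _ (h.rot₁ _ _ _ hs))
  linarith [h.add_gt i hi, h.add_gt j hj, h.add_gt k hk, h.b_lt_a i hi, h.b_lt_a j hj,
    h.b_lt_a k hk, h.sum₁ _ _ _ hs]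

theorem inv_le {m n : ℕ} (hm : 0 < m) (hmn : m ≤ n) : 1 / (n : ℝ) ≤ 1 / m := by
  have : (0 : ℝ) < m := by exact_mod_cast hm
  have : (m : ℝ) ≤ n := by exact_mod_cast hmn
  gcongr

theorem eq_two (h : InnerTypes occ a b S₁) {i j k : ℕ} (hs : S₁ i j k) (hi : 3 ≤ i)
    (hj : 3 ≤ j) : k = 2 := by
  have h1 := h.inv_sum hs
  have hk := h.two_le k (h.occ₁ _ _ _ (h.rot₁ _ _ _ (h.rot₁ _ _ _ hs)))
  by_contra hne
  have e1 := inv_le (by norm_num) hi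
  have e2 := inv_le (by norm_num) hj
  have e3 := inv_le (m := 3) (by norm_num) (by omega : 3 ≤ k)
  norm_num at e1 e2 e3 h1
  linarith

theorem le_five (h : InnerTypes occ a b S₁) {i j : ℕ} (hs : S₁ 2 i j) (hi : 3 ≤ i)
    (hj : 3 ≤ j) : (i = 3 ∧ j ≤ 5) ∨ (j = 3 ∧ i ≤ 5) := by
  have h1 := h.inv_sum hs
  by_contra! hne
  rcases (by omega : (4 ≤ i ∧ 4 ≤ j) ∨ (3 ≤ i ∧ 6 ≤ j) ∨ (6 ≤ i ∧ 3 ≤ j)) with h2 | h2 | h2 <;>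
  · have e1 := inv_le (by norm_num) h2.1
    have e2 := inv_le (by norm_num) h2.2
    norm_num at e1 e2 h1
    linarith

theorem a_le (h : InnerTypes occ a b S₁) {i j : ℕ} (hi : occ i) (hj : occ j)
    (hij : i ≤ j) : a i ≤ a j := by
  rcases hij.eq_or_lt with rfl | h1
  · rfl
  · exact (h.a_mono _ _ hi hj h1).le

theorem b_le (h : InnerTypes occ a b S₁) {i j : ℕ} (hi : occ i) (hj : occ j)
    (hij : i ≤ j) : b i ≤ b j := by
  rcases hij.eq_or_lt with rfl | h1
  · rfl
  · exact (h.b_mono _ _ hi hj h1).le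

theorem occ_two (h : InnerTypes occ a b S₁) : occ 2 := by
  obtain ⟨i, j, k, hs⟩ := h.nonempty
  have hi := h.occ₁ _ _ _ hs
  have hj := h.occ₁ _ _ _ (h.rot₁ _ _ _ hs)
  have hk := h.occ₁ _ _ _ (h.rot₁ _ _ _ (h.rot₁ _ _ _ hs))
  rcases (h.two_le i hi).eq_or_lt with rfl | h1
  · exact hi
  rcases (h.two_le j hj).eq_or_lt with rfl | h2
  · exact hj
  · rwa [h.eq_two hs h1 h2] at hk

theorem a_two_le (h : InnerTypes occ a b S₁) : a 2 ≤ 1 / 3 := by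
  obtain ⟨i, j, k, hs⟩ := h.nonempty
  have hi := h.occ₁ _ _ _ hs
  have hj := h.occ₁ _ _ _ (h.rot₁ _ _ _ hs)
  have hk := h.occ₁ _ _ _ (h.rot₁ _ _ _ (h.rot₁ _ _ _ hs))
  have h2 := h.occ_two
  linarith [h.sum₁ _ _ _ hs, h.a_le h2 hi (h.two_le _ hi), h.a_le h2 hj (h.two_le _ hj),
    h.a_le h2 hk (h.two_le _ hk)]

theorem b_two_gt (h : InnerTypes occ a b S₁) : 1 / 6 < b 2 := by
  have h1 := h.add_gt 2 h.occ_two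
  have := h.a_two_le
  norm_num at h1
  linarith

theorem b_two_le (h : InnerTypes occ a b S₁) {i j k : ℕ} (hs : S₁ i j k) : b 2 ≤ b i :=
  h.b_le h.occ_two (h.occ₁ _ _ _ hs) (h.two_le _ (h.occ₁ _ _ _ hs))

end InnerTypes

namespace TypeSystem

variable {occ : ℕ → Prop} {a b : ℕ → ℝ} {S₁ S₃ : ℕ → ℕ → ℕ → Prop}
  {S₄ : ℕ → ℕ → ℕ → ℕ → Prop} {S₅ : ℕ → ℕ → ℕ → ℕ → ℕ → Prop}

open InnerTypes

/-- If a rhombus, a hexagon and a larger face meet at an inner vertex, there is no space left around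
the outer vertices. -/
theorem not_two_three_big (h : TypeSystem occ a b S₁ S₃ S₄ S₅) {j : ℕ} (hj : 4 ≤ j) :
    ¬ S₁ 2 3 j := by
  intro hs
  have h2 := h.occ_two
  have hs3 := h.rot₁ _ _ _ hs
  have hsj := h.rot₁ _ _ _ hs3
  have o3 := h.occ₁ _ _ _ hs3
  have oj := h.occ₁ _ _ _ hsj
  have hsum := h.sum₁ _ _ _ hs
  have ha := h.a_mono 3 j o3 oj (by omega)
  have b3 := h.b_lt_a _ o3
  have bj := h.b_lt_a _ oj
  have b2 := h.b_lt_a _ h2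
  have hb2 := h.b_two_gt
  have big : 11 / 12 < b 2 + b 3 + b j := by
    have e1 := h.add_gt 2 h2
    have e2 := h.add_gt 3 o3
    have e3 := h.add_gt j oj
    have e4 := inv_le (by norm_num) hj
    norm_num at e1 e2 e3 e4
    linarith
  rcases h.edge₁ _ _ _ hs3 with ⟨x, hx⟩ | ⟨x, y, hx⟩ | ⟨x, y, z, hx⟩
  · obtain ⟨y, hy⟩ := h.edge₃ _ _ _ (h.rot₃ _ _ _ hx)
    obtain ⟨z, hz⟩ := h.edge₃ _ _ _ (h.rot₃ _ _ _ (h.rot₃ _ _ _ hx))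
    have ox := h.occ₁ _ _ _ hz
    have hbsum := h.sum₃ _ _ _ hx
    rcases (h.two_le x ox).eq_or_lt with rfl | hx3
    · linarith
    · have hy2 := h.eq_two hy (by omega) hx3
      have hz2 := h.eq_two hz hx3 le_rfl
      subst hy2 hz2
      have h4 := h.sum₁ _ _ _ hy
      have h5 := h.sum₁ _ _ _ hz
      have : x = 3 := h.a_inj ox o3 (by linarith)
      subst this
      linarith
  · obtain ⟨u, hu⟩ := h.edge₄ _ _ _ _ (h.rot₄ _ _ _ _ (h.rot₄ _ _ _ _ hx))
    obtain ⟨w, hw⟩ := h.edge₄ _ _ _ _ (h.rot₄ _ _ _ _ (h.rot₄ _ _ _ _ (h.rot₄ _ _ _ _ hx)))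
    linarith [h.sum₄ _ _ _ _ hx, h.b_two_le hu, h.b_two_le hw]
  · obtain ⟨u, hu⟩ := h.edge₅ _ _ _ _ _ (h.rot₅ _ _ _ _ _ (h.rot₅ _ _ _ _ _ hx))
    obtain ⟨w, hw⟩ := h.edge₅ _ _ _ _ _
      (h.rot₅ _ _ _ _ _ (h.rot₅ _ _ _ _ _ (h.rot₅ _ _ _ _ _ hx)))
    obtain ⟨s, hs⟩ := h.edge₅ _ _ _ _ _
      (h.rot₅ _ _ _ _ _ (h.rot₅ _ _ _ _ _ (h.rot₅ _ _ _ _ _ (h.rot₅ _ _ _ _ _ hx))))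
    linarith [h.sum₅ _ _ _ _ _ hx, h.b_two_le hu, h.b_two_le hw, h.b_two_le hs]

/-- A rhombus and two hexagons cannot meet at an inner vertex. -/
theorem not_two_three_three (h : TypeSystem occ a b S₁ S₃ S₄ S₅) : ¬ S₁ 2 3 3 := by
  intro hs
  have o2 := h.occ_two
  have hs3 := h.rot₁ _ _ _ hs
  have o3 := h.occ₁ _ _ _ hs3
  have hsum := h.sum₁ _ _ _ hs
  have ha := h.a_mono 2 3 o2 o3 (by omega)
  have hb := h.b_mono 2 3 o2 o3 (by omega)
  have b3 := h.b_lt_a _ o3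
  have b2 := h.b_lt_a _ o2
  have hb2 := h.b_two_gt
  have big : 5 / 6 < b 2 + 2 * b 3 := by
    have e1 := h.add_gt 2 o2
    have e2 := h.add_gt 3 o3
    norm_num at e1 e2
    linarith
  -- a face adjacent to a hexagon is a rhombus or a hexagon
  have adj3 : ∀ x y, S₁ 3 x y → x = 2 ∨ x = 3 := by
    intro x y hxy
    have ox := h.occ₁ _ _ _ (h.rot₁ _ _ _ hxy)
    by_contra! hne
    have hx3 : 3 ≤ x := by have := h.two_le _ ox; omega
    have := h.eq_two hxy le_rfl hx3
    subst this
    have h4 := h.sum₁ _ _ _ hxy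
    exact hne.2 (h.a_inj ox o3 (by linarith))
  have hb3 : b 3 = 1 / 3 := by
    rcases h.edge₁ _ _ _ hs3 with ⟨x, hx⟩ | ⟨x, y, hx⟩ | ⟨x, y, z, hx⟩
    · obtain ⟨y, hy⟩ := h.edge₃ _ _ _ (h.rot₃ _ _ _ hx)
      have hbsum := h.sum₃ _ _ _ hx
      rcases adj3 _ _ hy with rfl | rfl <;> linarith
    · obtain ⟨u, hu⟩ := h.edge₄ _ _ _ _ (h.rot₄ _ _ _ _ (h.rot₄ _ _ _ _ hx))
      obtain ⟨w, hw⟩ := h.edge₄ _ _ _ _ (h.rot₄ _ _ _ _ (h.rot₄ _ _ _ _ (h.rot₄ _ _ _ _ hx)))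
      linarith [h.sum₄ _ _ _ _ hx, h.b_two_le hu, h.b_two_le hw]
    · obtain ⟨u, hu⟩ := h.edge₅ _ _ _ _ _ (h.rot₅ _ _ _ _ _ (h.rot₅ _ _ _ _ _ hx))
      obtain ⟨w, hw⟩ := h.edge₅ _ _ _ _ _
        (h.rot₅ _ _ _ _ _ (h.rot₅ _ _ _ _ _ (h.rot₅ _ _ _ _ _ hx)))
      obtain ⟨s, hs⟩ := h.edge₅ _ _ _ _ _
        (h.rot₅ _ _ _ _ _ (h.rot₅ _ _ _ _ _ (h.rot₅ _ _ _ _ _ (h.rot₅ _ _ _ _ _ hx))))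
      linarith [h.sum₅ _ _ _ _ _ hx, h.b_two_le hu, h.b_two_le hw, h.b_two_le hs]
  obtain ⟨hb29, k, hk⟩ : b 2 = 2 / 9 ∧ ∃ k, S₁ 2 2 k := by
    rcases h.edge₁ _ _ _ hs with ⟨x, hx⟩ | ⟨x, y, hx⟩ | ⟨x, y, z, hx⟩
    · obtain ⟨y, hy⟩ := h.edge₃ _ _ _ (h.rot₃ _ _ _ hx)
      have hbsum := h.sum₃ _ _ _ hx
      rcases adj3 _ _ hy with rfl | rfl <;> linarith
    · obtain ⟨u, hu⟩ := h.edge₄ _ _ _ _ (h.rot₄ _ _ _ _ (h.rot₄ _ _ _ _ hx))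
      obtain ⟨w, hw⟩ := h.edge₄ _ _ _ _ (h.rot₄ _ _ _ _ (h.rot₄ _ _ _ _ (h.rot₄ _ _ _ _ hx)))
      have ou := h.occ₁ _ _ _ hu
      have ow := h.occ₁ _ _ _ hw
      have hsum4 := h.sum₄ _ _ _ _ hx
      have hx2 : x = 2 := by
        by_contra hne
        have := h.b_le o3 ou (by have := h.two_le _ ou; omega)
        linarith [h.b_two_le hw]
      have hy2 : y = 2 := by
        by_contra hne
        have := h.b_le o3 ow (by have := h.two_le _ ow; omega)
        linarith [h.b_two_le hu]
      subst hx2 hy2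
      exact ⟨by linarith, u, hu⟩
    · obtain ⟨u, hu⟩ := h.edge₅ _ _ _ _ _ (h.rot₅ _ _ _ _ _ (h.rot₅ _ _ _ _ _ hx))
      obtain ⟨w, hw⟩ := h.edge₅ _ _ _ _ _
        (h.rot₅ _ _ _ _ _ (h.rot₅ _ _ _ _ _ (h.rot₅ _ _ _ _ _ hx)))
      obtain ⟨s, hs⟩ := h.edge₅ _ _ _ _ _
        (h.rot₅ _ _ _ _ _ (h.rot₅ _ _ _ _ _ (h.rot₅ _ _ _ _ _ (h.rot₅ _ _ _ _ _ hx))))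
      linarith [h.sum₅ _ _ _ _ _ hx, h.b_two_le hu, h.b_two_le hw, h.b_two_le hs]
  have hk2 := h.rot₁ _ _ _ hk
  have ok := h.occ₁ _ _ _ (h.rot₁ _ _ _ hk2)
  have hsumk := h.sum₁ _ _ _ hk
  have hk4 : 4 ≤ k := by
    by_contra hlt
    have := h.two_le _ ok
    rcases (by omega : k = 2 ∨ k = 3) with rfl | rfl <;> linarith
  have hbk := h.b_mono 3 k o3 ok (by omega)
  have hbka := h.b_lt_a k ok
  rcases h.edge₁ _ _ _ hk2 with ⟨x, hx⟩ | ⟨x, y, hx⟩ | ⟨x, y, z, hx⟩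
  · obtain ⟨y, hy⟩ := h.edge₃ _ _ _ (h.rot₃ _ _ _ hx)
    have ox := h.occ₁ _ _ _ (h.rot₁ _ _ _ hy)
    have hbsum := h.sum₃ _ _ _ hx
    rcases (h.two_le x ox).eq_or_lt with rfl | hx3
    · linarith
    · have := h.eq_two hy (by omega) hx3
      subst this
      have h4 := h.sum₁ _ _ _ hy
      have := h.a_inj ox o2 (by linarith)
      omega
  · obtain ⟨u, hu⟩ := h.edge₄ _ _ _ _ (h.rot₄ _ _ _ _ (h.rot₄ _ _ _ _ hx))
    obtain ⟨w, hw⟩ := h.edge₄ _ _ _ _ (h.rot₄ _ _ _ _ (h.rot₄ _ _ _ _ (h.rot₄ _ _ _ _ hx)))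
    linarith [h.sum₄ _ _ _ _ hx, h.b_two_le hu, h.b_two_le hw]
  · obtain ⟨u, hu⟩ := h.edge₅ _ _ _ _ _ (h.rot₅ _ _ _ _ _ (h.rot₅ _ _ _ _ _ hx))
    obtain ⟨w, hw⟩ := h.edge₅ _ _ _ _ _
      (h.rot₅ _ _ _ _ _ (h.rot₅ _ _ _ _ _ (h.rot₅ _ _ _ _ _ hx)))
    obtain ⟨s, hs⟩ := h.edge₅ _ _ _ _ _
      (h.rot₅ _ _ _ _ _ (h.rot₅ _ _ _ _ _ (h.rot₅ _ _ _ _ _ (h.rot₅ _ _ _ _ _ hx))))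
    linarith [h.sum₅ _ _ _ _ _ hx, h.b_two_le hu, h.b_two_le hw, h.b_two_le hs]

/-- Every inner vertex is on at least two rhombi. -/
theorem eq_two_of_three_le (h : TypeSystem occ a b S₁ S₃ S₄ S₅) {i j k : ℕ} (hs : S₁ i j k)
    (hi : 3 ≤ i) : j = 2 ∧ k = 2 := by
  have oj := h.two_le _ (h.occ₁ _ _ _ (h.rot₁ _ _ _ hs))
  have ok := h.two_le _ (h.occ₁ _ _ _ (h.rot₁ _ _ _ (h.rot₁ _ _ _ hs)))
  have key : ∀ i j, S₁ 2 i j → 3 ≤ i → 3 ≤ j → False := by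
    intro i j hs hi hj
    rcases h.le_five hs hi hj with ⟨rfl, h1⟩ | ⟨rfl, h1⟩
    · rcases hj.eq_or_lt with rfl | hj
      · exact h.not_two_three_three hs
      · exact h.not_two_three_big hj hs
    · have hs'' : S₁ 2 3 i := by
        have h1 := h.rot₁ _ _ _ (h.rot₁ _ _ _ hs)
        exact h.swap₁ _ _ _ h1
      rcases hi.eq_or_lt with rfl | hi
      · exact h.not_two_three_three hs''
      · exact h.not_two_three_big hi hs''
  by_contra hne
  rcases (by omega : (j = 2 ∧ 3 ≤ k) ∨ 3 ≤ j) with ⟨rfl, h1⟩ | h1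
  · exact key _ _ (h.rot₁ _ _ _ hs) h1 hi
  · have := h.eq_two hs hi h1
    subst this
    exact key _ _ (h.rot₁ _ _ _ (h.rot₁ _ _ _ hs)) hi h1

theorem all_two (h : TypeSystem occ a b S₁ S₃ S₄ S₅)
    (hex : occ 3 → 2 * a 2 + a 3 = 1 → b 2 = 1 / 5 → b 3 = 3 / 10 → False) :
    ∀ i j k, S₁ i j k → i = 2 := by
  by_contra! hne
  obtain ⟨k, i, j, hs, hk⟩ := hne
  have o2 := h.occ_two
  have ok := h.occ₁ _ _ _ hs
  have hk3 : 3 ≤ k := by have := h.two_le _ ok; omega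
  obtain ⟨rfl, rfl⟩ := h.eq_two_of_three_le hs hk3
  have hs2 := h.swap₁ _ _ _ hs
  have hs22 := h.rot₁ _ _ _ hs
  have hsum := h.sum₁ _ _ _ hs
  have ha := h.a_mono 2 k o2 ok (by omega)
  have hb := h.b_mono 2 k o2 ok (by omega)
  have bk := h.b_lt_a _ ok
  have b2 := h.b_lt_a _ o2
  have hb2 := h.b_two_gt
  have hhalf := h.a_lt_half _ ok
  -- the types of faces
  have typ : ∀ i j l, S₁ i j l → i = 2 ∨ i = k := by
    intro i j l hi
    have oi := h.occ₁ _ _ _ hi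
    rcases (h.two_le _ oi).eq_or_lt with h1 | h1
    · exact Or.inl h1.symm
    · obtain ⟨rfl, rfl⟩ := h.eq_two_of_three_le hi h1
      exact Or.inr (h.a_inj oi ok (by linarith [h.sum₁ _ _ _ hi]))
  have nkk : ∀ l, ¬ S₁ k k l := fun l hl => by
    have := (h.eq_two_of_three_le hl hk3).1
    omega
  have e2 := h.add_gt 2 o2
  have ek := h.add_gt k ok
  norm_num at e2
  have e3 := inv_le (by norm_num) hk3
  norm_num at e3 ek
  -- around an outer vertex on a rhombus and a larger face
  have h22 : 2 * b 2 + 2 * b k = 1 := by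
    rcases h.edge₁ _ _ _ hs2 with ⟨x, hx⟩ | ⟨x, y, hx⟩ | ⟨x, y, z, hx⟩
    · obtain ⟨u, hu⟩ := h.edge₃ _ _ _ (h.rot₃ _ _ _ hx)
      obtain ⟨w, hw⟩ := h.edge₃ _ _ _ (h.rot₃ _ _ _ (h.rot₃ _ _ _ hx))
      have hbsum := h.sum₃ _ _ _ hx
      rcases typ _ _ _ hw with rfl | rfl
      · linarith
      · exact absurd hu (nkk _)
    · obtain ⟨u, hu⟩ := h.edge₄ _ _ _ _ (h.rot₄ _ _ _ _ hx)
      obtain ⟨w, hw⟩ := h.edge₄ _ _ _ _ (h.rot₄ _ _ _ _ (h.rot₄ _ _ _ _ hx))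
      obtain ⟨s, hs⟩ := h.edge₄ _ _ _ _ (h.rot₄ _ _ _ _ (h.rot₄ _ _ _ _ (h.rot₄ _ _ _ _ hx)))
      have hbsum := h.sum₄ _ _ _ _ hx
      rcases typ _ _ _ hw with rfl | rfl
      · rcases typ _ _ _ hs with rfl | rfl
        · obtain ⟨i', j', h1, h2, h3⟩ := h.rhombus 2 2 k
            (h.rot₄ _ _ _ _ (h.rot₄ _ _ _ _ hx))
          have hi' : i' = k := h.a_inj (h.occ₁ _ _ _ (h.rot₁ _ _ _ (h.rot₁ _ _ _ h1))) ok
            (by linarith [h.sum₁ _ _ _ h1])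
          have hj' : j' = k := h.a_inj (h.occ₁ _ _ _ (h.rot₁ _ _ _ (h.rot₁ _ _ _ h2))) ok
            (by linarith [h.sum₁ _ _ _ h2])
          subst hi' hj'
          rcases h3 with h3 | ⟨x, h3⟩ | ⟨x, y, h3⟩
          · obtain ⟨t, ht⟩ := h.edge₃ _ _ _ (h.rot₃ _ _ _ (h.rot₃ _ _ _ h3))
            exact absurd ht (nkk _)
          · obtain ⟨t, ht⟩ := h.edge₄ _ _ _ _ (h.rot₄ _ _ _ _ (h.rot₄ _ _ _ _ (h.rot₄ _ _ _ _ h3)))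
            linarith [h.sum₄ _ _ _ _ h3, h.b_two_le ht]
          · obtain ⟨t, ht⟩ := h.edge₅ _ _ _ _ _
              (h.rot₅ _ _ _ _ _ (h.rot₅ _ _ _ _ _ (h.rot₅ _ _ _ _ _ h3)))
            obtain ⟨r, hr⟩ := h.edge₅ _ _ _ _ _
              (h.rot₅ _ _ _ _ _ (h.rot₅ _ _ _ _ _ (h.rot₅ _ _ _ _ _ (h.rot₅ _ _ _ _ _ h3))))
            linarith [h.sum₅ _ _ _ _ _ h3, h.b_two_le ht, h.b_two_le hr]
        · linarith
      · exact absurd hu (nkk _)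
    · obtain ⟨u, hu⟩ := h.edge₅ _ _ _ _ _ (h.rot₅ _ _ _ _ _ (h.rot₅ _ _ _ _ _ hx))
      obtain ⟨w, hw⟩ := h.edge₅ _ _ _ _ _
        (h.rot₅ _ _ _ _ _ (h.rot₅ _ _ _ _ _ (h.rot₅ _ _ _ _ _ hx)))
      obtain ⟨s, hs⟩ := h.edge₅ _ _ _ _ _
        (h.rot₅ _ _ _ _ _ (h.rot₅ _ _ _ _ _ (h.rot₅ _ _ _ _ _ (h.rot₅ _ _ _ _ _ hx))))
      linarith [h.sum₅ _ _ _ _ _ hx, h.b_two_le hu, h.b_two_le hw, h.b_two_le hs]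
  have hk' : k = 3 := by
    by_contra hne
    have e4 := inv_le (by norm_num) (by omega : 4 ≤ k)
    norm_num at e4
    linarith
  subst hk'
  have hb25 : b 2 = 1 / 5 := by
    rcases h.edge₁ _ _ _ hs22 with ⟨x, hx⟩ | ⟨x, y, hx⟩ | ⟨x, y, z, hx⟩
    · obtain ⟨w, hw⟩ := h.edge₃ _ _ _ (h.rot₃ _ _ _ (h.rot₃ _ _ _ hx))
      have hbsum := h.sum₃ _ _ _ hx
      rcases typ _ _ _ hw with rfl | rfl <;> linarith
    · obtain ⟨w, hw⟩ := h.edge₄ _ _ _ _ (h.rot₄ _ _ _ _ (h.rot₄ _ _ _ _ hx))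
      obtain ⟨s, hs⟩ := h.edge₄ _ _ _ _ (h.rot₄ _ _ _ _ (h.rot₄ _ _ _ _ (h.rot₄ _ _ _ _ hx)))
      have hbsum := h.sum₄ _ _ _ _ hx
      rcases typ _ _ _ hw with rfl | rfl <;> rcases typ _ _ _ hs with rfl | rfl
      · linarith
      · linarith
      · linarith
      · exact absurd hw (nkk _)
    · obtain ⟨u, hu⟩ := h.edge₅ _ _ _ _ _ (h.rot₅ _ _ _ _ _ (h.rot₅ _ _ _ _ _ hx))
      obtain ⟨w, hw⟩ := h.edge₅ _ _ _ _ _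
        (h.rot₅ _ _ _ _ _ (h.rot₅ _ _ _ _ _ (h.rot₅ _ _ _ _ _ hx)))
      obtain ⟨s, hs⟩ := h.edge₅ _ _ _ _ _
        (h.rot₅ _ _ _ _ _ (h.rot₅ _ _ _ _ _ (h.rot₅ _ _ _ _ _ (h.rot₅ _ _ _ _ _ hx))))
      have hbsum := h.sum₅ _ _ _ _ _ hx
      rcases typ _ _ _ hu with rfl | rfl <;> rcases typ _ _ _ hw with rfl | rfl <;>
        rcases typ _ _ _ hs with rfl | rfl <;> linarith
  exact hex ok (by linarith) hb25 (by linarith)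

end TypeSystem

end

section

namespace FaceType

variable {p q c t t' : ℝ} {k k' : ℕ}

theorem eq_c (h : FaceType p q c 2 t) : t = c := by
  have h1 := h.eq
  rw [Nat.cast_ofNat, Real.cos_pi_div_two] at h1
  nlinarith [h.le]

theorem sin_sq_two (h : FaceType p q c 2 t) (hp : c < p) (hq : c < q) :
    (p * q - c ^ 2) * Real.sin (Real.pi * ang p q c 2 t) ^ 2 = p * (q - c) := by
  have ht := h.eq_c
  subst ht
  have hS : 0 < p * q - t ^ 2 := by nlinarith [h.pos]
  rw [(h.ang_spec hp hq).2.2.2, Nat.cast_ofNat, Real.sin_pi_div_two]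
  field_simp

theorem sin_sq_three (h : FaceType p q c 3 t) (hp : c < p) (hq : c < q) :
    (p * q - c ^ 2) * Real.sin (Real.pi * ang p q c 3 t) ^ 2 = 3 / 4 * (p * (q - t)) := by
  have hS : 0 < p * q - c ^ 2 := by nlinarith [h.pos, h.le]
  rw [(h.ang_spec hp hq).2.2.2, Nat.cast_ofNat, Real.sin_pi_div_three, div_pow,
    Real.sq_sqrt (by norm_num)]
  field_simp
  ring

/-- Angles of rhombi and hexagons that come close to being realisable. -/
theorem not_near_miss (h : FaceType p q c 2 t) (h' : FaceType p q c 3 t') (hp : c < p) (hq : c < q)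
    (hA : 2 * ang p q c 2 t + ang p q c 3 t' = 1) (hB : ang q p c 2 t = 1 / 5)
    (hB' : ang q p c 3 t' = 3 / 10) : False := by
  have hc : 0 < c := h.eq_c ▸ h.pos
  have h5 : √5 ^ 2 = 5 := Real.sq_sqrt (by norm_num)
  have hcos : Real.cos (Real.pi / 5) ^ 2 = (3 + √5) / 8 := by
    rw [Real.cos_pi_div_five]; linear_combination h5 / 16
  have hsin : Real.sin (Real.pi / 5) ^ 2 = (5 - √5) / 8 := by
    linear_combination Real.sin_sq_add_cos_sq (Real.pi / 5) - hcos
  have e1 := h.symm.sin_sq_two hq hp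
  have e2 := h'.symm.sin_sq_three hq hp
  have e3 := h.sin_sq_two hp hq
  have e4 := h'.sin_sq_three hp hq
  rw [hB, show Real.pi * (1 / 5) = Real.pi / 5 by ring, hsin] at e1
  rw [hB', show Real.pi * (3 / 10) = Real.pi / 2 - Real.pi / 5 by ring, Real.sin_pi_div_two_sub,
    hcos] at e2
  rw [show Real.pi * ang p q c 3 t' = Real.pi - 2 * (Real.pi * ang p q c 2 t) by
    linear_combination Real.pi * hA, Real.sin_pi_sub, Real.sin_two_mul] at e4
  set S := p * q - c ^ 2 with hS
  set s := Real.sin (Real.pi * ang p q c 2 t) ^ 2 with hs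
  have hcs : Real.cos (Real.pi * ang p q c 2 t) ^ 2 = 1 - s := by
    linear_combination Real.sin_sq_add_cos_sq (Real.pi * ang p q c 2 t)
  have e4' : S * (4 * s * (1 - s)) = 3 / 4 * (p * (q - t')) := by
    rw [← e4, mul_pow, mul_pow, hcs]; ring
  have hS0 : 0 < S := by nlinarith
  set X := (q - c) * c with hX
  have hX0 : 0 < X := by have := sub_pos.2 hq; positivity
  have hSX : S = q * (p - c) + X := by rw [hS, hX]; ring
  have hqp : q * p - c ^ 2 = S := by rw [hS]; ring
  rw [hqp] at e1 e2
  -- `q (p - c) = τ X`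
  have f0 : S * (3 + √5) = 8 * X := by linear_combination -8 * e1 + 8 * hSX
  have f1 : q * (p - c) = (5 - 2 * √5) * X := by
    have : S * 4 = (3 - √5) * (8 * X) := by rw [← f0]; linear_combination S * h5
    linear_combination -hSX + this / 4
  have f2 : 3 * (q * (p - t')) = 4 * X := by linear_combination -4 * e2 + f0 / 2
  have f3 : 3 * (q - t') * S = 16 * ((q - c) * (p - c) * c) := by
    have hp0 : p ≠ 0 := by linarith
    have hs1 : S * (1 - s) = (p - c) * c := by rw [hS] at e3 ⊢; linear_combination -e3
    apply mul_left_cancel₀ hp0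
    linear_combination (-4 * S) * e4' + 16 * (S * (1 - s)) * e3 + 16 * (p * (q - c)) * hs1
  have f4 : 3 * (q - t') * (6 - 2 * √5) = 16 * (p - c) := by
    apply mul_left_cancel₀ hX0.ne'
    have : S = (6 - 2 * √5) * X := by linear_combination hSX + f1
    rw [this] at f3
    rw [hX] at f3 ⊢
    linear_combination f3
  have f5 : 3 * (q * (c - t')) = (6 * √5 - 11) * X := by linear_combination f2 - 3 * f1
  have f6 : (p - t') * (q - t') = 4 * (c - t') ^ 2 := by
    have := h'.eq
    rw [Nat.cast_ofNat, Real.cos_pi_div_three] at this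
    linarith
  have f7 : X ^ 2 * (3046 - 1362 * √5) = 0 := by
    have g1 : 3 * (q * (p - t')) * (q * (3 * (q - t') * (6 - 2 * √5))) =
        4 * (6 - 2 * √5) * (3 * (q * (c - t'))) ^ 2 := by
      linear_combination 9 * q ^ 2 * (6 - 2 * √5) * f6
    rw [f2, f4, f5, show q * (16 * (p - c)) = 16 * (q * (p - c)) by ring, f1] at g1
    linear_combination -g1 / 4 - X ^ 2 * (480 - 72 * √5) * h5
  have f8 : (1362 * √5) = 3046 := by
    have := (mul_eq_zero.1 f7).resolve_left (by positivity)
    linarith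
  have f9 : (1362 * √5) ^ 2 = 3046 ^ 2 := by rw [f8]
  rw [mul_pow, h5] at f9
  norm_num at f9

end FaceType

end

section

/-- A two-dimensional face. -/
structure IsFace₂ (V T : Finset E) : Prop where
  isFace : IsFace V T
  dim : Module.finrank ℝ (vectorSpan ℝ (T : Set E)) = 2

/-- The face `T` is a `2 k`-gon with squared distance `t` to the origin. -/
structure HasType (T : Finset E) (A : Set E) (p q c : ℝ) (k : ℕ) (t : ℝ) : Prop where
  type : FaceType p q c k t
  inner₁ : ∀ x u u', x ∈ A → Adj T x u → Adj T x u' → u ≠ u' →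
    ⟪u, u'⟫_ℝ = t + (q - t) * Real.cos (2 * (Real.pi / k))
  inner₂ : ∀ x u u', x ∉ A → Adj T x u → Adj T x u' → u ≠ u' →
    ⟪u, u'⟫_ℝ = t + (p - t) * Real.cos (2 * (Real.pi / k))
  two_nbrs : ∀ x ∈ T, ∃ u u', u ≠ u' ∧ ∀ y, Adj T x y ↔ y = u ∨ y = u'
  rhombus : k = 2 → ∀ x u u', Adj T x u → Adj T x u' → u ≠ u' →
    ∃ x', x' ≠ x ∧ Adj T x' u ∧ Adj T x' u'

theorem inner_eq_zero_of_mem_vectorSpan {T : Finset E} {z x : E} {a : ℝ}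
    (ha : ∀ u ∈ T, ⟪z, u⟫_ℝ = a) (hx : x ∈ vectorSpan ℝ (T : Set E)) : ⟪z, x⟫_ℝ = 0 := by
  have : vectorSpan ℝ (T : Set E) ≤ (ℝ ∙ z)ᗮ := by
    rw [vectorSpan_def, Submodule.span_le]
    rintro _ ⟨u, hu, u', hu', rfl⟩
    rw [SetLike.mem_coe, Submodule.mem_orthogonal_singleton_iff_inner_right]
    change ⟪z, u - u'⟫_ℝ = 0
    rw [inner_sub_right, ha u hu, ha u' hu', sub_self]
  exact Submodule.mem_orthogonal_singleton_iff_inner_right.1 (this hx)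

namespace Cfg

variable {V : Finset E} {A : Set E} {p q c : ℝ}

theorem mem_face_iff {T : Finset E} (hT : IsFace V T) {x : E} (hx : x ∈ T) (y : E) :
    y ∈ T ↔ y ∈ V ∧ y - x ∈ vectorSpan ℝ (T : Set E) := by
  obtain ⟨hTV, z, a, ha, hlt⟩ := hT
  constructor
  · intro hy
    exact ⟨hTV hy, vsub_mem_vectorSpan ℝ hy hx⟩
  · rintro ⟨hy, hyx⟩
    by_contra hyT
    have h1 := inner_eq_zero_of_mem_vectorSpan ha hyx
    rw [inner_sub_right, ha x hx] at h1
    linarith [hlt y hy hyT]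

variable [FiniteDimensional ℝ E]

theorem vectorSpan_face₂ (h : Cfg V A p q c) {T : Finset E} (hT : IsFace₂ V T) {x u u' : E}
    (hu : Adj T x u) (hu' : Adj T x u') (hne : u ≠ u') :
    vectorSpan ℝ (T : Set E) = Submodule.span ℝ {u - x, u' - x} := by
  symm
  apply Submodule.eq_of_le_of_finrank_eq
  · rw [Submodule.span_le]
    rintro y (rfl | rfl)
    · exact vsub_mem_vectorSpan ℝ hu.2.1 hu.1
    · exact vsub_mem_vectorSpan ℝ hu'.2.1 hu'.1
  · rw [h.finrank_span_pair (hT.isFace.adj hu) (hT.isFace.adj hu') hne, hT.dim]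

theorem face₂_unique (h : Cfg V A p q c) {T T' : Finset E} (hT : IsFace₂ V T) (hT' : IsFace₂ V T')
    {x u u' : E} (hu : Adj T x u) (hu' : Adj T x u') (hv : Adj T' x u) (hv' : Adj T' x u')
    (hne : u ≠ u') : T = T' := by
  ext y
  rw [mem_face_iff hT.isFace hu.1, mem_face_iff hT'.isFace hv.1, h.vectorSpan_face₂ hT hu hu' hne,
    h.vectorSpan_face₂ hT' hv hv' hne]

/-- Every two-dimensional face of a configuration of dimension three has a type. -/
theorem exists_hasType (h : Cfg V A p q c) (hpq : p ≤ q)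
    (hW : ∀ u ∈ V, u ∈ vectorSpan ℝ (V : Set E))
    (hdim : Module.finrank ℝ (vectorSpan ℝ (V : Set E)) = 3) {T : Finset E} (hT : IsFace₂ V T)
    {v w : E} (hvw : Adj T v w) (hvA : v ∈ A) : ∃ k t, HasType T A p q c k t := by
  obtain ⟨k, m, f, g, a, b, hP, e0, e1, ha, hb, ha2, hb2, hc, hm, hmo⟩ :=
    h.exists_polygon hpq hT.isFace hT.dim hvw hvA
  have hk : (2 : ℝ) ≤ k := by exact_mod_cast hP.two_le
  have hkz : (2 : ℤ) ≤ k := by exact_mod_cast hP.two_le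
  have hπ := Real.pi_pos
  have hcos : 0 ≤ Real.cos (Real.pi / k) := by
    apply Real.cos_nonneg_of_mem_Icc
    have : 0 ≤ Real.pi / k := by positivity
    exact ⟨by linarith, by gcongr⟩
  have hper : ∀ i j : ℤ, polyPt m f g a b (Real.pi / k) i = polyPt m f g a b (Real.pi / k) j ↔
      (2 * k : ℤ) ∣ i - j := by
    intro i j
    constructor
    · intro hij
      have hpar : Even i ↔ Even j := by rw [← hP.memA i, ← hP.memA j, hij]
      rw [polyPt_add, polyPt_add m, add_left_inj] at hij
      obtain ⟨n, hn⟩ := polyPt_eq_iff (by omega) ha hb hP.ff hP.gg hP.fg hpar hij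
      exact ⟨-n, by linarith⟩
    · rintro ⟨n, hn⟩
      obtain rfl : i = j + 2 * k * n := by linarith
      have h1 : Even (j + 2 * k * n) ↔ Even j := by
        rw [Int.even_add]
        simp
      have h2 : ((j + 2 * k * n : ℤ) : ℝ) * (Real.pi / k) = j * (Real.pi / k) + n * (2 * Real.pi) := by
        push_cast
        field_simp
      simp only [polyPt, h1, h2, Real.cos_add_int_mul_two_pi, Real.sin_add_int_mul_two_pi]
  have hm0 : 0 < ⟪m, m⟫_ℝ := by
    rw [real_inner_self_pos]
    rintro rfl
    obtain ⟨hTV, z, r, hz, hlt⟩ := hT.isFace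
    have hv := inner_eq_zero_of_mem_vectorSpan hz (hm v hvw.1)
    rw [sub_zero] at hv
    have hr : r = 0 := by rw [← hz v hvw.1, hv]
    have h0 := h.inner_eq_zero hpq hW (hTV hvw.1) hvA hv fun u hu => by
      by_cases huT : u ∈ T
      · rw [hz u huT, hr]
      · exact (hr ▸ hlt u hu.2.1 huT).le
    have hTV' : T = V := Finset.Subset.antisymm hTV fun u hu => by
      by_contra huT
      have := hlt u hu huT
      rw [h0 u hu, hr] at this
      exact lt_irrefl _ this
    have := hT.dim
    rw [hTV', hdim] at this
    omega
  have hinner : ∀ i j : ℤ, ⟪polyPt m f g a b (Real.pi / k) i, polyPt m f g a b (Real.pi / k) j⟫_ℝ =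
      ⟪m, m⟫_ℝ + (if Even i then a else b) * (if Even j then a else b) *
        Real.cos ((j - i : ℤ) * (Real.pi / k)) := by
    intro i j
    have hperp : ∀ j, ⟪m, polyPt 0 f g a b (Real.pi / k) j⟫_ℝ = 0 := fun j => by
      simp only [polyPt, zero_add, inner_add_right, real_inner_smul_right, hP.mf, hP.mg, mul_zero,
        add_zero]
    rw [polyPt_add, polyPt_add m, inner_add_left, inner_add_right, inner_add_right,
      inner_polyPt hP.ff hP.gg hP.fg, hperp, real_inner_comm, hperp]
    ring
  have hcorner : ∀ x u u', Adj T x u → Adj T x u' → u ≠ u' → ∃ j : ℤ,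
      x = polyPt m f g a b (Real.pi / k) j ∧
      ((u = polyPt m f g a b (Real.pi / k) (j - 1) ∧ u' = polyPt m f g a b (Real.pi / k) (j + 1)) ∨
      (u' = polyPt m f g a b (Real.pi / k) (j - 1) ∧
        u = polyPt m f g a b (Real.pi / k) (j + 1))) := by
    intro x u u' hu hu' hne
    obtain ⟨j, rfl⟩ := hP.surj x hu.1
    rw [hP.adj] at hu hu'
    refine ⟨j, rfl, ?_⟩
    rcases hu with rfl | rfl <;> rcases hu' with rfl | rfl
    · exact absurd rfl hne
    · exact Or.inl ⟨rfl, rfl⟩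
    · exact Or.inr ⟨rfl, rfl⟩
    · exact absurd rfl hne
  have htwo : ∀ j : ℤ, ((j + 1 - (j - 1) : ℤ) : ℝ) * (Real.pi / k) = 2 * (Real.pi / k) := fun j => by
    push_cast; ring
  refine ⟨k, ⟪m, m⟫_ℝ, ⟨hP.two_le, hm0, ?_, ?_⟩, ?_, ?_, ?_, ?_⟩
  · have : 0 ≤ a * b * Real.cos (Real.pi / k) := by positivity
    linarith
  · rw [← ha2, ← hb2, hc]; ring
  · intro x u u' hx hu hu' hne
    obtain ⟨j, rfl, hj⟩ := hcorner x u u' hu hu' hne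
    rw [hP.memA] at hx
    have h1 : ¬ Even (j - 1) := by rw [Int.even_sub_one]; simpa using hx
    have h2 : ¬ Even (j + 1) := by rw [Int.even_add_one]; simpa using hx
    rcases hj with ⟨rfl, rfl⟩ | ⟨rfl, rfl⟩
    · rw [hinner, htwo, if_neg h1, if_neg h2, ← sq, hb2]
    · rw [real_inner_comm, hinner, htwo, if_neg h1, if_neg h2, ← sq, hb2]
  · intro x u u' hx hu hu' hne
    obtain ⟨j, rfl, hj⟩ := hcorner x u u' hu hu' hne
    rw [hP.memA] at hx
    have h1 : Even (j - 1) := by rw [Int.even_sub_one]; simpa using hx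
    have h2 : Even (j + 1) := by rw [Int.even_add_one]; simpa using hx
    rcases hj with ⟨rfl, rfl⟩ | ⟨rfl, rfl⟩
    · rw [hinner, htwo, if_pos h1, if_pos h2, ← sq, ha2]
    · rw [real_inner_comm, hinner, htwo, if_pos h1, if_pos h2, ← sq, ha2]
  · intro x hx
    obtain ⟨j, rfl⟩ := hP.surj x hx
    refine ⟨_, _, ?_, hP.adj j⟩
    rw [Ne, hper]
    rintro ⟨s, hs⟩
    have : (k : ℤ) * s = -1 := by linarith
    have := Int.isUnit_iff.1 (IsUnit.of_mul_eq_one (-s) (by linarith) : IsUnit (k : ℤ))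
    omega
  · rintro rfl x u u' hu hu' hne
    have key : ∀ j : ℤ, ∃ x', x' ≠ polyPt m f g a b (Real.pi / (2 : ℕ)) j ∧
        Adj T x' (polyPt m f g a b (Real.pi / (2 : ℕ)) (j - 1)) ∧
        Adj T x' (polyPt m f g a b (Real.pi / (2 : ℕ)) (j + 1)) := by
      intro j
      refine ⟨polyPt m f g a b (Real.pi / (2 : ℕ)) (j + 2), ?_, ?_, ?_⟩
      · rw [Ne, hper]
        push_cast
        omega
      · rw [hP.adj]
        right
        rw [hper]
        push_cast
        omega
      · rw [hP.adj]
        left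
        congr 1
        ring
    obtain ⟨j, rfl, hj⟩ := hcorner x u u' hu hu' hne
    obtain ⟨x', h1, h2, h3⟩ := key j
    rcases hj with ⟨rfl, rfl⟩ | ⟨rfl, rfl⟩
    · exact ⟨x', h1, h2, h3⟩
    · exact ⟨x', h1, h3, h2⟩

end Cfg

end

section

/-- Points of a circle in cyclic order. -/
theorem exists_cyclic_order {α : Type*} (N : Finset α) (hN : N.Nonempty) (F : α → ℂ) {R : ℝ}
    (hR : ∀ u ∈ N, ‖F u‖ = R) (hinj : Set.InjOn F N) :
    ∃ (Y : ℤ → α) (θ : ℤ → ℝ), (∀ i, Y i ∈ N) ∧ (∀ i j, Y i = Y j ↔ (N.card : ℤ) ∣ i - j) ∧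
      (∀ u ∈ N, ∃ i, Y i = u) ∧ StrictMono θ ∧ (∀ i, θ (i + N.card) = θ i + 2 * Real.pi) ∧
      ∀ i, F (Y i) = R * (Real.cos (θ i) + Real.sin (θ i) * Complex.I) := by
  classical
  set n := N.card with hn
  have hn0 : (0 : ℤ) < n := by exact_mod_cast hN.card_pos
  have hpol : ∀ u ∈ N, F u = R * (Real.cos (F u).arg + Real.sin (F u).arg * Complex.I) := by
    intro u hu
    rw [← hR u hu, Complex.ofReal_cos, Complex.ofReal_sin, Complex.norm_mul_cos_add_sin_mul_I]
  have hinj' : Set.InjOn (fun u => (F u).arg) N := by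
    intro u hu u' hu' huu
    apply hinj hu hu'
    rw [hpol u hu, hpol u' hu']
    simp only at huu
    rw [huu]
  have hcard : (N.image fun u => (F u).arg).card = n := Finset.card_image_of_injOn hinj'
  set e := (N.image fun u => (F u).arg).orderIsoOfFin hcard
  have hmem : ∀ i : Fin n, ∃ u ∈ N, (F u).arg = e i := fun i => Finset.mem_image.1 (e i).2
  choose φ hφN hφ using hmem
  have hr0 : ∀ i : ℤ, 0 ≤ i % n := fun i => Int.emod_nonneg i hn0.ne'
  have hr1 : ∀ i : ℤ, i % n < n := fun i => Int.emod_lt_of_pos i hn0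
  set ι : ℤ → Fin n := fun i => ⟨(i % n).toNat, by have := hr0 i; have := hr1 i; omega⟩ with hι
  have hιeq : ∀ i j, ι i = ι j ↔ (n : ℤ) ∣ i - j := by
    intro i j
    rw [hι, Fin.mk.injEq]
    have h1 := hr0 i
    have h2 := hr0 j
    rw [← Int.modEq_iff_dvd, Int.ModEq]
    omega
  have hφinj : Function.Injective φ := by
    intro i j hij
    have := (hφ i).symm.trans ((congrArg (fun u => (F u).arg) hij).trans (hφ j))
    exact e.injective (Subtype.ext this)
  refine ⟨fun i => φ (ι i), fun i => e (ι i) + 2 * Real.pi * (i / n : ℤ), fun i => hφN _,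
    fun i j => ?_, fun u hu => ?_, ?_, fun i => ?_, fun i => ?_⟩
  · rw [hφinj.eq_iff, hιeq]
  · obtain ⟨j, hj⟩ := e.surjective ⟨_, Finset.mem_image_of_mem _ hu⟩
    refine ⟨(j : ℕ), hinj' (hφN _) hu ?_⟩
    have hιj : ι (j : ℕ) = j := by
      rw [hι]
      ext
      simp only
      rw [Int.emod_eq_of_lt (by omega) (by exact_mod_cast j.2)]
      simp
    simp only
    rw [hιj, hφ, hj]
  · apply strictMono_int_of_lt_succ
    intro i
    have h1 := hr0 i
    have h2 := hr1 i
    have h3 := Int.emod_add_mul_ediv i n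
    by_cases hlt : i % n + 1 < n
    · obtain ⟨h4, h5⟩ := (Int.ediv_emod_unique (a := i + 1) (q := i / n) (r := i % n + 1) hn0).2
        ⟨by linarith, by omega, hlt⟩
      rw [h4]
      have : e (ι i) < e (ι (i + 1)) := by
        rw [OrderIso.lt_iff_lt, Fin.lt_def, hι]
        simp only
        omega
      have : (e (ι i) : ℝ) < e (ι (i + 1)) := this
      linarith
    · obtain ⟨h4, h5⟩ := (Int.ediv_emod_unique (a := i + 1) (q := i / n + 1) (r := 0) hn0).2
        ⟨by linarith [show i % n + 1 = n by omega], le_rfl, hn0⟩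
      rw [h4, ← hφ, ← hφ]
      have h6 := Complex.neg_pi_lt_arg (F (φ (ι (i + 1))))
      have h7 := Complex.arg_le_pi (F (φ (ι i)))
      push_cast
      linarith
  · have h1 : ι (i + n) = ι i := by rw [hιeq]; simp
    have h2 : (i + n) / n = i / n + 1 := Int.add_ediv_of_dvd_right (dvd_refl _) |>.trans (by
      rw [Int.ediv_self hn0.ne'])
    simp only [h1, h2]
    push_cast
    ring
  · rw [hpol _ (hφN _), hφ]
    simp only
    rw [mul_comm (2 * Real.pi), Real.cos_add_int_mul_two_pi, Real.sin_add_int_mul_two_pi]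

end

section

/-- The dihedral angle, in full turns, between two edges with inner product `y` of their ends at a
vertex of squared norm `P`. -/
def gap (P Q c y : ℝ) : ℝ := Real.arccos ((y - c ^ 2 / P) / (Q - c ^ 2 / P)) / (2 * Real.pi)

/-- The neighbours `Y i` of the vertex `x` in cyclic order together with the faces `T i`
between them. -/
structure Star (V : Finset E) (x : E) (P Q c : ℝ) (n : ℕ) (Y : ℤ → E) (T : ℤ → Finset E) :
    Prop where
  three_le : 3 ≤ n
  eq_iff : ∀ i j, Y i = Y j ↔ (n : ℤ) ∣ i - j
  adj : ∀ i, Adj V x (Y i)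
  surj : ∀ u, Adj V x u → ∃ i, Y i = u
  face : ∀ i, IsFace₂ V (T i)
  adjT : ∀ i u, Adj (T i) x u ↔ u = Y i ∨ u = Y (i + 1)
  sum : ∀ s, ∑ i ∈ Finset.range n, gap P Q c ⟪Y (s + i), Y (s + i + 1)⟫_ℝ = 1

variable [FiniteDimensional ℝ E]

theorem exists_frame {M : Submodule ℝ E} (hM : Module.finrank ℝ M = 3) {x : E} (hx : x ∈ M)
    (hx0 : x ≠ 0) : ∃ f g : E, f ∈ M ∧ g ∈ M ∧ ⟪f, f⟫_ℝ = 1 ∧ ⟪g, g⟫_ℝ = 1 ∧ ⟪f, g⟫_ℝ = 0 ∧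
      ⟪x, f⟫_ℝ = 0 ∧ ⟪x, g⟫_ℝ = 0 ∧
      ∀ y ∈ M, y = (⟪x, y⟫_ℝ / ⟪x, x⟫_ℝ) • x + ⟪f, y⟫_ℝ • f + ⟪g, y⟫_ℝ • g := by
  have hxM : (ℝ ∙ x) ≤ M := by rwa [Submodule.span_singleton_le_iff_mem]
  have hW : Module.finrank ℝ ((ℝ ∙ x)ᗮ ⊓ M : Submodule ℝ E) = 2 := by
    have := Submodule.finrank_add_inf_finrank_orthogonal hxM
    rw [finrank_span_singleton hx0, hM] at this
    omega
  set B := (stdOrthonormalBasis ℝ ((ℝ ∙ x)ᗮ ⊓ M : Submodule ℝ E)).reindex (finCongr hW)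
  have hB : ∀ i j, ⟪(B i : E), (B j : E)⟫_ℝ = if i = j then 1 else 0 :=
    orthonormal_iff_ite.1 B.orthonormal
  have hperp : ∀ y : ((ℝ ∙ x)ᗮ ⊓ M : Submodule ℝ E), ⟪x, y⟫_ℝ = 0 := fun y =>
    Submodule.mem_orthogonal_singleton_iff_inner_right.1 y.2.1
  have hp' : ∀ y : ((ℝ ∙ x)ᗮ ⊓ M : Submodule ℝ E), ⟪(y : E), x⟫_ℝ = 0 := fun y => by
    rw [real_inner_comm, hperp]
  refine ⟨B 0, B 1, (B 0).2.2, (B 1).2.2, (hB 0 0).trans (if_pos rfl),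
    (hB 1 1).trans (if_pos rfl), (hB 0 1).trans (if_neg (by decide)), hperp _,
    hperp _, fun y hy => ?_⟩
  have hxx : ⟪x, x⟫_ℝ ≠ 0 := inner_self_ne_zero.2 hx0
  have hmem : y - (⟪x, y⟫_ℝ / ⟪x, x⟫_ℝ) • x ∈ ((ℝ ∙ x)ᗮ ⊓ M : Submodule ℝ E) := by
    refine ⟨Submodule.mem_orthogonal_singleton_iff_inner_right.2 ?_,
      M.sub_mem hy (M.smul_mem _ hx)⟩
    rw [inner_sub_right, real_inner_smul_right, div_mul_cancel₀ _ hxx, sub_self]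
  have h1 := B.sum_repr' ⟨_, hmem⟩
  rw [Fin.sum_univ_two] at h1
  have h2 := congrArg (Subtype.val) h1
  simp only [Submodule.coe_add, Submodule.coe_smul, Submodule.coe_inner, inner_sub_right,
    real_inner_smul_right, hp', mul_zero, sub_zero] at h2
  rw [add_assoc, h2]
  abel

theorem cos_lt_cos_of_arc {d δ : ℝ} (hδ : 0 < δ) (h1 : δ < d) (h2 : d < 2 * Real.pi - δ) :
    Real.cos d < Real.cos δ := by
  have h3 := Real.cos_sub_cos d δ
  have h4 : 0 < Real.sin ((d + δ) / 2) := Real.sin_pos_of_pos_of_lt_pi (by linarith) (by linarith)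
  have h5 : 0 < Real.sin ((d - δ) / 2) := Real.sin_pos_of_pos_of_lt_pi (by linarith) (by linarith)
  nlinarith [mul_pos h4 h5]

namespace Cfg

variable {V : Finset E} {A : Set E} {p q c : ℝ}

theorem exists_star (h : Cfg V A p q c) (hW : ∀ u ∈ V, u ∈ vectorSpan ℝ (V : Set E))
    (hdim : Module.finrank ℝ (vectorSpan ℝ (V : Set E)) = 3) {x : E} {P Q : ℝ} (hx : x ∈ V)
    (hP : ⟪x, x⟫_ℝ = P) (hQ : ∀ u, Adj V x u → ⟪u, u⟫_ℝ = Q)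
    (hS : ∀ z y, ⟪z, x⟫_ℝ = 0 → Adj V x y → ⟪z, y⟫_ℝ = 0 → (∀ u, Adj V x u → ⟪z, u⟫_ℝ ≤ 0) →
      ∀ u ∈ V, ⟪z, u⟫_ℝ = 0) : ∃ n Y T, Star V x P Q c n Y T := by
  have hπ := Real.pi_pos
  have hcP := h.inner_self_gt hx
  rw [hP] at hcP
  obtain ⟨y₀, hy₀, -⟩ := h.exists_adj hx x
  have hxy := h.inner _ _ hy₀
  have hPQ : c ^ 2 < P * Q := by
    have h1 := h.sub_pos
    have h2 := h.bip _ _ hy₀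
    rw [← hP, ← hQ y₀ hy₀]
    by_cases hA : x ∈ A
    · rw [h.norm1 x hx hA, h.norm2 y₀ hy₀.2.1 (by tauto)]; linarith
    · rw [h.norm2 x hx hA, h.norm1 y₀ hy₀.2.1 (by tauto)]; linarith
  have hx0 : x ≠ 0 := by
    rintro rfl
    rw [inner_zero_left] at hP hxy
    rw [← hP, ← hxy] at hcP
    exact lt_irrefl _ hcP
  have hP0 : 0 < P := by rw [← hP]; exact real_inner_self_pos.2 hx0
  obtain ⟨f, g, hf, hg, hff, hgg, hfg, hxf, hxg, hdec⟩ := exists_frame hdim (hW x hx) hx0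
  have hgf : ⟪g, f⟫_ℝ = 0 := by rw [real_inner_comm, hfg]
  have hfx : ⟪f, x⟫_ℝ = 0 := by rw [real_inner_comm, hxf]
  have hgx : ⟪g, x⟫_ℝ = 0 := by rw [real_inner_comm, hxg]
  have hin : ∀ u u', Adj V x u → Adj V x u' →
      ⟪u, u'⟫_ℝ = c ^ 2 / P + ⟪f, u⟫_ℝ * ⟪f, u'⟫_ℝ + ⟪g, u⟫_ℝ * ⟪g, u'⟫_ℝ := by
    intro u u' hu hu'
    conv_lhs => rw [hdec u (hW u hu.2.1)]
    rw [inner_add_left, inner_add_left, real_inner_smul_left, real_inner_smul_left,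
      real_inner_smul_left, h.inner _ _ hu, h.inner _ _ hu', hP]
    ring
  set R := √(Q - c ^ 2 / P) with hRdef
  have hR2 : R ^ 2 = Q - c ^ 2 / P := by
    apply Real.sq_sqrt
    rw [sub_nonneg, div_le_iff₀ hP0]
    linarith
  have hR0 : 0 < R := by
    apply Real.sqrt_pos.2
    rw [_root_.sub_pos, div_lt_iff₀ hP0]
    linarith
  obtain ⟨Y, θ, hYmem, hYeq, hYsurj, hθ, hθn, hY⟩ := exists_cyclic_order (nbrs V x)
    ⟨y₀, mem_nbrs.2 hy₀⟩ (fun u => (⟨⟪f, u⟫_ℝ, ⟪g, u⟫_ℝ⟩ : ℂ)) (R := R) (by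
      intro u hu
      rw [mem_nbrs] at hu
      have := hin u u hu hu
      rw [hQ u hu] at this
      rw [Complex.norm_def, Complex.normSq_mk, hRdef]
      congr 1
      linarith) (by
      intro u hu u' hu' huu
      rw [Finset.mem_coe, mem_nbrs] at hu hu'
      simp only [Complex.mk.injEq] at huu
      rw [hdec u (hW u hu.2.1), hdec u' (hW u' hu'.2.1), huu.1, huu.2, h.inner _ _ hu,
        h.inner _ _ hu'])
  set n := (nbrs V x).card with hn
  have hadj : ∀ i, Adj V x (Y i) := fun i => mem_nbrs.1 (hYmem i)
  have hYf : ∀ i, ⟪f, Y i⟫_ℝ = R * Real.cos (θ i) := fun i => by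
    have := congrArg Complex.re (hY i)
    simpa [-Complex.ofReal_cos, -Complex.ofReal_sin] using this
  have hYg : ∀ i, ⟪g, Y i⟫_ℝ = R * Real.sin (θ i) := fun i => by
    have := congrArg Complex.im (hY i)
    simpa [-Complex.ofReal_cos, -Complex.ofReal_sin] using this
  have hn0 : 0 < n := Finset.card_pos.2 ⟨y₀, mem_nbrs.2 hy₀⟩
  have hlift : ∀ u, Adj V x u → ∀ i : ℤ, ∃ j, Y j = u ∧ i ≤ j ∧ j < i + n := by
    intro u hu i
    obtain ⟨j, hj⟩ := hYsurj u (mem_nbrs.2 hu)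
    refine ⟨i + (j - i) % n, ?_, ?_, ?_⟩
    · rw [← hj, hYeq]
      refine ⟨-((j - i) / n), ?_⟩
      linarith [Int.emod_add_mul_ediv (j - i) n]
    · linarith [Int.emod_nonneg (j - i) (by omega : (n : ℤ) ≠ 0)]
    · linarith [Int.emod_lt_of_pos (j - i) (by omega : (0 : ℤ) < n)]
  have hz : ∀ μ j, ⟪Real.cos μ • f + Real.sin μ • g, Y j⟫_ℝ = R * Real.cos (θ j - μ) := by
    intro μ j
    rw [inner_add_left, real_inner_smul_left, real_inner_smul_left, hYf, hYg, Real.cos_sub]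
    ring
  have hzx : ∀ μ, ⟪Real.cos μ • f + Real.sin μ • g, x⟫_ℝ = 0 := by
    intro μ
    rw [inner_add_left, real_inner_smul_left, real_inner_smul_left, hfx, hgx]
    ring
  have hlt : ∀ i, θ (i + 1) - θ i < Real.pi := by
    intro i
    by_contra! hge
    have h0 := hS _ (Y i) (hzx (θ i + Real.pi / 2)) (hadj i) (by
      rw [hz, show θ i - (θ i + Real.pi / 2) = -(Real.pi / 2) by ring, Real.cos_neg,
        Real.cos_pi_div_two, mul_zero]) (by
      intro u hu
      obtain ⟨j, rfl, h1, h2⟩ := hlift u hu i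
      rw [hz]
      rcases h1.eq_or_lt with rfl | h1
      · rw [show θ i - (θ i + Real.pi / 2) = -(Real.pi / 2) by ring, Real.cos_neg,
          Real.cos_pi_div_two, mul_zero]
      · have h3 := hθ.monotone (by omega : i + 1 ≤ j)
        have h4 := hθ h2
        rw [hθn] at h4
        have : Real.cos (θ j - (θ i + Real.pi / 2)) ≤ 0 :=
          Real.cos_nonpos_of_pi_div_two_le_of_le (by linarith) (by linarith)
        exact mul_nonpos_of_nonneg_of_nonpos hR0.le this)
    have h1 := inner_eq_zero_of_mem_vectorSpan h0
      (Submodule.add_mem _ (Submodule.smul_mem _ (Real.cos (θ i + Real.pi / 2)) hf)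
        (Submodule.smul_mem _ (Real.sin (θ i + Real.pi / 2)) hg))
    simp only [inner_add_left, inner_add_right, real_inner_smul_left, real_inner_smul_right, hff,
      hgg, hfg, hgf] at h1
    have := Real.sin_sq_add_cos_sq (θ i + Real.pi / 2)
    linarith
  have hthree : 3 ≤ n := by
    by_contra hlt3
    have h1 := hθn 0
    have h2 := hlt 0
    have h3 := hlt 1
    rcases (by omega : n = 1 ∨ n = 2) with hn1 | hn1
    · rw [hn1] at h1
      norm_num at h1 h2
      linarith
    · rw [hn1] at h1
      norm_num at h1 h2 h3
      linarith
  have hface : ∀ i, ∃ T, IsFace₂ V T ∧ ∀ u, Adj T x u ↔ u = Y i ∨ u = Y (i + 1) := by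
    intro i
    have hne : Y i ≠ Y (i + 1) := by
      rw [Ne, hYeq]
      rintro ⟨s, hs⟩
      have := Int.isUnit_iff.1 (IsUnit.of_mul_eq_one (-s) (by linarith) : IsUnit (n : ℤ))
      omega
    have hδ := hθ (by omega : i < i + 1)
    set μ := (θ i + θ (i + 1)) / 2 with hμ
    set κ := R * Real.cos (θ i - μ) / (c - P) with hκ
    have hκ' : κ * (c - P) = R * Real.cos (θ i - μ) := div_mul_cancel₀ _ (by linarith)
    have hval : ∀ j, ⟪Real.cos μ • f + Real.sin μ • g - κ • x, Y j⟫_ℝ =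
        R * Real.cos (θ j - μ) - κ * c := fun j => by
      rw [inner_sub_left, hz, real_inner_smul_left, h.inner _ _ (hadj j)]
    have hvalx : ⟪Real.cos μ • f + Real.sin μ • g - κ • x, x⟫_ℝ = - κ * P := by
      rw [inner_sub_left, hzx, real_inner_smul_left, hP]; ring
    obtain ⟨T, h1, h2, h3, h4, h5⟩ := h.exists_face_pair (hadj i) (hadj (i + 1)) hne
      (z := Real.cos μ • f + Real.sin μ • g - κ • x) (by rw [hval, hvalx]; linarith)
      (by
        rw [hval, hvalx, ← Real.cos_neg, show -(θ (i + 1) - μ) = θ i - μ by rw [hμ]; ring]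
        linarith)
      (by
        intro u hu hu1 hu2
        obtain ⟨j, rfl, h6, h7⟩ := hlift u hu i
        have h8 : i + 1 < j := by
          rcases h6.eq_or_lt with rfl | h6
          · exact absurd rfl hu1
          · rcases (by omega : i + 1 ≤ j).eq_or_lt with rfl | h6
            · exact absurd rfl hu2
            · exact h6
        have h9 := hθ h8
        have h10 := hθ h7
        rw [hθn] at h10
        rw [hval, hvalx]
        have : Real.cos (θ j - μ) < Real.cos (-(θ i - μ)) :=
          cos_lt_cos_of_arc (by rw [hμ]; linarith) (by rw [hμ]; linarith) (by rw [hμ]; linarith)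
        rw [Real.cos_neg] at this
        have := mul_lt_mul_of_pos_left this hR0
        linarith)
    refine ⟨T, ⟨h1, h5⟩, fun u => ⟨h4 u, ?_⟩⟩
    rintro (rfl | rfl)
    · exact h2
    · exact h3
  choose T hT hTadj using hface
  refine ⟨n, Y, T, hthree, hYeq, hadj, fun u hu => hYsurj u (mem_nbrs.2 hu), hT, hTadj, fun s => ?_⟩
  have hgap : ∀ j, gap P Q c ⟪Y j, Y (j + 1)⟫_ℝ = (θ (j + 1) - θ j) / (2 * Real.pi) := by
    intro j
    have h1 := hθ (by omega : j < j + 1)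
    rw [gap, hin _ _ (hadj j) (hadj _), ← hR2, hYf, hYf, hYg, hYg,
      show c ^ 2 / P + R * Real.cos (θ j) * (R * Real.cos (θ (j + 1))) +
        R * Real.sin (θ j) * (R * Real.sin (θ (j + 1))) - c ^ 2 / P =
        R ^ 2 * Real.cos (θ (j + 1) - θ j) by rw [Real.cos_sub]; ring,
      mul_div_cancel_left₀ _ (by positivity), Real.arccos_cos (by linarith) (hlt j).le]
  have hsum := Finset.sum_range_sub (fun i : ℕ => θ (s + i) / (2 * Real.pi)) n
  rw [hθn] at hsum
  push_cast at hsum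
  rw [add_zero] at hsum
  calc _ = ∑ i ∈ Finset.range n, (θ (s + (i + 1)) / (2 * Real.pi) - θ (s + i) / (2 * Real.pi)) :=
        Finset.sum_congr rfl fun i _ => by rw [hgap, add_assoc]; ring
    _ = 1 := by
      rw [hsum]
      field_simp
      ring

end Cfg

end

section

/-- A three-dimensional configuration with `p < q`. -/
structure Solid (V : Finset E) (A : Set E) (p q c : ℝ) : Prop extends Cfg V A p q c where
  lt : p < q
  mem_span : ∀ u ∈ V, u ∈ vectorSpan ℝ (V : Set E)
  finrank_eq : Module.finrank ℝ (vectorSpan ℝ (V : Set E)) = 3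

namespace Star

variable {V : Finset E} {x : E} {P Q c : ℝ} {n : ℕ} {Y : ℤ → E} {T : ℤ → Finset E}

theorem shift (h : Star V x P Q c n Y T) (s : ℤ) :
    Star V x P Q c n (fun i => Y (i + s)) (fun i => T (i + s)) where
  three_le := h.three_le
  eq_iff i j := by rw [h.eq_iff, add_sub_add_right_eq_sub]
  adj i := h.adj _
  surj u hu := by
    obtain ⟨i, hi⟩ := h.surj u hu
    exact ⟨i - s, by rwa [sub_add_cancel]⟩
  face i := h.face _
  adjT i u := by rw [h.adjT, add_right_comm]
  sum r := by
    rw [← h.sum (r + s)]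
    refine Finset.sum_congr rfl fun i _ => ?_
    rw [show r + (i : ℤ) + s = r + s + i by ring, show r + (i : ℤ) + 1 + s = r + s + i + 1 by ring]

theorem reverse (h : Star V x P Q c n Y T) :
    Star V x P Q c n (fun i => Y (-i)) (fun i => T (-i - 1)) where
  three_le := h.three_le
  eq_iff i j := by rw [h.eq_iff, ← dvd_neg, show -(-i - -j) = i - j by ring]
  adj i := h.adj _
  surj u hu := by
    obtain ⟨i, hi⟩ := h.surj u hu
    exact ⟨-i, by rwa [neg_neg]⟩
  face i := h.face _
  adjT i u := by
    rw [h.adjT, show -i - 1 + 1 = -i by ring, show -(i + 1) = -i - 1 by ring, or_comm]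
  sum r := by
    rw [← h.sum (-r - n), ← Finset.sum_range_reflect]
    refine Finset.sum_congr rfl fun i hi => ?_
    have hi' : ((n - 1 - i : ℕ) : ℤ) = n - 1 - i := by
      have := Finset.mem_range.1 hi
      omega
    rw [hi', real_inner_comm]
    congr 3 <;> ring

theorem Y_ne (h : Star V x P Q c n Y T) (i : ℤ) : Y i ≠ Y (i + 1) := by
  rw [Ne, h.eq_iff]
  have := h.three_le
  intro h1
  have := Int.le_of_dvd one_pos (show (n : ℤ) ∣ 1 by
    rwa [← dvd_neg, show (-1 : ℤ) = i - (i + 1) by ring])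
  omega

theorem T_ne (h : Star V x P Q c n Y T) (i : ℤ) : T (i - 1) ≠ T i := by
  intro he
  have h1 := (h.adjT (i - 1) (Y (i - 1))).2 (Or.inl rfl)
  rw [he, h.adjT] at h1
  have := h.three_le
  rcases h1 with h1 | h1 <;> rw [h.eq_iff, ← dvd_neg] at h1
  · have := Int.le_of_dvd (by omega) h1
    omega
  · have := Int.le_of_dvd (by omega) h1
    omega

variable {A : Set E} {p q : ℝ} [FiniteDimensional ℝ E]

theorem T_add (h : Star V x P Q c n Y T) (hC : Cfg V A p q c) (i : ℤ) : T (i + n) = T i := by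
  have h1 : ∀ j, Y (j + n) = Y j := fun j => (h.eq_iff _ _).2 ⟨1, by ring⟩
  have h2 : Y (i + n + 1) = Y (i + 1) := by rw [add_right_comm, h1]
  exact hC.face₂_unique (h.face _) (h.face _) ((h.adjT _ _).2 (Or.inl rfl))
    ((h.adjT _ _).2 (Or.inr rfl)) ((h.adjT _ _).2 (Or.inl (h1 i))) ((h.adjT _ _).2 (Or.inr h2))
    (h.Y_ne _)

end Star

namespace Solid

variable {V : Finset E} {A : Set E} {p q c : ℝ} [FiniteDimensional ℝ E]

theorem exists_star_outer (h : Solid V A p q c) {x : E} (hx : x ∈ V) (hxA : x ∉ A) :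
    ∃ n Y T, Star V x q p c n Y T := by
  refine h.exists_star h.mem_span h.finrank_eq hx (h.norm2 x hx hxA)
    (fun u hu => h.norm1 u hu.2.1 (by_contra fun hA => hxA ((h.bip _ _ hu).2 hA))) ?_
  intro z y hzx hy hzy hz
  have hyA : y ∈ A := by_contra fun hA => hxA ((h.bip _ _ hy).2 hA)
  refine h.inner_eq_zero h.lt.le h.mem_span hy.2.1 hyA hzy fun u hu => ?_
  rw [← hzx]
  exact h.pos.le_of_adj hx (fun w hw => by rw [hzx]; exact hz w hw) hu.2.1

theorem exists_star_inner (h : Solid V A p q c) {x : E} (hx : x ∈ V) (hxA : x ∈ A) :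
    ∃ Y T, Star V x p q c 3 Y T := by
  obtain ⟨n, Y, T, hS⟩ := h.exists_star h.mem_span h.finrank_eq hx (h.norm1 x hx hxA)
    (fun u hu => h.norm2 u hu.2.1 ((h.bip _ _ hu).1 hxA))
    fun z y hzx _ _ hz => h.inner_eq_zero h.lt.le h.mem_span hx hxA hzx hz
  have hcard := h.card_nbrs h.lt.le hx hxA
  rw [h.finrank_eq] at hcard
  suffices n = 3 by subst this; exact ⟨Y, T, hS⟩
  refine le_antisymm ?_ hS.three_le
  rw [← hcard, ← Finset.card_range n]
  refine Finset.card_le_card_of_injOn (fun i : ℕ => Y i) (fun i _ => mem_nbrs.2 (hS.adj _)) ?_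
  intro i hi j hj hij
  have h1 := (hS.eq_iff _ _).1 hij
  have hi' := Finset.mem_range.1 hi
  have hj' := Finset.mem_range.1 hj
  have := Int.eq_zero_of_abs_lt_dvd h1 (by rw [abs_lt]; omega)
  omega

theorem exists_hasType_of_adj (h : Solid V A p q c) {T : Finset E} (hT : IsFace₂ V T) {x u : E}
    (hu : Adj T x u) : ∃ k t, HasType T A p q c k t := by
  by_cases hx : x ∈ A
  · exact h.exists_hasType h.lt.le h.mem_span h.finrank_eq hT hu hx
  · exact h.exists_hasType h.lt.le h.mem_span h.finrank_eq hT hu.symm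
      (by_contra fun hA => hx ((h.bip _ _ (hT.isFace.adj hu)).2 hA))

/-- A face containing an edge at a vertex of degree three is one of the two faces of the star. -/
theorem face_eq (h : Solid V A p q c) {x : E} {P Q : ℝ} {Y : ℤ → E} {T : ℤ → Finset E}
    (hS : Star V x P Q c 3 Y T) {F : Finset E} (hF : IsFace₂ V F) {i : ℤ} (hi : Adj F x (Y i)) :
    F = T (i - 1) ∨ F = T i := by
  obtain ⟨k, t, hk⟩ := h.exists_hasType_of_adj hF hi
  obtain ⟨u, u', hne, hu⟩ := hk.two_nbrs x hi.1
  obtain ⟨y, hy, hyi⟩ : ∃ y, Adj F x y ∧ y ≠ Y i := by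
    rcases (hu _).1 hi with h1 | h1
    · exact ⟨u', (hu _).2 (Or.inr rfl), by rw [h1]; exact hne.symm⟩
    · exact ⟨u, (hu _).2 (Or.inl rfl), by rw [h1]; exact hne⟩
  obtain ⟨j, rfl⟩ := hS.surj y (hF.isFace.adj hy)
  have h2 : Y j = Y (i - 1) ∨ Y j = Y (i + 1) := by
    rw [Ne, hS.eq_iff] at hyi
    rw [hS.eq_iff, hS.eq_iff]
    push_cast at hyi ⊢
    omega
  rcases h2 with h2 | h2
  · left
    refine h.face₂_unique hF (hS.face _) hi hy ((hS.adjT _ _).2 ?_) ((hS.adjT _ _).2 (Or.inl h2))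
      hyi.symm
    right
    rw [sub_add_cancel]
  · right
    exact h.face₂_unique hF (hS.face _) hi hy ((hS.adjT _ _).2 (Or.inl rfl))
      ((hS.adjT _ _).2 (Or.inr h2)) hyi.symm

/-- The star at the other end of an edge, numbered compatibly. -/
theorem exists_turn (h : Solid V A p q c) {x : E} {P Q P' Q' : ℝ} {n n' : ℕ} {Y Y' : ℤ → E}
    {T T' : ℤ → Finset E} (hS : Star V x P Q c n Y T) (i : ℤ)
    (hS' : Star V (Y i) P' Q' c n' Y' T') (hn : n = 3 ∨ n' = 3) :
    ∃ Y' T', Star V (Y i) P' Q' c n' Y' T' ∧ Y' 1 = x ∧ T' 0 = T (i - 1) ∧ T' 1 = T i := by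
  obtain ⟨j, hj⟩ := hS'.surj x (hS.adj i).symm
  have hTne := hS.T_ne i
  have hTne' := hS'.T_ne j
  have e1 : Adj (T (i - 1)) (Y i) (Y' j) := by
    rw [hj]
    exact ((hS.adjT _ _).2 (Or.inr (by rw [sub_add_cancel]))).symm
  have e2 : Adj (T i) (Y i) (Y' j) := by
    rw [hj]
    exact ((hS.adjT _ _).2 (Or.inl rfl)).symm
  have e3 : Adj (T' (j - 1)) x (Y i) := by
    rw [← hj]
    exact ((hS'.adjT _ _).2 (Or.inr (by rw [sub_add_cancel]))).symm
  have e4 : Adj (T' j) x (Y i) := by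
    rw [← hj]
    exact ((hS'.adjT _ _).2 (Or.inl rfl)).symm
  have key : (T' (j - 1) = T (i - 1) ∧ T' j = T i) ∨ (T' (j - 1) = T i ∧ T' j = T (i - 1)) := by
    rcases hn with rfl | rfl
    · rcases h.face_eq hS (hS'.face _) e3 with h1 | h1 <;>
        rcases h.face_eq hS (hS'.face _) e4 with h2 | h2
      · exact absurd (h1.trans h2.symm) hTne'
      · exact Or.inl ⟨h1, h2⟩
      · exact Or.inr ⟨h1, h2⟩
      · exact absurd (h1.trans h2.symm) hTne'
    · rcases h.face_eq hS' (hS.face _) e1 with h1 | h1 <;>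
        rcases h.face_eq hS' (hS.face _) e2 with h2 | h2
      · exact absurd (h1.trans h2.symm) hTne
      · exact Or.inl ⟨h1.symm, h2.symm⟩
      · exact Or.inr ⟨h2.symm, h1.symm⟩
      · exact absurd (h1.trans h2.symm) hTne
  rcases key with ⟨h1, h2⟩ | ⟨h1, h2⟩
  · refine ⟨_, _, hS'.shift (j - 1), ?_, ?_, ?_⟩
    · simpa using hj
    · simpa using h1
    · simpa using h2
  · refine ⟨_, _, hS'.reverse.shift (-j - 1), ?_, ?_, ?_⟩
    · simpa using hj
    · simpa [neg_add_eq_sub] using h2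
    · simpa [neg_add_eq_sub] using h1

end Solid

end

section

/-- The squared distance to the origin of a face with `2 k` vertices. -/
def faceDist (p q c : ℝ) (k : ℕ) : ℝ := Classical.epsilon (FaceType p q c k)

/-- Half the number of vertices of a two-dimensional face. -/
def faceKind (A : Set E) (p q c : ℝ) (T : Finset E) : ℕ :=
  Classical.epsilon fun k => ∃ t, HasType T A p q c k t

theorem FaceType.faceDist_eq {p q c t : ℝ} {k : ℕ} (h : FaceType p q c k t) (hp : c < p)
    (hq : c < q) : faceDist p q c k = t :=
  FaceType.t_unique (Classical.epsilon_spec (p := FaceType p q c k) ⟨t, h⟩) h hp hq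

/-- The cyclic sequence of types of faces around a vertex in `A`. -/
def InnerKinds (V : Finset E) (A : Set E) (p q c : ℝ) (κ : ℤ → ℕ) : Prop :=
  ∃ x Y T, x ∈ A ∧ Star V x p q c 3 Y T ∧ ∀ i, κ i = faceKind A p q c (T i)

/-- The cyclic sequence of types of faces around a vertex outside `A`. -/
def OuterKinds (V : Finset E) (A : Set E) (p q c : ℝ) (n : ℕ) (κ : ℤ → ℕ) : Prop :=
  ∃ x Y T, x ∉ A ∧ Star V x q p c n Y T ∧ ∀ i, κ i = faceKind A p q c (T i)

variable {V : Finset E} {A : Set E} {p q c : ℝ} {n : ℕ} {κ : ℤ → ℕ}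

theorem InnerKinds.shift (h : InnerKinds V A p q c κ) (s : ℤ) :
    InnerKinds V A p q c fun i => κ (i + s) := by
  obtain ⟨x, Y, T, hx, hS, hκ⟩ := h
  exact ⟨x, _, _, hx, hS.shift s, fun i => hκ _⟩

theorem InnerKinds.reverse (h : InnerKinds V A p q c κ) :
    InnerKinds V A p q c fun i => κ (-i - 1) := by
  obtain ⟨x, Y, T, hx, hS, hκ⟩ := h
  exact ⟨x, _, _, hx, hS.reverse, fun i => hκ _⟩

theorem OuterKinds.shift (h : OuterKinds V A p q c n κ) (s : ℤ) :
    OuterKinds V A p q c n fun i => κ (i + s) := by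
  obtain ⟨x, Y, T, hx, hS, hκ⟩ := h
  exact ⟨x, _, _, hx, hS.shift s, fun i => hκ _⟩

namespace Solid

variable [FiniteDimensional ℝ E]

theorem hasType_faceKind (h : Solid V A p q c) {T : Finset E} (hT : IsFace₂ V T) {x u : E}
    (hu : Adj T x u) :
    HasType T A p q c (faceKind A p q c T) (faceDist p q c (faceKind A p q c T)) := by
  obtain ⟨t, ht⟩ := Classical.epsilon_spec (h.exists_hasType_of_adj hT hu)
  have := ht.type.faceDist_eq h.c_lt_p h.c_lt_q
  rwa [← this] at ht

theorem hasType_star (h : Solid V A p q c) {x : E} {P Q : ℝ} {Y : ℤ → E} {T : ℤ → Finset E}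
    (hS : Star V x P Q c n Y T) (i : ℤ) :
    HasType (T i) A p q c (faceKind A p q c (T i)) (faceDist p q c (faceKind A p q c (T i))) :=
  h.hasType_faceKind (hS.face i) ((hS.adjT _ _).2 (Or.inl rfl))

theorem gap_inner (h : Solid V A p q c) {x : E} (hx : x ∈ A) {Y : ℤ → E} {T : ℤ → Finset E}
    (hS : Star V x p q c n Y T) (i : ℤ) : gap p q c ⟪Y i, Y (i + 1)⟫_ℝ =
      ang p q c (faceKind A p q c (T i)) (faceDist p q c (faceKind A p q c (T i))) := by
  rw [(h.hasType_star hS i).inner₁ x _ _ hx ((hS.adjT _ _).2 (Or.inl rfl))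
    ((hS.adjT _ _).2 (Or.inr rfl)) (hS.Y_ne i)]
  rfl

theorem gap_outer (h : Solid V A p q c) {x : E} (hx : x ∉ A) {Y : ℤ → E} {T : ℤ → Finset E}
    (hS : Star V x q p c n Y T) (i : ℤ) : gap q p c ⟪Y i, Y (i + 1)⟫_ℝ =
      ang q p c (faceKind A p q c (T i)) (faceDist p q c (faceKind A p q c (T i))) := by
  rw [(h.hasType_star hS i).inner₂ x _ _ hx ((hS.adjT _ _).2 (Or.inl rfl))
    ((hS.adjT _ _).2 (Or.inr rfl)) (hS.Y_ne i)]
  rfl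

theorem faceType_inner (h : Solid V A p q c) (hκ : InnerKinds V A p q c κ) (i : ℤ) :
    FaceType p q c (κ i) (faceDist p q c (κ i)) := by
  obtain ⟨x, Y, T, hx, hS, hκ⟩ := hκ
  rw [hκ]
  exact (h.hasType_star hS i).type

theorem faceType_outer (h : Solid V A p q c) (hκ : OuterKinds V A p q c n κ) (i : ℤ) :
    FaceType p q c (κ i) (faceDist p q c (κ i)) := by
  obtain ⟨x, Y, T, hx, hS, hκ⟩ := hκ
  rw [hκ]
  exact (h.hasType_star hS i).type

theorem sum_inner (h : Solid V A p q c) (hκ : InnerKinds V A p q c κ) :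
    ang p q c (κ 0) (faceDist p q c (κ 0)) + ang p q c (κ 1) (faceDist p q c (κ 1)) +
      ang p q c (κ 2) (faceDist p q c (κ 2)) = 1 := by
  obtain ⟨x, Y, T, hx, hS, hκ⟩ := hκ
  have := hS.sum 0
  simp only [h.gap_inner hx hS, ← hκ, Finset.sum_range_succ, Finset.sum_range_zero] at this
  simpa using this

theorem sum_outer (h : Solid V A p q c) (hκ : OuterKinds V A p q c n κ) :
    ∑ i ∈ Finset.range n, ang q p c (κ i) (faceDist p q c (κ i)) = 1 := by
  obtain ⟨x, Y, T, hx, hS, hκ⟩ := hκ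
  have := hS.sum 0
  simpa only [h.gap_outer hx hS, ← hκ, zero_add] using this

theorem inner_add (h : Solid V A p q c) (hκ : InnerKinds V A p q c κ) (i : ℤ) :
    κ (i + 3) = κ i := by
  obtain ⟨x, Y, T, hx, hS, hκ⟩ := hκ
  have := hS.T_add h.toCfg i
  rw [hκ, hκ, ← this]
  rfl

theorem outer_add (h : Solid V A p q c) (hκ : OuterKinds V A p q c n κ) (i : ℤ) :
    κ (i + n) = κ i := by
  obtain ⟨x, Y, T, hx, hS, hκ⟩ := hκ
  rw [hκ, hκ, hS.T_add h.toCfg i]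

theorem exists_innerKinds (h : Solid V A p q c) : ∃ κ, InnerKinds V A p q c κ := by
  obtain ⟨x, hx, hxA⟩ := h.exists_mem
  obtain ⟨Y, T, hS⟩ := h.exists_star_inner hx hxA
  exact ⟨_, x, Y, T, hxA, hS, fun i => rfl⟩

theorem exists_outerKinds (h : Solid V A p q c) (hκ : InnerKinds V A p q c κ) :
    ∃ n κ', OuterKinds V A p q c n κ' ∧ κ' 0 = κ 0 ∧ κ' 1 = κ 1 := by
  obtain ⟨x, Y, T, hx, hS, hκ⟩ := hκ
  have hA := (h.bip _ _ (hS.adj 1)).1 hx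
  obtain ⟨n, Y', T', hS'⟩ := h.exists_star_outer (hS.adj 1).2.1 hA
  obtain ⟨Y'', T'', hS'', -, h0, h1⟩ := h.exists_turn hS 1 hS' (Or.inl rfl)
  exact ⟨n, _, ⟨_, Y'', T'', hA, hS'', fun i => rfl⟩, by rw [h0, hκ, sub_self], by rw [h1, hκ]⟩

theorem exists_innerKinds_of_outerKinds (h : Solid V A p q c) (hκ : OuterKinds V A p q c n κ) :
    ∃ κ', InnerKinds V A p q c κ' ∧ κ' 0 = κ 0 ∧ κ' 1 = κ 1 := by
  obtain ⟨x, Y, T, hx, hS, hκ⟩ := hκ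
  have hA : Y 1 ∈ A := by_contra fun hA => hx ((h.bip _ _ (hS.adj 1)).2 hA)
  obtain ⟨Y', T', hS'⟩ := h.exists_star_inner (hS.adj 1).2.1 hA
  obtain ⟨Y'', T'', hS'', -, h0, h1⟩ := h.exists_turn hS 1 hS' (Or.inr rfl)
  exact ⟨_, ⟨_, Y'', T'', hA, hS'', fun i => rfl⟩, by rw [h0, hκ, sub_self], by rw [h1, hκ]⟩

/-- Passing from a vertex outside `A` to the opposite vertex of a rhombus. -/
theorem exists_opposite (h : Solid V A p q c) (hκ : OuterKinds V A p q c n κ) (h2 : κ 1 = 2) :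
    ∃ κ₁ κ₂ n' κ', InnerKinds V A p q c κ₁ ∧ InnerKinds V A p q c κ₂ ∧ OuterKinds V A p q c n' κ' ∧
      κ₁ 0 = κ 0 ∧ κ₁ 1 = 2 ∧ κ₂ 0 = 2 ∧ κ₂ 1 = κ 2 ∧ κ' 0 = κ₁ 2 ∧ κ' 1 = 2 ∧ κ' 2 = κ₂ 2 := by
  obtain ⟨w, Y, T, hw, hS, hκ⟩ := hκ
  have hA : ∀ i, Y i ∈ A := fun i => by_contra fun hA => hw ((h.bip _ _ (hS.adj i)).2 hA)
  have hT1 : Adj (T 1) w (Y 1) := (hS.adjT _ _).2 (Or.inl rfl)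
  have hT2 : Adj (T 1) w (Y 2) := (hS.adjT _ _).2 (Or.inr rfl)
  have h2' := h2
  rw [hκ] at h2'
  obtain ⟨w', hne, hw1, hw2⟩ := (h.hasType_star hS 1).rhombus h2' w _ _ hT1 hT2 (hS.Y_ne 1)
  obtain ⟨Y₀, T₀, hS₀⟩ := h.exists_star_inner (hS.adj 1).2.1 (hA 1)
  obtain ⟨Y₁, T₁, hS₁, e1, h10, h11⟩ := h.exists_turn hS 1 hS₀ (Or.inr rfl)
  obtain ⟨Y₀, T₀, hS₀⟩ := h.exists_star_inner (hS.adj 2).2.1 (hA 2)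
  obtain ⟨Y₂, T₂, hS₂, e2, h20, h21⟩ := h.exists_turn hS 2 hS₀ (Or.inr rfl)
  norm_num at h10 h20
  have hw1' : w' = Y₁ 2 := by
    have := hw1.symm
    rw [← h11, hS₁.adjT, e1] at this
    exact this.resolve_left hne
  have hw2' : w' = Y₂ 0 := by
    have := hw2.symm
    rw [← h20, hS₂.adjT, zero_add, e2] at this
    exact this.resolve_right hne
  have hw'A := (h.bip _ _ (hS₁.adj 2)).1 (hA 1)
  obtain ⟨n', Y', T', hS'⟩ := h.exists_star_outer (hS₁.adj 2).2.1 hw'A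
  obtain ⟨Y', T', hS', e3, h30, h31⟩ := h.exists_turn hS₁ 2 hS' (Or.inl rfl)
  rw [← hw1'] at hS' hw'A
  norm_num at h30
  rw [h11] at h30
  have e4 : Y' 0 = Y 2 := by
    have := hw2
    rw [← h30, hS'.adjT, zero_add, e3] at this
    exact (this.resolve_right (hS.Y_ne 1).symm).symm
  have h3 : T' (-1) = T₂ 2 := by
    have e5 : Adj (T' (-1)) (Y 2) (Y₂ 0) := by
      rw [← hw2', ← e4]
      exact ((hS'.adjT _ _).2 (Or.inr rfl)).symm
    have e6 := hS'.T_ne 0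
    rcases h.face_eq hS₂ (hS'.face _) e5 with h4 | h4
    · rw [h4]
      exact (hS₂.T_add h.toCfg _).symm
    · rw [zero_sub, h30, h4, h20] at e6
      exact absurd rfl e6
  refine ⟨_, _, n', _, ⟨_, Y₁, T₁, hA 1, hS₁, fun i => rfl⟩, ⟨_, Y₂, T₂, hA 2, hS₂, fun i => rfl⟩,
    ⟨_, _, _, hw'A, hS'.reverse.shift (-2), fun i => rfl⟩, ?_, ?_, ?_, ?_, ?_, ?_, ?_⟩
  · rw [h10, hκ]
  · rw [h11, h2']
  · rw [h20, h2']
  · rw [h21, hκ]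
  · norm_num
    rw [h31]
  · norm_num
    rw [h30, h2']
  · norm_num
    rw [h3]

end Solid

end

section

variable {E : Type*} [NormedAddCommGroup E] [InnerProductSpace ℝ E] [FiniteDimensional ℝ E]

namespace Solid

variable {V : Finset E} {A : Set E} {p q c : ℝ}

theorem innerTypes (h : Solid V A p q c) : InnerTypes (fun k => ∃ t, FaceType p q c k t)
    (fun k => ang p q c k (faceDist p q c k)) (fun k => ang q p c k (faceDist p q c k))
    (fun i j k => ∃ κ, InnerKinds V A p q c κ ∧ κ 0 = i ∧ κ 1 = j ∧ κ 2 = k) := by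
  have hp := h.c_lt_p
  have hq := h.c_lt_q
  have hocc : ∀ k, (∃ t, FaceType p q c k t) → FaceType p q c k (faceDist p q c k) := fun k hk =>
    Classical.epsilon_spec hk
  refine ⟨fun k hk => (hocc k hk).two_le, fun k hk => (hocc k hk).ang_swap_lt hp h.lt,
    fun k hk => (hocc k hk).ang_lt_half hp hq, fun k hk => (hocc k hk).ang_add_gt hp hq,
    fun i j hi hj hij => (hocc i hi).ang_lt (hocc j hj) hp hq hij,
    fun i j hi hj hij => (hocc i hi).symm.ang_lt (hocc j hj).symm hq hp hij, ?_, ?_, ?_, ?_, ?_⟩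
  · obtain ⟨κ, hκ⟩ := h.exists_innerKinds
    exact ⟨_, _, _, κ, hκ, rfl, rfl, rfl⟩
  · rintro i j k ⟨κ, hκ, rfl, rfl, rfl⟩
    exact ⟨_, h.faceType_inner hκ 0⟩
  · rintro i j k ⟨κ, hκ, rfl, rfl, rfl⟩
    exact h.sum_inner hκ
  · rintro i j k ⟨κ, hκ, rfl, rfl, rfl⟩
    refine ⟨_, hκ.reverse.shift (-2), ?_, ?_, ?_⟩
    · norm_num
    · norm_num
    · norm_num
      rw [← h.inner_add hκ]
      rfl
  · rintro i j k ⟨κ, hκ, rfl, rfl, rfl⟩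
    refine ⟨_, hκ.shift 1, rfl, rfl, ?_⟩
    exact h.inner_add hκ 0

theorem outer_card (h : Solid V A p q c) {n : ℕ} {κ : ℤ → ℕ} (hκ : OuterKinds V A p q c n κ) :
    n = 3 ∨ n = 4 ∨ n = 5 := by
  have hn : 3 ≤ n := by
    obtain ⟨x, Y, T, hx, hS, -⟩ := hκ
    exact hS.three_le
  have hi := h.innerTypes
  have hlt : ∀ i, (1 : ℝ) / 6 < ang q p c (κ i) (faceDist p q c (κ i)) := fun i => by
    have hf := h.faceType_outer hκ i
    exact hi.b_two_gt.trans_le (hi.b_le hi.occ_two ⟨_, hf⟩ hf.two_le)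
  have hsum := h.sum_outer hκ
  have h1 : ∑ i ∈ Finset.range n, (1 : ℝ) / 6 < 1 := by
    refine lt_of_lt_of_eq (Finset.sum_lt_sum_of_nonempty ?_ fun i _ => hlt i) hsum
    rw [Finset.nonempty_range_iff]
    omega
  rw [Finset.sum_const, Finset.card_range, nsmul_eq_mul] at h1
  have h2 : (n : ℝ) < 6 := by linarith
  have : n < 6 := by exact_mod_cast h2
  omega

theorem typeSystem (h : Solid V A p q c) : TypeSystem (fun k => ∃ t, FaceType p q c k t)
    (fun k => ang p q c k (faceDist p q c k)) (fun k => ang q p c k (faceDist p q c k))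
    (fun i j k => ∃ κ, InnerKinds V A p q c κ ∧ κ 0 = i ∧ κ 1 = j ∧ κ 2 = k)
    (fun i j k => ∃ κ, OuterKinds V A p q c 3 κ ∧ κ 0 = i ∧ κ 1 = j ∧ κ 2 = k)
    (fun i j k l => ∃ κ, OuterKinds V A p q c 4 κ ∧ κ 0 = i ∧ κ 1 = j ∧ κ 2 = k ∧ κ 3 = l)
    (fun i j k l m => ∃ κ, OuterKinds V A p q c 5 κ ∧ κ 0 = i ∧ κ 1 = j ∧ κ 2 = k ∧ κ 3 = l ∧
      κ 4 = m) := by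
  refine ⟨h.innerTypes, ?_, ?_, ?_, ?_, ?_, ?_, ?_, ?_, ?_, ?_, ?_⟩
  · rintro i j k ⟨κ, hκ, rfl, rfl, rfl⟩
    simpa [Finset.sum_range_succ] using h.sum_outer hκ
  · rintro i j k ⟨κ, hκ, rfl, rfl, rfl⟩
    exact ⟨_, hκ.shift 1, rfl, rfl, h.outer_add hκ 0⟩
  · rintro i j k l ⟨κ, hκ, rfl, rfl, rfl, rfl⟩
    simpa [Finset.sum_range_succ] using h.sum_outer hκ
  · rintro i j k l ⟨κ, hκ, rfl, rfl, rfl, rfl⟩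
    exact ⟨_, hκ.shift 1, rfl, rfl, rfl, h.outer_add hκ 0⟩
  · rintro i j k l m ⟨κ, hκ, rfl, rfl, rfl, rfl, rfl⟩
    simpa [Finset.sum_range_succ] using h.sum_outer hκ
  · rintro i j k l m ⟨κ, hκ, rfl, rfl, rfl, rfl, rfl⟩
    exact ⟨_, hκ.shift 1, rfl, rfl, rfl, rfl, h.outer_add hκ 0⟩
  · rintro i j k ⟨κ, hκ, rfl, rfl, rfl⟩
    obtain ⟨n, κ', hκ', h0, h1⟩ := h.exists_outerKinds hκ
    rcases h.outer_card hκ' with rfl | rfl | rfl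
    · exact Or.inl ⟨_, _, hκ', h0, h1, rfl⟩
    · exact Or.inr (Or.inl ⟨_, _, _, hκ', h0, h1, rfl, rfl⟩)
    · exact Or.inr (Or.inr ⟨_, _, _, _, hκ', h0, h1, rfl, rfl, rfl⟩)
  · rintro i j k ⟨κ, hκ, rfl, rfl, rfl⟩
    obtain ⟨κ', hκ', h0, h1⟩ := h.exists_innerKinds_of_outerKinds hκ
    exact ⟨_, κ', hκ', h0, h1, rfl⟩
  · rintro i j k l ⟨κ, hκ, rfl, rfl, rfl, rfl⟩
    obtain ⟨κ', hκ', h0, h1⟩ := h.exists_innerKinds_of_outerKinds hκ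
    exact ⟨_, κ', hκ', h0, h1, rfl⟩
  · rintro i j k l m ⟨κ, hκ, rfl, rfl, rfl, rfl, rfl⟩
    obtain ⟨κ', hκ', h0, h1⟩ := h.exists_innerKinds_of_outerKinds hκ
    exact ⟨_, κ', hκ', h0, h1, rfl⟩
  · rintro i j l ⟨κ, hκ, rfl, h2, rfl, rfl⟩
    obtain ⟨κ₁, κ₂, n, κ', hκ₁, hκ₂, hκ', e1, e2, e3, e4, e5, e6, e7⟩ := h.exists_opposite hκ h2
    refine ⟨_, _, ⟨κ₁, hκ₁, e1, e2, rfl⟩, ⟨κ₂, hκ₂, e3, e4, rfl⟩, ?_⟩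
    rcases h.outer_card hκ' with rfl | rfl | rfl
    · exact Or.inl ⟨_, hκ', e5, e6, e7⟩
    · exact Or.inr (Or.inl ⟨_, _, hκ', e5, e6, e7, rfl⟩)
    · exact Or.inr (Or.inr ⟨_, _, _, hκ', e5, e6, e7, rfl, rfl⟩)

theorem innerKinds_eq_two (h : Solid V A p q c) {κ : ℤ → ℕ} (hκ : InnerKinds V A p q c κ) (i : ℤ) :
    κ i = 2 := by
  have hall := h.typeSystem.all_two (by
    intro h3 h4 h5 h6
    obtain ⟨t, ht⟩ := h3
    obtain ⟨t', ht'⟩ := h.innerTypes.occ_two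
    have e1 := ht.faceDist_eq h.c_lt_p h.c_lt_q
    have e2 := ht'.faceDist_eq h.c_lt_p h.c_lt_q
    simp only [e1, e2] at h4 h5 h6
    exact ht'.not_near_miss ht h.c_lt_p h.c_lt_q h4 h5 h6)
  have := hall _ _ _ ⟨_, hκ.shift i, rfl, rfl, rfl⟩
  simpa using this

theorem outerKinds_eq_two (h : Solid V A p q c) {n : ℕ} {κ : ℤ → ℕ}
    (hκ : OuterKinds V A p q c n κ) (i : ℤ) : κ i = 2 := by
  obtain ⟨κ', hκ', h0, -⟩ := h.exists_innerKinds_of_outerKinds (hκ.shift i)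
  rw [h.innerKinds_eq_two hκ' 0] at h0
  simpa using h0.symm

theorem eq_cos_of_arccos {x y : ℝ} (h : Real.arccos x = y) (h0 : 0 < y) (hy : y < Real.pi) :
    x = Real.cos y := by
  have h1 : x < 1 := by
    by_contra! hx
    rw [Real.arccos_eq_zero.2 hx] at h
    linarith
  have h2 : -1 < x := by
    by_contra! hx
    rw [Real.arccos_eq_pi.2 hx] at h
    linarith
  rw [← h, Real.cos_arccos h2.le h1.le]

/-- All faces are rhombi, three at each vertex of `A`, and four or five at the other vertices. -/
theorem exists_metric (h : Solid V A p q c) : ∃ n : ℕ, (n = 4 ∨ n = 5) ∧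
    p * q = 4 * c * p - 3 * c ^ 2 ∧
    2 * c * q - p * q - c ^ 2 = (p * q - c ^ 2) * Real.cos (2 * Real.pi / n) ∧
    (∀ x u u', x ∈ A → Adj V x u → Adj V x u' → u ≠ u' → ⟪u, u'⟫_ℝ = 2 * c - q) ∧
    ∀ w ∈ V, w ∉ A → ∃ Y : ℤ → E, (∀ u, Adj V w u ↔ ∃ i, Y i = u) ∧
      (∀ i j, Y i = Y j ↔ (n : ℤ) ∣ i - j) ∧ ∀ i, ⟪Y i, Y (i + 1)⟫_ℝ = 2 * c - p := by
  have hπ := Real.pi_pos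
  have hp := h.c_lt_p
  have hq := h.c_lt_q
  have hi := h.innerTypes
  obtain ⟨t, ht⟩ := hi.occ_two
  have hd : faceDist p q c 2 = c := by rw [ht.faceDist_eq hp hq, ht.eq_c]
  have htc : FaceType p q c 2 c := by have := ht; rwa [ht.eq_c] at this
  obtain ⟨κ, hκ⟩ := h.exists_innerKinds
  have hsum := h.sum_inner hκ
  simp only [h.innerKinds_eq_two hκ, hd] at hsum
  have hba := htc.ang_swap_lt hp h.lt
  have hcos : Real.cos (2 * (Real.pi / (2 : ℕ))) = -1 := by
    rw [Nat.cast_ofNat, mul_div_cancel₀ _ two_ne_zero, Real.cos_pi]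
  have hb : ∀ n κ, OuterKinds V A p q c n κ → n * ang q p c 2 c = 1 := by
    intro n κ hκ
    have := h.sum_outer hκ
    simpa only [h.outerKinds_eq_two hκ, hd, Finset.sum_const, Finset.card_range, nsmul_eq_mul]
      using this
  obtain ⟨n, κ', hκ', -, -⟩ := h.exists_outerKinds hκ
  have hn := hb n κ' hκ'
  have hn45 : n = 4 ∨ n = 5 := by
    refine (h.outer_card hκ').resolve_left ?_
    rintro rfl
    push_cast at hn
    linarith
  have hn4 : (4 : ℝ) ≤ n := by rcases hn45 with rfl | rfl <;> norm_num
  have hs := h.sub_pos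
  have hp0 := h.p_pos
  have hq0 := h.q_pos
  have ha : ang p q c 2 c = 1 / 3 := by linarith
  have hb' : ang q p c 2 c = 1 / n := by
    rw [eq_div_iff (by linarith)]; linarith
  refine ⟨n, hn45, ?_, ?_, ?_, ?_⟩
  · rw [ang, div_eq_iff (by positivity), hcos] at ha
    have h1 := eq_cos_of_arccos ha (by positivity) (by linarith)
    rw [show 1 / 3 * (2 * Real.pi) = Real.pi - Real.pi / 3 by ring, Real.cos_pi_sub,
      Real.cos_pi_div_three, div_eq_iff (by
        rw [sub_ne_zero, ne_comm]
        refine ne_of_lt ?_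
        rw [div_lt_iff₀ hp0]
        linarith)] at h1
    field_simp at h1
    linarith
  · rw [ang, div_eq_iff (by positivity), hcos] at hb'
    have h1 := eq_cos_of_arccos hb' (by positivity) (by
      rw [one_div, inv_mul_lt_iff₀ (by linarith)]
      nlinarith)
    rw [show 1 / (n : ℝ) * (2 * Real.pi) = 2 * Real.pi / n by ring, div_eq_iff (by
        rw [sub_ne_zero, ne_comm]
        refine ne_of_lt ?_
        rw [div_lt_iff₀ hq0]
        linarith)] at h1
    generalize Real.cos (2 * Real.pi / n) = C at h1 ⊢
    field_simp at h1
    linarith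
  · intro x u u' hx hu hu' hne
    obtain ⟨Y, T, hS⟩ := h.exists_star_inner hu.1 hx
    obtain ⟨i, rfl⟩ := hS.surj u hu
    obtain ⟨j, rfl⟩ := hS.surj u' hu'
    have key : ∀ i, ⟪Y i, Y (i + 1)⟫_ℝ = 2 * c - q := by
      intro i
      have hk := h.hasType_star hS i
      rw [show faceKind A p q c (T i) = 2 from
        h.innerKinds_eq_two ⟨x, Y, T, hx, hS, fun i => rfl⟩ i, hd] at hk
      rw [hk.inner₁ x _ _ hx ((hS.adjT _ _).2 (Or.inl rfl)) ((hS.adjT _ _).2 (Or.inr rfl))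
        (hS.Y_ne i), hcos]
      ring
    have h2 : Y j = Y (i + 1) ∨ Y i = Y (j + 1) := by
      rw [Ne, hS.eq_iff] at hne
      rw [hS.eq_iff, hS.eq_iff]
      push_cast at hne ⊢
      omega
    rcases h2 with h2 | h2
    · rw [h2, key]
    · rw [h2, real_inner_comm, key]
  · intro w hw hwA
    obtain ⟨n', Y, T, hS⟩ := h.exists_star_outer hw hwA
    have hκ : OuterKinds V A p q c n' fun i => faceKind A p q c (T i) :=
      ⟨w, Y, T, hwA, hS, fun i => rfl⟩
    have h1 := hb _ _ hκ
    have h2 : n' = n := by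
      rw [hb', mul_one_div, div_eq_one_iff_eq (by linarith)] at h1
      exact_mod_cast h1
    subst h2
    refine ⟨Y, fun u => ⟨hS.surj u, ?_⟩, hS.eq_iff, fun i => ?_⟩
    · rintro ⟨i, rfl⟩
      exact hS.adj i
    · have hk := h.hasType_star hS i
      rw [show faceKind A p q c (T i) = 2 from h.outerKinds_eq_two hκ i, hd] at hk
      rw [hk.inner₂ w _ _ hwA ((hS.adjT _ _).2 (Or.inl rfl)) ((hS.adjT _ _).2 (Or.inr rfl))
        (hS.Y_ne i), hcos]
      ring

end Solid

end

section

variable {E : Type*} [NormedAddCommGroup E] [InnerProductSpace ℝ E] [FiniteDimensional ℝ E]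
  {V : Finset E} {A : Set E} {p q c : ℝ}

theorem Solid.three_mul_sub_le (h : Solid V A p q c) : 3 * (p - q) ≤ -(p + q - 2 * c) := by
  obtain ⟨n, hn, h1, h2, -⟩ := h.exists_metric
  have hp := h.p_pos
  have hs := h.sub_pos
  have hcp := h.c_lt_p
  have hcos : 0 ≤ Real.cos (2 * Real.pi / n) := by
    have hn4 : (4 : ℝ) ≤ n := by rcases hn with rfl | rfl <;> norm_num
    have hπ := Real.pi_pos
    apply Real.cos_nonneg_of_mem_Icc
    constructor
    · have : 0 ≤ 2 * Real.pi / n := by positivity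
      linarith
    · rw [div_le_iff₀ (by linarith)]
      nlinarith
  have h3 : 0 ≤ 2 * c * q - p * q - c ^ 2 := by rw [h2]; exact mul_nonneg hs.le hcos
  have hc : 0 < c := by
    by_contra! hc
    nlinarith [mul_nonneg (neg_nonneg.2 hc) hp.le, sq_nonneg c]
  have h4 : 0 ≤ c * (q - 2 * p + c) := by nlinarith
  have := nonneg_of_mul_nonneg_right h4 hc
  linarith

namespace Cfg

/-- Any two edges at an inner vertex make an angle of cosine at most `-1/3`. -/
theorem inner_edge_le (h : Cfg V A p q c) (hpq : p < q) {v u u' : E}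
    (hdim : 3 ≤ Module.finrank ℝ (vectorSpan ℝ (V : Set E))) (hA : v ∈ A)
    (hu : Adj V v u) (hu' : Adj V v u') (hne : u ≠ u') :
    3 * ⟪u - v, u' - v⟫_ℝ ≤ -(p + q - 2 * c) := by
  classical
  rw [← h.card_nbrs hpq.le hu.1 hA] at hdim
  obtain ⟨I, hI1, hI2, hI3⟩ := Finset.exists_subsuperset_card_eq
    (s := {u, u'}) (t := nbrs V v) (n := 3) (by
      intro y hy
      rw [mem_nbrs]
      rcases Finset.mem_insert.1 hy with rfl | hy
      · exact hu
      · rwa [Finset.mem_singleton.1 hy]) (by rw [Finset.card_pair hne]; omega) hdim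
  obtain ⟨T, hT, hvT, hTadj, hTdim⟩ := h.exists_face_of_subset hpq.le hu.1 hA hI2
  rw [hI3] at hTdim
  obtain ⟨m, hm, -, hC⟩ := h.face_center hT (by omega)
  have hS : Solid (shift T m) {x | x + m ∈ A} (p - ⟪m, m⟫_ℝ) (q - ⟪m, m⟫_ℝ) (c - ⟪m, m⟫_ℝ) := by
    refine ⟨hC, by linarith, fun y hy => ?_, by rwa [vectorSpan_shift]⟩
    rw [vectorSpan_shift]
    have := hm _ (mem_shift.1 hy)
    rwa [add_sub_cancel_right] at this
  have hadj : ∀ y ∈ I, Adj (shift T m) (v - m) (y - m) := fun y hy => by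
    rw [adj_shift, sub_add_cancel, sub_add_cancel]
    exact (hTadj y).2 hy
  have e1 := hadj u (hI1 (Finset.mem_insert_self _ _))
  have e2 := hadj u' (hI1 (Finset.mem_insert_of_mem (Finset.mem_singleton_self _)))
  have hAm : v - m ∈ {x | x + m ∈ A} := by
    rw [Set.mem_ofPred_eq, sub_add_cancel]
    exact hA
  obtain ⟨-, -, -, -, hin, -⟩ := hS.exists_metric
  have h1 := hin _ _ _ hAm e1 e2 (by rwa [Ne, sub_left_inj])
  have h2 := hS.three_mul_sub_le
  have h3 := hC.inner _ _ e1
  have h4 := hC.inner _ _ e2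
  have h5 := hC.norm1 _ e1.1 hAm
  rw [show u - v = (u - m) - (v - m) by abel, show u' - v = (u' - m) - (v - m) by abel,
    inner_sub_left, inner_sub_right _ _ (v - m), inner_sub_right _ _ (v - m), h1, h4, h5,
    real_inner_comm (v - m), h3]
  linarith

theorem finrank_le_three (h : Cfg V A p q c) (hpq : p < q) :
    Module.finrank ℝ (vectorSpan ℝ (V : Set E)) ≤ 3 := by
  classical
  by_contra! hdim
  obtain ⟨v, hv, hA⟩ := h.exists_mem
  have hcard := h.card_nbrs hpq.le hv hA
  obtain ⟨I, hI, hI4⟩ := Finset.exists_subset_card_eq (s := nbrs V v) (n := 4) (by omega)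
  have hadj : ∀ u ∈ I, Adj V v u := fun u hu => mem_nbrs.1 (hI hu)
  have hself : ∀ u ∈ I, ⟪u - v, u - v⟫_ℝ = p + q - 2 * c := by
    intro u hu
    have h1 := h.inner _ _ (hadj u hu)
    have h2 := real_inner_comm u v
    rw [inner_sub_left, inner_sub_right, inner_sub_right, h.norm1 v hv hA,
      h.norm2 u (hadj u hu).2.1 ((h.bip _ _ (hadj u hu)).1 hA)]
    linarith
  have hle : ∀ u ∈ I, ∑ u' ∈ I, ⟪u - v, u' - v⟫_ℝ ≤ 0 := by
    intro u hu
    rw [← Finset.add_sum_erase _ _ hu, hself u hu]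
    have : ∑ u' ∈ I.erase u, ⟪u - v, u' - v⟫_ℝ ≤ ∑ u' ∈ I.erase u, -(p + q - 2 * c) / 3 :=
      Finset.sum_le_sum fun u' hu' => by
        have := h.inner_edge_le hpq hdim.le hA (hadj u hu) (hadj u' (Finset.mem_of_mem_erase hu'))
          (Finset.ne_of_mem_erase hu').symm
        linarith
    rw [Finset.sum_const, Finset.card_erase_of_mem hu, hI4] at this
    norm_num at this
    linarith
  have hzero : ∑ u ∈ I, (u - v) = 0 := by
    by_contra hne
    refine (real_inner_self_pos.2 hne).not_ge ?_
    rw [sum_inner]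
    refine Finset.sum_nonpos fun u hu => ?_
    rw [inner_sum]
    exact hle u hu
  have h1 : ⟪v, ∑ u ∈ I, (u - v)⟫_ℝ = 0 := by rw [hzero, inner_zero_right]
  rw [inner_sum, Finset.sum_congr rfl fun u hu => by
    rw [inner_sub_right, h.inner _ _ (hadj u hu), h.norm1 v hv hA], Finset.sum_const, hI4] at h1
  have := h.c_lt_p
  norm_num at h1
  linarith

end Cfg

end

section

theorem linearIndependent_pair_of_gram {v w : E} (h : 0 < ⟪v, v⟫_ℝ * ⟪w, w⟫_ℝ - ⟪v, w⟫_ℝ ^ 2) :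
    LinearIndependent ℝ ![v, w] := by
  rw [LinearIndependent.pair_iff]
  intro s t hst
  have h1 : ⟪v, s • v + t • w⟫_ℝ = 0 := by rw [hst, inner_zero_right]
  have h2 : ⟪w, s • v + t • w⟫_ℝ = 0 := by rw [hst, inner_zero_right]
  simp only [inner_add_right, real_inner_smul_right] at h1 h2
  rw [real_inner_comm v w] at h2
  have e1 : s * (⟪v, v⟫_ℝ * ⟪w, w⟫_ℝ - ⟪v, w⟫_ℝ ^ 2) = 0 := by
    linear_combination ⟪w, w⟫_ℝ * h1 - ⟪v, w⟫_ℝ * h2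
  have e2 : t * (⟪v, v⟫_ℝ * ⟪w, w⟫_ℝ - ⟪v, w⟫_ℝ ^ 2) = 0 := by
    linear_combination ⟪v, v⟫_ℝ * h2 - ⟪v, w⟫_ℝ * h1
  exact ⟨(mul_eq_zero.1 e1).resolve_right h.ne', (mul_eq_zero.1 e2).resolve_right h.ne'⟩

/-- In dimension three a vector of given length is determined up to two possibilities by its inner
products with two independent vectors. -/
theorem eq_or_eq_of_inner (hE : Module.finrank ℝ E = 3) {v w y y₁ y₂ : E} {a b s : ℝ}
    (h : 0 < ⟪v, v⟫_ℝ * ⟪w, w⟫_ℝ - ⟪v, w⟫_ℝ ^ 2)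
    (hv : ⟪v, y⟫_ℝ = a) (hw : ⟪w, y⟫_ℝ = b) (hs : ⟪y, y⟫_ℝ = s)
    (hv₁ : ⟪v, y₁⟫_ℝ = a) (hw₁ : ⟪w, y₁⟫_ℝ = b) (hs₁ : ⟪y₁, y₁⟫_ℝ = s)
    (hv₂ : ⟪v, y₂⟫_ℝ = a) (hw₂ : ⟪w, y₂⟫_ℝ = b) (hs₂ : ⟪y₂, y₂⟫_ℝ = s)
    (hne : y₁ ≠ y₂) : y = y₁ ∨ y = y₂ := by
  have : FiniteDimensional ℝ E := .of_finrank_pos (by omega)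
  set K := Submodule.span ℝ (Set.range ![v, w])
  have hK : Module.finrank ℝ K = 2 := by
    simpa using finrank_span_eq_card (linearIndependent_pair_of_gram h)
  have hK' : Module.finrank ℝ Kᗮ = 1 := by
    have := K.finrank_add_finrank_orthogonal
    omega
  have hmem : ∀ z : E, ⟪v, z⟫_ℝ = 0 → ⟪w, z⟫_ℝ = 0 → z ∈ Kᗮ := by
    intro z h1 h2
    rw [Submodule.mem_orthogonal]
    intro u hu
    induction hu using Submodule.span_induction with
    | mem u hu =>
      obtain ⟨i, rfl⟩ := hu
      fin_cases i
      · exact h1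
      · exact h2
    | zero => exact inner_zero_left _
    | add x y _ _ hx hy => rw [inner_add_left, hx, hy, add_zero]
    | smul r x _ hx => rw [real_inner_smul_left, hx, mul_zero]
  have h1 : y - y₁ ∈ Kᗮ := hmem _ (by rw [inner_sub_right, hv, hv₁, sub_self])
    (by rw [inner_sub_right, hw, hw₁, sub_self])
  have h2 : y₂ - y₁ ∈ Kᗮ := hmem _ (by rw [inner_sub_right, hv₂, hv₁, sub_self])
    (by rw [inner_sub_right, hw₂, hw₁, sub_self])
  have h2ne : (⟨y₂ - y₁, h2⟩ : Kᗮ) ≠ 0 := fun h0 =>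
    hne (sub_eq_zero.1 (congrArg Subtype.val h0)).symm
  obtain ⟨t, ht⟩ := (finrank_eq_one_iff_of_nonzero' _ h2ne).1 hK' ⟨y - y₁, h1⟩
  replace ht : t • (y₂ - y₁) = y - y₁ := congrArg Subtype.val ht
  have hy : y = y₁ + t • (y₂ - y₁) := by rw [ht]; abel
  have hy₂ : ⟪y₁ + (y₂ - y₁), y₁ + (y₂ - y₁)⟫_ℝ = s := by rwa [add_sub_cancel]
  rw [hy] at hs
  have hpos : ⟪y₂ - y₁, y₂ - y₁⟫_ℝ ≠ 0 := by
    rw [Ne, inner_self_eq_zero, sub_eq_zero]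
    exact hne.symm
  rw [real_inner_add_add_self] at hs hy₂
  simp only [real_inner_smul_left, real_inner_smul_right] at hs
  have : t * (t - 1) * ⟪y₂ - y₁, y₂ - y₁⟫_ℝ = 0 := by
    linear_combination hs - t * hy₂ + (t - 1) * hs₁
  rcases mul_eq_zero.1 ((mul_eq_zero.1 this).resolve_right hpos) with h0 | h0
  · exact .inl (by rw [hy, h0, zero_smul, add_zero])
  · exact .inr (by rw [hy, sub_eq_zero.1 h0, one_smul, add_sub_cancel])

/-- Two vectors can be moved by an isometry to any two vectors with the same Gram matrix. -/
theorem exists_isometry_pair {v w v' w' : E} (h1 : ⟪v, v⟫_ℝ = ⟪v', v'⟫_ℝ)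
    (h2 : ⟪w, w⟫_ℝ = ⟪w', w'⟫_ℝ) (h3 : ⟪v, w⟫_ℝ = ⟪v', w'⟫_ℝ) :
    ∃ T : E ≃ₗᵢ[ℝ] E, T v = v' ∧ T w = w' := by
  have hv : refl (v' - v) v = v' := refl_sub_eq h1
  set R := refl (v' - v)
  have hR : ⟪R w, R w⟫_ℝ = ⟪w', w'⟫_ℝ := by rw [R.inner_map_map, h2]
  refine ⟨R.trans (refl (w' - R w)), ?_, ?_⟩
  · rw [LinearIsometryEquiv.trans_apply, hv, refl_apply, inner_sub_left]
    have : ⟪R w, v'⟫_ℝ = ⟪w', v'⟫_ℝ := by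
      rw [← hv, R.inner_map_map, hv, real_inner_comm, h3, real_inner_comm]
    rw [this, sub_self, mul_zero, zero_div, zero_smul, sub_zero]
  · exact refl_sub_eq hR

/-- A labelled family of points whose incidences agree locally with those of a solid. -/
structure Chart {ι : Type*} (F : ι → E) (Q₁ Q₂ : List ι) (M : ι → ι → Bool) (p q c : ℝ) (n : ℕ) :
    Prop where
  norm1 : ∀ x ∈ Q₁, ⟪F x, F x⟫_ℝ = p
  norm2 : ∀ y ∈ Q₂, ⟪F y, F y⟫_ℝ = q
  inner : ∀ x ∈ Q₁, ∀ y ∈ Q₂, M x y → ⟪F x, F y⟫_ℝ = c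
  next1 : ∀ x ∈ Q₁, ∀ y ∈ Q₂, M x y → ∃ z₁ ∈ Q₂, ∃ z₂ ∈ Q₂, M x z₁ ∧ M x z₂ ∧ F z₁ ≠ F z₂ ∧
    ⟪F y, F z₁⟫_ℝ = 2 * c - q ∧ ⟪F y, F z₂⟫_ℝ = 2 * c - q
  next2 : ∀ y ∈ Q₂, ∀ x ∈ Q₁, M x y → ∃ z₁ ∈ Q₁, ∃ z₂ ∈ Q₁, M z₁ y ∧ M z₂ y ∧ F z₁ ≠ F z₂ ∧
    ⟪F x, F z₁⟫_ℝ = 2 * c - p ∧ ⟪F x, F z₂⟫_ℝ = 2 * c - p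
  card1 : ∀ x ∈ Q₁, (Q₂.filter fun y => M x y).length ≤ 3
  card2 : ∀ y ∈ Q₂, (Q₁.filter fun x => M x y).length ≤ n
  conn : ∀ S : ι → Prop, (∀ x ∈ Q₁, ∀ y ∈ Q₂, M x y → (S x ↔ S y)) →
    ∀ x ∈ Q₁ ++ Q₂, ∀ y ∈ Q₁ ++ Q₂, S x → S y

theorem adj_of_filter {ι : Type*} {F : ι → E} {V : Finset E} {v : E} {Q : List ι} {m : ι → Bool}
    (h : ∀ u, Adj V v u → ∃ y ∈ Q, m y ∧ u = F y) (hc : (Q.filter m).length ≤ (nbrs V v).card)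
    {y : ι} (hy : y ∈ Q) (hm : m y) : Adj V v (F y) := by
  classical
  have hsub : nbrs V v ⊆ ((Q.filter m).map F).toFinset := by
    intro u hu
    obtain ⟨y, hy, hm, rfl⟩ := h u (mem_nbrs.1 hu)
    exact List.mem_toFinset.2 (List.mem_map.2 ⟨y, List.mem_filter.2 ⟨hy, hm⟩, rfl⟩)
  have heq := Finset.eq_of_subset_of_card_le hsub
    ((List.toFinset_card_le _).trans (by rwa [List.length_map]))
  rw [← mem_nbrs, heq]
  exact List.mem_toFinset.2 (List.mem_map.2 ⟨y, List.mem_filter.2 ⟨hy, hm⟩, rfl⟩)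

namespace Chart

variable {ι : Type*} {F : ι → E} {Q₁ Q₂ : List ι} {M : ι → ι → Bool} {p q c : ℝ} {n : ℕ}
  {V : Finset E} {A : Set E}

theorem exists_of_adj1 (hF : Chart F Q₁ Q₂ M p q c n) (h : Cfg V A p q c)
    (hE : Module.finrank ℝ E = 3)
    (hin : ∀ x u u', x ∈ A → Adj V x u → Adj V x u' → u ≠ u' → ⟪u, u'⟫_ℝ = 2 * c - q)
    {x y : ι} (hx : x ∈ Q₁) (hy : y ∈ Q₂) (hxy : M x y) (hA : F x ∈ A) (hadj : Adj V (F x) (F y))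
    {u : E} (hu : Adj V (F x) u) : ∃ z ∈ Q₂, M x z ∧ u = F z := by
  by_cases huy : u = F y
  · exact ⟨y, hy, hxy, huy⟩
  obtain ⟨z₁, hz₁, z₂, hz₂, hM₁, hM₂, hne, hi₁, hi₂⟩ := hF.next1 x hx y hy hxy
  have huA : u ∉ A := (h.bip _ _ hu).1 hA
  rcases eq_or_eq_of_inner hE (v := F x) (w := F y) (y := u)
    (by rw [hF.norm1 x hx, hF.norm2 y hy, hF.inner x hx y hy hxy]; exact h.sub_pos)
    (h.inner _ _ hu) (hin _ _ _ hA hadj hu (Ne.symm huy)) (h.norm2 u hu.2.1 huA)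
    (hF.inner x hx _ hz₁ hM₁) hi₁ (hF.norm2 _ hz₁)
    (hF.inner x hx _ hz₂ hM₂) hi₂ (hF.norm2 _ hz₂) hne with rfl | rfl
  · exact ⟨z₁, hz₁, hM₁, rfl⟩
  · exact ⟨z₂, hz₂, hM₂, rfl⟩

theorem exists_of_adj2 (hF : Chart F Q₁ Q₂ M p q c n) (h : Cfg V A p q c)
    (hE : Module.finrank ℝ E = 3) {x y : ι} (hx : x ∈ Q₁) (hy : y ∈ Q₂) (hxy : M x y)
    (hA : F y ∉ A) (hadj : Adj V (F y) (F x)) {Y : ℤ → E}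
    (hY : ∀ u, Adj V (F y) u ↔ ∃ i, Y i = u) (hYi : ∀ i, ⟪Y i, Y (i + 1)⟫_ℝ = 2 * c - p)
    {u : E} (hu : Adj V (F y) u) : ∃ z ∈ Q₁, M z y ∧ u = F z := by
  have hYA : ∀ i, Adj V (F y) (Y i) := fun i => (hY _).2 ⟨i, rfl⟩
  have step : ∀ i j, ⟪Y i, Y j⟫_ℝ = 2 * c - p → (∃ z ∈ Q₁, M z y ∧ Y i = F z) →
      ∃ z ∈ Q₁, M z y ∧ Y j = F z := by
    rintro i j hij ⟨z, hz, hzy, hi⟩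
    obtain ⟨z₁, hz₁, z₂, hz₂, hM₁, hM₂, hne, hi₁, hi₂⟩ := hF.next2 y hy z hz hzy
    have hjA : Y j ∈ A := by
      have := h.bip _ _ (hYA j)
      tauto
    have hc : ∀ z ∈ Q₁, M z y → ⟪F y, F z⟫_ℝ = c := fun z hz hzy => by
      rw [real_inner_comm, hF.inner z hz y hy hzy]
    rcases eq_or_eq_of_inner hE (v := F y) (w := F z) (y := Y j)
      (by rw [hF.norm1 z hz, hF.norm2 y hy, hc z hz hzy, mul_comm]; exact h.sub_pos)
      (h.inner _ _ (hYA j)) (by rw [← hi, hij]) (h.norm1 _ (hYA j).2.1 hjA)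
      (hc _ hz₁ hM₁) hi₁ (hF.norm1 _ hz₁) (hc _ hz₂ hM₂) hi₂ (hF.norm1 _ hz₂) hne with h | h
    · exact ⟨z₁, hz₁, hM₁, h⟩
    · exact ⟨z₂, hz₂, hM₂, h⟩
  obtain ⟨i, hi⟩ := (hY _).1 hadj
  obtain ⟨j, rfl⟩ := (hY _).1 hu
  induction j using Int.inductionOn' (b := i) with
  | zero => exact ⟨x, hx, hxy, hi⟩
  | succ k _ ih => exact step k (k + 1) (hYi k) (ih (hYA k))
  | pred k _ ih =>
    refine step k (k - 1) ?_ (ih (hYA k))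
    rw [real_inner_comm]
    simpa using hYi (k - 1)

theorem coe_eq_image (hF : Chart F Q₁ Q₂ M p q c n) (h : Cfg V A p q c) (hpq : p < q)
    (hE : Module.finrank ℝ E = 3) (hcard : ∀ v ∈ V, v ∈ A → (nbrs V v).card = 3)
    (hin : ∀ x u u', x ∈ A → Adj V x u → Adj V x u' → u ≠ u' → ⟪u, u'⟫_ℝ = 2 * c - q)
    (hout : ∀ w ∈ V, w ∉ A → ∃ Y : ℤ → E, (∀ u, Adj V w u ↔ ∃ i, Y i = u) ∧
      (∀ i j, Y i = Y j ↔ (n : ℤ) ∣ i - j) ∧ ∀ i, ⟪Y i, Y (i + 1)⟫_ℝ = 2 * c - p)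
    {x₀ y₀ : ι} (hx₀ : x₀ ∈ Q₁) (hy₀ : y₀ ∈ Q₂) (hM₀ : M x₀ y₀) (hA₀ : F x₀ ∈ A)
    (hadj₀ : Adj V (F x₀) (F y₀)) : (V : Set E) = F '' {x | x ∈ Q₁ ++ Q₂} := by
  set G₁ : ι → Prop := fun x => x ∈ Q₁ ∧ F x ∈ A ∧ ∃ y ∈ Q₂, M x y ∧ Adj V (F x) (F y)
  set G₂ : ι → Prop := fun y => y ∈ Q₂ ∧ F y ∉ A ∧ ∃ x ∈ Q₁, M x y ∧ Adj V (F y) (F x)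
  have s1 : ∀ x, G₁ x → ∀ u, Adj V (F x) u → ∃ z ∈ Q₂, M x z ∧ u = F z := by
    rintro x ⟨hx, hA, y, hy, hxy, hadj⟩ u hu
    exact hF.exists_of_adj1 h hE hin hx hy hxy hA hadj hu
  have s2 : ∀ y, G₂ y → ∀ u, Adj V (F y) u → ∃ z ∈ Q₁, M z y ∧ u = F z := by
    rintro y ⟨hy, hA, x, hx, hxy, hadj⟩ u hu
    obtain ⟨Y, h1, _, h3⟩ := hout _ hadj.1 hA
    exact hF.exists_of_adj2 h hE hx hy hxy hA hadj h1 h3 hu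
  have t1 : ∀ x, G₁ x → ∀ y ∈ Q₂, M x y → Adj V (F x) (F y) → G₂ y :=
    fun x hx y hy hxy hadj => ⟨hy, (h.bip _ _ hadj).1 hx.2.1, x, hx.1, hxy, hadj.symm⟩
  have t2 : ∀ y, G₂ y → ∀ x ∈ Q₁, M x y → Adj V (F y) (F x) → G₁ x :=
    fun y hy x hx hxy hadj => ⟨hx, (h.bip _ _ hadj.symm).2 hy.2.1, y, hy.1, hxy, hadj.symm⟩
  have hG₀ : G₁ x₀ := ⟨hx₀, hA₀, y₀, hy₀, hM₀, hadj₀⟩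
  refine Set.Subset.antisymm (fun u hu => ?_) ?_
  · have := h.pos.mem_of_adj_closed (C := {v | ∃ x, (G₁ x ∨ G₂ x) ∧ v = F x}) ?_ hadj₀.1
      ⟨x₀, .inl hG₀, rfl⟩ hu
    · obtain ⟨x, hx, rfl⟩ := this
      refine ⟨x, ?_, rfl⟩
      rcases hx with hx | hx
      · exact List.mem_append_left _ hx.1
      · exact List.mem_append_right _ hx.1
    · rintro v - ⟨x, hx | hx, rfl⟩ w hw
      · obtain ⟨z, hz, hxz, rfl⟩ := s1 x hx w hw
        exact ⟨z, .inr (t1 x hx z hz hxz hw), rfl⟩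
      · obtain ⟨z, hz, hxz, rfl⟩ := s2 x hx w hw
        exact ⟨z, .inl (t2 x hx z hz hxz hw), rfl⟩
  · rintro _ ⟨x, hx, rfl⟩
    have hclosed : ∀ x ∈ Q₁, ∀ y ∈ Q₂, M x y → (G₁ x ∨ G₂ x ↔ G₁ y ∨ G₂ y) := by
      intro x hx y hy hxy
      have hx2 : ¬G₂ x := fun h2 => hpq.ne (by rw [← hF.norm1 x hx, hF.norm2 x h2.1])
      have hy1 : ¬G₁ y := fun h1 => hpq.ne (by rw [← hF.norm1 y h1.1, hF.norm2 y hy])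
      rw [or_iff_left hx2, or_iff_right hy1]
      constructor
      · intro hG
        refine t1 x hG y hy hxy (adj_of_filter (s1 x hG) ?_ hy hxy)
        obtain ⟨_, hA, _, _, _, hadj⟩ := hG
        rw [hcard _ hadj.1 hA]
        exact hF.card1 x hx
      · intro hG
        refine t2 y hG x hx hxy (adj_of_filter (s2 y hG) ((hF.card2 y hy).trans ?_) hx hxy)
        obtain ⟨_, hA, _, _, _, hadj⟩ := hG
        obtain ⟨Y, h1, h2, -⟩ := hout _ hadj.1 hA
        rw [← Finset.card_range n]
        refine Finset.card_le_card_of_injOn (fun i => Y i) (fun i _ => mem_nbrs.2 ((h1 _).2 ⟨i, rfl⟩))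
          fun i hi j hj hij => ?_
        have := (h2 _ _).1 hij
        have hi' := Finset.mem_range.1 hi
        have hj' := Finset.mem_range.1 hj
        have h0 := Int.eq_zero_of_abs_lt_dvd this (by rw [abs_lt]; omega)
        omega
    have := hF.conn (fun x => G₁ x ∨ G₂ x) hclosed x₀ (List.mem_append_left _ hx₀) x hx (.inl hG₀)
    rcases this with ⟨_, _, _, _, _, h⟩ | ⟨_, _, _, _, _, h⟩ <;> exact h.1

end Chart

end

section

/-- The element `a + bφ` of `ℤ[φ]`, as a pair of integers. -/
abbrev GoldenInt := ℤ × ℤ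

/-- A point of `ℤ[φ]³`. -/
abbrev GoldenPt := GoldenInt × GoldenInt × GoldenInt

namespace GoldenInt

def mul (x y : GoldenInt) : GoldenInt :=
  (x.1 * y.1 + x.2 * y.2, x.1 * y.2 + x.2 * y.1 + x.2 * y.2)

def dot (x y : GoldenPt) : GoldenInt :=
  ((mul x.1 y.1).1 + (mul x.2.1 y.2.1).1 + (mul x.2.2 y.2.2).1,
    (mul x.1 y.1).2 + (mul x.2.1 y.2.1).2 + (mul x.2.2 y.2.2).2)

/-- The real number represented by a pair. -/
def toReal (x : GoldenInt) : ℝ := x.1 + x.2 * goldenR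

def toEuc (x : GoldenPt) : Euc 3 := pt3 (toReal x.1) (toReal x.2.1) (toReal x.2.2)

theorem goldenR_eq : goldenR = Real.goldenRatio := rfl

theorem goldenR_sq : goldenR ^ 2 = goldenR + 1 := by
  rw [goldenR_eq]
  exact Real.goldenRatio_sq

theorem toReal_injective : Function.Injective toReal := by
  rintro ⟨a, b⟩ ⟨a', b'⟩ h
  simp only [toReal] at h
  have hb : b = b' := by
    by_contra hne
    have hne' : ((b : ℝ) - b') ≠ 0 := sub_ne_zero.2 (by exact_mod_cast hne)
    refine Real.goldenRatio_irrational ⟨(a' - a) / (b - b'), ?_⟩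
    rw [← goldenR_eq]
    push_cast
    rw [div_eq_iff hne']
    linarith
  subst hb
  have : (a : ℝ) = a' := by linarith
  rw [Prod.mk.injEq]
  exact ⟨by exact_mod_cast this, rfl⟩

theorem inner_pt3 (a b c a' b' c' : ℝ) :
    ⟪pt3 a b c, pt3 a' b' c'⟫_ℝ = a * a' + b * b' + c * c' := by
  simp [pt3, PiLp.inner_apply, Fin.sum_univ_three, mul_comm]

theorem pt3_inj {a b c a' b' c' : ℝ} (h : pt3 a b c = pt3 a' b' c') : a = a' ∧ b = b' ∧ c = c' := by
  have h' := (WithLp.equiv 2 (Fin 3 → ℝ)).symm.injective h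
  exact ⟨congrFun h' 0, congrFun h' 1, congrFun h' 2⟩

theorem toEuc_injective : Function.Injective toEuc := by
  rintro ⟨a, b, c⟩ ⟨a', b', c'⟩ h
  obtain ⟨h1, h2, h3⟩ := pt3_inj h
  exact Prod.ext (toReal_injective h1) (Prod.ext (toReal_injective h2) (toReal_injective h3))

theorem inner_toEuc (x y : GoldenPt) : ⟪toEuc x, toEuc y⟫_ℝ = toReal (dot x y) := by
  have := goldenR_sq
  simp only [toEuc, inner_pt3, toReal, dot, mul]
  push_cast
  linear_combination
    ((x.1.2 : ℝ) * y.1.2 + x.2.1.2 * y.2.1.2 + x.2.2.2 * y.2.2.2) * this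

end GoldenInt

open GoldenInt

/-- The decidable part of `Chart` for points with coordinates in `ℤ[φ]`. -/
structure GoldenChart (Q₁ Q₂ : List GoldenPt) (p q c : GoldenInt) (n : ℕ) : Prop where
  norm1 : ∀ x ∈ Q₁, dot x x = p
  norm2 : ∀ y ∈ Q₂, dot y y = q
  next1 : ∀ x ∈ Q₁, ∀ y ∈ Q₂, dot x y = c → ∃ z₁ ∈ Q₂, dot x z₁ = c ∧ dot y z₁ = c + c - q ∧
    ∃ z₂ ∈ Q₂, dot x z₂ = c ∧ dot y z₂ = c + c - q ∧ z₁ ≠ z₂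
  next2 : ∀ y ∈ Q₂, ∀ x ∈ Q₁, dot x y = c → ∃ z₁ ∈ Q₁, dot z₁ y = c ∧ dot x z₁ = c + c - p ∧
    ∃ z₂ ∈ Q₁, dot z₂ y = c ∧ dot x z₂ = c + c - p ∧ z₁ ≠ z₂
  card1 : ∀ x ∈ Q₁, (Q₂.filter fun y => dot x y = c).length ≤ 3
  card2 : ∀ y ∈ Q₂, (Q₁.filter fun x => dot x y = c).length ≤ n
  conn : ∃ (b : GoldenPt) (f : GoldenPt → ℕ),
    (∀ x ∈ Q₁, x = b ∨ ∃ y ∈ Q₂, dot x y = c ∧ f y < f x) ∧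
    ∀ y ∈ Q₂, y = b ∨ ∃ x ∈ Q₁, dot x y = c ∧ f x < f y

theorem toReal_add_sub (c q : GoldenInt) : toReal (c + c - q) = 2 * toReal c - toReal q := by
  simp only [toReal, Prod.fst_sub, Prod.snd_sub, Prod.fst_add, Prod.snd_add]
  push_cast
  ring

theorem GoldenChart.chart {Q₁ Q₂ : List GoldenPt} {p q c : GoldenInt} {n : ℕ}
    (h : GoldenChart Q₁ Q₂ p q c n) {F : GoldenPt → Euc 3} {κ : ℝ} (hinj : Function.Injective F)
    (hF : ∀ x y, ⟪F x, F y⟫_ℝ = κ * toReal (dot x y)) :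
    Chart F Q₁ Q₂ (fun x y => decide (dot x y = c)) (κ * toReal p) (κ * toReal q) (κ * toReal c)
      n where
  norm1 x hx := by rw [hF, h.norm1 x hx]
  norm2 x hx := by rw [hF, h.norm2 x hx]
  inner x _ y _ hxy := by rw [hF, of_decide_eq_true hxy]
  next1 x hx y hy hxy := by
    obtain ⟨z₁, hz₁, h1, h1', z₂, hz₂, h2, h2', hne⟩ := h.next1 x hx y hy (of_decide_eq_true hxy)
    refine ⟨z₁, hz₁, z₂, hz₂, decide_eq_true h1, decide_eq_true h2, hinj.ne hne, ?_, ?_⟩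
    · rw [hF, h1', toReal_add_sub]; ring
    · rw [hF, h2', toReal_add_sub]; ring
  next2 y hy x hx hxy := by
    obtain ⟨z₁, hz₁, h1, h1', z₂, hz₂, h2, h2', hne⟩ := h.next2 y hy x hx (of_decide_eq_true hxy)
    refine ⟨z₁, hz₁, z₂, hz₂, decide_eq_true h1, decide_eq_true h2, hinj.ne hne, ?_, ?_⟩
    · rw [hF, h1', toReal_add_sub]; ring
    · rw [hF, h2', toReal_add_sub]; ring
  card1 := by simpa using h.card1
  card2 := by simpa using h.card2
  conn S hS := by
    obtain ⟨b, f, h1, h2⟩ := h.conn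
    have key : ∀ (k : ℕ), ∀ x ∈ Q₁ ++ Q₂, f x = k → (S x ↔ S b) := by
      intro k
      induction k using Nat.strong_induction_on with
      | _ k ih =>
        rintro x hx rfl
        rcases List.mem_append.1 hx with hx | hx
        · rcases h1 x hx with rfl | ⟨y, hy, hxy, hlt⟩
          · rfl
          · rw [hS x hx y hy (decide_eq_true hxy)]
            exact ih _ hlt y (List.mem_append_right _ hy) rfl
        · rcases h2 x hx with rfl | ⟨y, hy, hxy, hlt⟩
          · rfl
          · rw [← hS y hy x hx (decide_eq_true hxy)]
            exact ih _ hlt y (List.mem_append_left _ hy) rfl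
    intro x hx y hy
    rw [key _ x hx rfl, key _ y hy rfl]
    exact id

def signs : List ℤ := [1, -1]

/-- The points `(±1, ±1, ±1)`. -/
def cubeList : List GoldenPt :=
  signs.flatMap fun s => signs.flatMap fun t => signs.map fun u => ((s, 0), (t, 0), (u, 0))

/-- The points `±2 • eᵢ`. -/
def octaList : List GoldenPt :=
  signs.flatMap fun s =>
    [((s * 2, 0), (0, 0), (0, 0)), ((0, 0), (s * 2, 0), (0, 0)), ((0, 0), (0, 0), (s * 2, 0))]

/-- The cyclic permutations of the coordinates of `(0, ±a, ±b)`. -/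
def cycList (a b : GoldenInt) : List GoldenPt :=
  signs.flatMap fun s => signs.flatMap fun t =>
    [((0, 0), (s * a.1, s * a.2), (t * b.1, t * b.2)),
      ((t * b.1, t * b.2), (0, 0), (s * a.1, s * a.2)),
      ((s * a.1, s * a.2), (t * b.1, t * b.2), (0, 0))]

/-- A decreasing function of a generic linear functional. -/
def height (x : GoldenPt) : ℕ :=
  (1000000 - (100 * (1000 * x.1.1 + 1618 * x.1.2) + 10 * (1000 * x.2.1.1 + 1618 * x.2.1.2) +
    (1000 * x.2.2.1 + 1618 * x.2.2.2))).toNat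

theorem goldenChart_dodecahedron : GoldenChart cubeList octaList (3, 0) (4, 0) (2, 0) 4 where
  norm1 := by decide +kernel
  norm2 := by decide +kernel
  next1 := by decide +kernel
  next2 := by decide +kernel
  card1 := by decide +kernel
  card2 := by decide +kernel
  conn := ⟨((2, 0), (0, 0), (0, 0)), height, by decide +kernel, by decide +kernel⟩

theorem goldenChart_triacontahedron :
    GoldenChart (cubeList ++ cycList (-1, 1) (0, 1)) (cycList (0, 1) (1, 0)) (3, 0) (2, 1) (1, 1)
      5 where
  norm1 := by decide +kernel
  norm2 := by decide +kernel
  next1 := by decide +kernel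
  next2 := by decide +kernel
  card1 := by decide +kernel
  card2 := by decide +kernel
  conn := ⟨((0, 1), (1, 0), (0, 0)), height, by decide +kernel, by decide +kernel⟩

end

section

open GoldenInt

theorem cast_eq_one_or {s : ℤ} (h : s ∈ signs) : (s : ℝ) = 1 ∨ (s : ℝ) = -1 := by
  have : s = 1 ∨ s = -1 := by simpa [signs] using h
  exact_mod_cast this

theorem exists_mem_signs {s : ℝ} (h : s = 1 ∨ s = -1) : ∃ t ∈ signs, (t : ℝ) = s := by
  rcases h with rfl | rfl
  · exact ⟨1, by simp [signs], by simp⟩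
  · exact ⟨-1, by simp [signs], by simp⟩

theorem toEuc_image_cubeList : toEuc '' {x | x ∈ cubeList} = cubeVerts := by
  have hmem : ∀ x, x ∈ cubeList ↔ ∃ s ∈ signs, ∃ t ∈ signs, ∃ u ∈ signs,
      ((s, 0), (t, 0), (u, 0)) = x := fun x => by
    simp only [cubeList, List.mem_flatMap, List.mem_map]
  ext v
  constructor
  · rintro ⟨x, hx, rfl⟩
    obtain ⟨s, hs, t, ht, u, hu, rfl⟩ := (hmem x).1 hx
    exact ⟨s, t, u, cast_eq_one_or hs, cast_eq_one_or ht, cast_eq_one_or hu,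
      by simp [toEuc, toReal]⟩
  · rintro ⟨s, t, u, hs, ht, hu, rfl⟩
    obtain ⟨s, hs', rfl⟩ := exists_mem_signs hs
    obtain ⟨t, ht', rfl⟩ := exists_mem_signs ht
    obtain ⟨u, hu', rfl⟩ := exists_mem_signs hu
    exact ⟨_, (hmem _).2 ⟨s, hs', t, ht', u, hu', rfl⟩, by simp [toEuc, toReal]⟩

theorem toEuc_image_octaList : toEuc '' {x | x ∈ octaList} =
    {pt3 2 0 0, pt3 (-2) 0 0, pt3 0 2 0, pt3 0 (-2) 0, pt3 0 0 2, pt3 0 0 (-2)} := by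
  ext v
  simp [toEuc, toReal, octaList, signs, eq_comm]
  tauto

theorem toEuc_image_cycList (a b : GoldenInt) :
    toEuc '' {x | x ∈ cycList a b} = cycSigns (toReal a) (toReal b) := by
  have hmem : ∀ x, x ∈ cycList a b ↔ ∃ s ∈ signs, ∃ t ∈ signs,
      x = ((0, 0), (s * a.1, s * a.2), (t * b.1, t * b.2)) ∨
      x = ((t * b.1, t * b.2), (0, 0), (s * a.1, s * a.2)) ∨
      x = ((s * a.1, s * a.2), (t * b.1, t * b.2), (0, 0)) := fun x => by
    simp only [cycList, List.mem_flatMap, List.mem_cons, List.not_mem_nil, or_false]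
  have hmul : ∀ (s : ℤ) (c : GoldenInt), toReal (s * c.1, s * c.2) = s * toReal c := fun s c => by
    simp only [toReal]
    push_cast
    ring
  have h0 : toReal (0, 0) = 0 := by simp [toReal]
  ext v
  constructor
  · rintro ⟨x, hx, rfl⟩
    obtain ⟨s, hs, t, ht, h⟩ := (hmem x).1 hx
    refine ⟨s, t, cast_eq_one_or hs, cast_eq_one_or ht, ?_⟩
    rcases h with rfl | rfl | rfl
    · exact .inl (by simp only [toEuc, hmul, h0])
    · exact .inr (.inl (by simp only [toEuc, hmul, h0]))
    · exact .inr (.inr (by simp only [toEuc, hmul, h0]))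
  · rintro ⟨s, t, hs, ht, h⟩
    obtain ⟨s, hs', rfl⟩ := exists_mem_signs hs
    obtain ⟨t, ht', rfl⟩ := exists_mem_signs ht
    rcases h with rfl | rfl | rfl
    · exact ⟨_, (hmem _).2 ⟨s, hs', t, ht', .inl rfl⟩, by simp only [toEuc, hmul, h0]⟩
    · exact ⟨_, (hmem _).2 ⟨s, hs', t, ht', .inr (.inl rfl)⟩, by simp only [toEuc, hmul, h0]⟩
    · exact ⟨_, (hmem _).2 ⟨s, hs', t, ht', .inr (.inr rfl)⟩, by simp only [toEuc, hmul, h0]⟩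

theorem image_append {α β : Type*} (f : α → β) (l l' : List α) :
    f '' {x | x ∈ l ++ l'} = f '' {x | x ∈ l} ∪ f '' {x | x ∈ l'} := by
  rw [← Set.image_union]
  congr 1
  ext x
  exact List.mem_append

theorem rhombicDodecahedron_eq :
    rhombicDodecahedron = convexHull ℝ (toEuc '' {x | x ∈ cubeList ++ octaList}) := by
  rw [image_append, toEuc_image_octaList, rhombicDodecahedron]
  congr 1
  ext v
  simp [toEuc, toReal, cubeList, signs, eq_comm]
  tauto

theorem rhombicTriacontahedron_eq : rhombicTriacontahedron = convexHull ℝ (toEuc ''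
    {x | x ∈ (cubeList ++ cycList (-1, 1) (0, 1)) ++ cycList (0, 1) (1, 0)}) := by
  have h1 : toReal (-1, 1) = 1 / goldenR := by
    have h := goldenR_sq
    have h0 : goldenR ≠ 0 := Real.goldenRatio_ne_zero
    rw [eq_div_iff h0]
    simp only [toReal]
    push_cast
    linarith
  rw [image_append, image_append, toEuc_image_cubeList, toEuc_image_cycList, toEuc_image_cycList,
    rhombicTriacontahedron, h1]
  simp [toReal]

variable {V : Finset (Euc 3)} {A : Set (Euc 3)} {p q c : ℝ}

/-- A solid with the metric data of a chart is similar to the chart. -/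
theorem Solid.exists_similar (h : Solid V A p q c) {Q₁ Q₂ : List GoldenPt} {p' q' c' : GoldenInt}
    {n : ℕ} (hQ : GoldenChart Q₁ Q₂ p' q' c' n) {κ : ℝ} (hκ : 0 < κ) (hp : p = κ * toReal p')
    (hq : q = κ * toReal q') (hc : c = κ * toReal c')
    (hin : ∀ x u u', x ∈ A → Adj V x u → Adj V x u' → u ≠ u' → ⟪u, u'⟫_ℝ = 2 * c - q)
    (hout : ∀ w ∈ V, w ∉ A → ∃ Y : ℤ → Euc 3, (∀ u, Adj V w u ↔ ∃ i, Y i = u) ∧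
      (∀ i j, Y i = Y j ↔ (n : ℤ) ∣ i - j) ∧ ∀ i, ⟪Y i, Y (i + 1)⟫_ℝ = 2 * c - p)
    {x₀ y₀ : GoldenPt} (hx₀ : x₀ ∈ Q₁) (hy₀ : y₀ ∈ Q₂) (hM₀ : dot x₀ y₀ = c') :
    ∃ (T : Euc 3 ≃ₗᵢ[ℝ] Euc 3) (lam : ℝ), 0 < lam ∧
      convexHull ℝ (V : Set (Euc 3)) =
        lam • (T '' convexHull ℝ (toEuc '' {x | x ∈ Q₁ ++ Q₂})) := by
  obtain ⟨v, hv, hvA⟩ := h.exists_mem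
  obtain ⟨w, hvw, -⟩ := h.exists_adj hv 0
  have hwA : w ∉ A := (h.bip _ _ hvw).1 hvA
  set lam := √κ
  have hlam : 0 < lam := Real.sqrt_pos.2 hκ
  have hlam2 : lam * lam = κ := Real.mul_self_sqrt hκ.le
  obtain ⟨T, hTv, hTw⟩ := exists_isometry_pair (v := toEuc x₀) (w := toEuc y₀)
    (v' := lam⁻¹ • v) (w' := lam⁻¹ • w)
    (by
      rw [inner_toEuc, hQ.norm1 _ hx₀, real_inner_smul_left, real_inner_smul_right,
        h.norm1 v hv hvA, hp, ← hlam2]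
      field_simp)
    (by
      rw [inner_toEuc, hQ.norm2 _ hy₀, real_inner_smul_left, real_inner_smul_right,
        h.norm2 w hvw.2.1 hwA, hq, ← hlam2]
      field_simp)
    (by
      rw [inner_toEuc, hM₀, real_inner_smul_left, real_inner_smul_right, h.inner v w hvw, hc,
        ← hlam2]
      field_simp)
  have hE : Module.finrank ℝ (Euc 3) = 3 := by simp
  have hchart := hQ.chart (F := fun x => lam • T (toEuc x)) (κ := κ)
    (fun x y hxy => toEuc_injective (T.injective (smul_right_injective _ hlam.ne' hxy)))
    (fun x y => by
      rw [real_inner_smul_left, real_inner_smul_right, T.inner_map_map, inner_toEuc, ← hlam2,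
        mul_assoc])
  rw [← hp, ← hq, ← hc] at hchart
  have hFv : lam • T (toEuc x₀) = v := by rw [hTv, smul_inv_smul₀ hlam.ne']
  have hFw : lam • T (toEuc y₀) = w := by rw [hTw, smul_inv_smul₀ hlam.ne']
  have hV := hchart.coe_eq_image h.toCfg h.lt hE
    (fun v hv hvA => by rw [h.card_nbrs h.lt.le hv hvA, h.finrank_eq]) hin hout hx₀ hy₀
    (decide_eq_true hM₀) (by rwa [hFv]) (by rwa [hFv, hFw])
  refine ⟨T, lam, hlam, ?_⟩
  have hT : T '' convexHull ℝ (toEuc '' {x | x ∈ Q₁ ++ Q₂}) =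
      convexHull ℝ (T '' (toEuc '' {x | x ∈ Q₁ ++ Q₂})) :=
    T.toLinearEquiv.toLinearMap.image_convexHull _
  rw [hV, hT, ← convexHull_smul, ← Set.image_smul, Set.image_image, Set.image_image]

theorem Solid.similar_rhombic (h : Solid V A p q c) :
    ∃ (T : Euc 3 ≃ₗᵢ[ℝ] Euc 3) (lam : ℝ), 0 < lam ∧
      (convexHull ℝ (V : Set (Euc 3)) = lam • (T '' rhombicDodecahedron) ∨
        convexHull ℝ (V : Set (Euc 3)) = lam • (T '' rhombicTriacontahedron)) := by
  obtain ⟨n, hn, e1, e2, hin, hout⟩ := h.exists_metric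
  have hp := h.p_pos
  have hq := h.q_pos
  have hcp := h.c_lt_p
  have hlt := h.lt
  have hc : 0 < c := by
    by_contra! hc
    nlinarith [mul_pos hp hq, mul_nonneg (neg_nonneg.2 hc) hp.le, sq_nonneg c]
  rcases hn with rfl | rfl
  · rw [show 2 * Real.pi / (4 : ℕ) = Real.pi / 2 by push_cast; ring, Real.cos_pi_div_two] at e2
    have hq' : q = 2 * p - c := by
      apply mul_left_cancel₀ hc.ne'
      linarith
    have hp' : 2 * p = 3 * c := by
      have : (p - c) * (2 * p - 3 * c) = 0 := by rw [hq'] at e1; linear_combination e1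
      have := (mul_eq_zero.1 this).resolve_left (by linarith)
      linarith
    obtain ⟨T, lam, hlam, heq⟩ := h.exists_similar goldenChart_dodecahedron (κ := p / 3)
      (by linarith) (by simp [toReal]) (by simp [toReal]; linarith) (by simp [toReal]; linarith)
      hin hout (x₀ := ((1, 0), (1, 0), (1, 0))) (y₀ := ((2, 0), (0, 0), (0, 0)))
      (by decide) (by decide) (by decide)
    exact ⟨T, lam, hlam, .inl (by rw [heq, rhombicDodecahedron_eq])⟩
  · have hg := goldenR_sq
    have hcos : Real.cos (2 * Real.pi / (5 : ℕ)) = (goldenR - 1) / 2 := by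
      rw [show 2 * Real.pi / (5 : ℕ) = 2 * (Real.pi / 5) by push_cast; ring, Real.cos_two_mul,
        Real.cos_pi_div_five, show (1 + √5) / 4 = goldenR / 2 by rw [goldenR]; ring]
      linear_combination hg / 2
    rw [hcos] at e2
    have hq' : q = 2 * p - c + (p - c) * (goldenR - 1) := by
      apply mul_left_cancel₀ hc.ne'
      rw [e1] at e2
      linear_combination e2 / 2
    have hp' : p * goldenR ^ 2 = 3 * c := by
      have : (p - c) * (p * goldenR ^ 2 - 3 * c) = 0 := by
        rw [hq'] at e1
        linear_combination e1 + (p ^ 2 - c * p) * hg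
      have := (mul_eq_zero.1 this).resolve_left (by linarith)
      linarith
    have hcp' : c = p * (goldenR + 1) / 3 := by rw [← hg]; linarith
    obtain ⟨T, lam, hlam, heq⟩ := h.exists_similar goldenChart_triacontahedron (κ := p / 3)
      (by linarith) (by simp [toReal])
      (by
        simp only [toReal]
        push_cast
        rw [hq', hcp']
        linear_combination - p / 3 * hg)
      (by simp only [toReal]; push_cast; rw [hcp']; ring)
      hin hout (x₀ := ((1, 0), (1, 0), (1, 0))) (y₀ := ((0, 0), (0, 1), (1, 0)))
      (by decide) (by decide) (by decide)
    exact ⟨T, lam, hlam, .inr (by rw [heq, rhombicTriacontahedron_eq])⟩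

end

end BipartitePolytope

theorem bipartite_polytope_classification {d : ℕ} (hd : 2 ≤ d)
    (P : Set (Euc d)) (hP : IsPolytope P) (hfull : FullDim P)
    (hbip : IsBipartite P) :
    (d = 2 ∧ Even (Set.extremePoints ℝ P).ncard) ∨
    (∃ h : d = 3, ∃ (T : Euc 3 ≃ₗᵢ[ℝ] Euc 3) (lam : ℝ), 0 < lam ∧
      (((LinearIsometryEquiv.piLpCongrLeft 2 ℝ ℝ (finCongr h)) '' P
          = lam • (T '' rhombicDodecahedron)) ∨
       ((LinearIsometryEquiv.piLpCongrLeft 2 ℝ ℝ (finCongr h)) '' P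
          = lam • (T '' rhombicTriacontahedron)))) ∨
    IsPermutahedron P := by
  obtain ⟨V₁, V₂, r₁, r₂, l, hbip⟩ := hbip
  obtain ⟨V, c, hV, hPV, hW, h⟩ := BipartitePolytope.exists_cfg hd hP hfull hbip
  have hr₁ : 0 < r₁ := hbip.2.2.2.2.2.1
  rcases hbip.2.2.2.2.2.2.1.eq_or_lt with rfl | hlt
  · rw [hPV]
    exact .inr (.inr (h.isPermutahedron hW))
  have hpq : r₁ ^ 2 < r₂ ^ 2 := by gcongr
  have hfin : Module.finrank ℝ (vectorSpan ℝ (V : Set (Euc d))) = d := by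
    rw [hW, finrank_top, finrank_euclideanSpace_fin]
  have hmem : ∀ u ∈ V, u ∈ vectorSpan ℝ (V : Set (Euc d)) := fun u _ => by
    rw [hW]
    exact Submodule.mem_top
  have hd3 := h.finrank_le_three hpq
  rw [hfin] at hd3
  rcases hd.eq_or_lt with rfl | hd
  · refine .inl ⟨rfl, ?_⟩
    rw [← hV, Set.ncard_coe_finset]
    exact h.even_card hpq.le hmem hfin
  obtain rfl : d = 3 := by omega
  refine .inr (.inl ⟨rfl, ?_⟩)
  have hS : BipartitePolytope.Solid V V₁ (r₁ ^ 2) (r₂ ^ 2) c := ⟨h, hpq, hmem, hfin⟩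
  have hid : (LinearIsometryEquiv.piLpCongrLeft 2 ℝ ℝ (finCongr (rfl : 3 = 3))) '' P = P := by
    have : ∀ x : Euc 3, LinearIsometryEquiv.piLpCongrLeft 2 ℝ ℝ (finCongr (rfl : 3 = 3)) x = x :=
      fun x => rfl
    simp only [this, Set.image_id']
  rw [hid, hPV]
  exact hS.similar_rhombic
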